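/- (Linear relative isoperimetric inequality for involution-free G.) If G contains no element of order 2, w ∈ F is unimodular and k ≥ 2, then there exists a constant C > 0 with the following property: for every finite list L of elements of F, each entry of which lies in ι(G) or equals t or t⁻¹, if the product of L lies in the normal closure of w^k in F, then there exist s ≤ C · |L|_t, elements x₁, …, x_s ∈ F and signs ε₁, …, ε_s ∈ {1, −1} such that the product of L equals x₁ w^{ε₁ k} x₁⁻¹ · … · x_s w^{ε_s k} x_s⁻¹, where |L|_t denotes the number of entries of L equal to t or t⁻¹. (Hence G̃ is relatively hyperbolic with respect to G.) -/

import Mathlib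

/-- `F = G ∗ ⟨t⟩`: the free product of `G` with an infinite cyclic group. -/
abbrev FP (G : Type*) [Group G] : Type _ := Monoid.Coprod G (FreeGroup Unit)

/-- The additional generator `t ∈ F`. -/
def tgen (G : Type*) [Group G] : FP G := Monoid.Coprod.inr (FreeGroup.of ())

/-- The canonical embedding `ι : G → F`. -/
def emb (G : Type*) [Group G] : G →* FP G := Monoid.Coprod.inl

/-- The exponent-sum homomorphism `σ : F → ℤ` killing `G` and sending `t` to `1`. -/
def expSum (G : Type*) [Group G] : FP G →* Multiplicative ℤ :=
  Monoid.Coprod.lift 1 (FreeGroup.lift fun _ => Multiplicative.ofAdd (1 : ℤ))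

/-- A word `w ∈ F` is unimodular if the exponent sum of `t` in `w` is `1`. -/
def Unimodular {G : Type*} [Group G] (w : FP G) : Prop :=
  expSum G w = Multiplicative.ofAdd (1 : ℤ)

namespace RelIso

/-- Non-cancellation properties of short words alternating between an element outside `S`
(or its inverse) and elements of `S`. -/
def NoShortRel {H : Type*} [Group H] (S : Subgroup H) : Prop :=
  ∀ x, x ∉ S →
    (∀ p ∈ S, ∀ q ∈ S, x * p * x * q ≠ 1) ∧
    (∀ p ∈ S, ∀ q ∈ S, p ≠ 1 → q ≠ 1 → x * p * x⁻¹ * q ≠ 1) ∧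
    (∀ p ∈ S, ∀ q ∈ S, ∀ r ∈ S, q ≠ 1 → r ≠ 1 → x * p * x * q * x⁻¹ * r ≠ 1) ∧
    (∀ p ∈ S, ∀ q ∈ S, ∀ r ∈ S, ∀ s ∈ S, p ≠ 1 → q ≠ 1 → r ≠ 1 → s ≠ 1 →
      x * p * x⁻¹ * q * x * r * x⁻¹ * s ≠ 1)

/-- `g` or `g⁻¹`. -/
def sgn {H : Type*} [Group H] (g : H) (s : Bool) : H := bif s then g else g⁻¹

theorem sgn_not_mem {H : Type*} [Group H] {S : Subgroup H} {g : H} (hg : g ∉ S) (s : Bool) :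
    sgn g s ∉ S := by
  cases s <;> simpa [sgn] using hg

/-- A sequence of corners `x j₁ ^ s₁`, ..., `x j ^ s`, consecutive ones being separated by elements
of `S`, together with its number of corners, its value and its weight. -/
inductive CornerSeq {H : Type*} [Group H] (S : Subgroup H) (x : ℕ → H)
    (W : ℕ → Bool → ℕ → Bool → ℤ) (j₁ : ℕ) (s₁ : Bool) :
    ℕ → ℕ → Bool → H → ℤ → Prop
  | single (hx : x j₁ ∉ S) : CornerSeq S x W j₁ s₁ 1 j₁ s₁ (sgn (x j₁) s₁) 0
  | snoc {n j s v w} (h : CornerSeq S x W j₁ s₁ n j s v w) (j₂ : ℕ) (s₂ : Bool) (p : H)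
      (hx : x j₂ ∉ S) (hp : p ∈ S) (hne : j = j₂ → s ≠ s₂ → p ≠ 1) :
      CornerSeq S x W j₁ s₁ (n + 1) j₂ s₂ (v * p * sgn (x j₂) s₂) (w + W j s j₂ s₂)

/-- Conditions on the weights of transitions between corners; `j₀` is the exceptional corner. -/
structure GoodWeight (W : ℕ → Bool → ℕ → Bool → ℤ) (j₀ : ℕ) (σ : Bool) : Prop where
  same : ∀ j j' s, 4 ≤ W j s j' s
  two : ∀ j j' s, j ≠ j' → 12 ≤ W j s j' s + W j' s j s
  six : ∀ j j', 6 ≤ W j σ j' (!σ)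
  exc : ∀ j j', -2 ≤ W j (!σ) j' σ
  exc' : ∀ j j', (j ≠ j₀ ∨ j' ≠ j₀) → 6 ≤ W j (!σ) j' σ
  out : ∀ j, j ≠ j₀ → 8 ≤ W j₀ σ j σ
  into : ∀ j, j ≠ j₀ → 8 ≤ W j (!σ) j₀ (!σ)

section
variable {H : Type*} [Group H] {S : Subgroup H} {x : ℕ → H}
  {W : ℕ → Bool → ℕ → Bool → ℤ} {j₀ : ℕ} {σ : Bool}

theorem GoodWeight.sharp_edge (hW : GoodWeight W j₀ σ) (j j' : ℕ) (s s' : Bool) :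
    (if s = s' then
      (if (s = σ ∧ j = j₀ ∧ j' ≠ j₀) ∨ (s ≠ σ ∧ j ≠ j₀ ∧ j' = j₀) then 8 else 4)
    else if s = σ then 6 else if j = j₀ ∧ j' = j₀ then -2 else 6) ≤ W j s j' s' := by
  split_ifs with h1 h2 h3 h4
  · subst h1
    rcases h2 with ⟨rfl, rfl, h⟩ | ⟨h, h', rfl⟩
    · exact hW.out _ h
    · obtain rfl : s = !σ := Bool.eq_not_of_ne h
      exact hW.into _ h'
  · subst h1
    exact hW.same _ _ _
  · subst h3
    obtain rfl : s' = !s := Bool.eq_not_of_ne (Ne.symm h1)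
    exact hW.six _ _
  · obtain rfl : s = !σ := Bool.eq_not_of_ne h3
    obtain rfl : s' = σ := by simpa using (Bool.eq_not_of_ne (Ne.symm h1))
    exact hW.exc _ _
  · obtain rfl : s = !σ := Bool.eq_not_of_ne h3
    obtain rfl : s' = σ := by simpa using (Bool.eq_not_of_ne (Ne.symm h1))
    exact hW.exc' _ _ (by tauto)

theorem GoodWeight.edge (hW : GoodWeight W j₀ σ) (j j' : ℕ) (s s' : Bool) :
    2 + (if s = σ then 4 else 0) - (if s' = σ then 4 else 0) ≤ W j s j' s' := by
  have h1 := hW.same j j' s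
  have h2 := hW.six j j'
  have h3 := hW.exc j j'
  rcases hσ : σ with _ | _ <;> rcases s with _ | _ <;> rcases s' with _ | _ <;>
    simp_all <;> omega

theorem CornerSeq.le (hW : GoodWeight W j₀ σ) {j₁ s₁ n j s v w}
    (h : CornerSeq S x W j₁ s₁ n j s v w) :
    2 * ((n : ℤ) - 1) + (if s₁ = σ then 4 else 0) - (if s = σ then 4 else 0) ≤ w := by
  induction h with
  | single => simp
  | @snoc n j s v w h j' s' p hx hp hne ih =>
    have := hW.edge j j' s s'
    push_cast
    omega

theorem GoodWeight.five (hW : GoodWeight W j₀ σ) (j1 j2 j3 j4 j5 : ℕ) (s1 s2 s3 s4 s5 : Bool) :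
    12 ≤ 0 + W j1 s1 j2 s2 + W j2 s2 j3 s3 + W j3 s3 j4 s4 + W j4 s4 j5 s5 + W j5 s5 j1 s1 := by
  have h : ∀ j j' s s', (if s = s' then 4 else 2) + (if s = σ then 4 else 0)
      - (if s' = σ then 4 else 0) ≤ W j s j' s' := by
    intro j j' s s'
    have h1 := hW.same j j' s
    have h2 := hW.six j j'
    have h3 := hW.exc j j'
    rcases hσ : σ with _ | _ <;> rcases s with _ | _ <;> rcases s' with _ | _ <;>
      simp_all
  have e1 := h j1 j2 s1 s2
  have e2 := h j2 j3 s2 s3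
  have e3 := h j3 j4 s3 s4
  have e4 := h j4 j5 s4 s5
  have e5 := h j5 j1 s5 s1
  rcases s1 with _ | _ <;> rcases s2 with _ | _ <;> rcases s3 with _ | _ <;>
    rcases s4 with _ | _ <;> rcases s5 with _ | _ <;> simp only [reduceCtorEq, if_true, if_false]
      at * <;>
      omega

theorem closing_two (hS : NoShortRel S) (hW : GoodWeight W j₀ σ) {j1 j2 s1 s2} {p q : H}
    (h1 : x j1 ∉ S) (h2 : x j2 ∉ S) (hp : p ∈ S) (hq : q ∈ S)
    (n1 : j1 = j2 → s1 ≠ s2 → p ≠ 1) (n2 : j2 = j1 → s2 ≠ s1 → q ≠ 1)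
    (hv : sgn (x j1) s1 * p * sgn (x j2) s2 * q = 1) :
    12 ≤ 0 + W j1 s1 j2 s2 + W j2 s2 j1 s1 := by
  by_cases hj : j1 = j2
  · subst hj
    exfalso
    obtain ⟨a, b, -⟩ := hS _ h1
    obtain ⟨a', b', -⟩ := hS (x j1)⁻¹ (by simpa using h1)
    rcases s1 with _ | _ <;> rcases s2 with _ | _ <;> simp [sgn] at *
    · exact a' p hp q hq hv
    · exact b' p hp q hq n1 n2 hv
    · exact b p hp q hq n1 n2 hv
    · exact a p hp q hq hv
  · by_cases hs : s1 = s2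
    · subst hs
      have := hW.two j1 j2 s1 hj
      omega
    · have a1 := hW.six j1 j2
      have a2 := hW.six j2 j1
      have a3 := hW.exc' j1 j2 (by omega)
      have a4 := hW.exc' j2 j1 (by omega)
      rcases hσ : σ with _ | _ <;> rcases s1 with _ | _ <;> rcases s2 with _ | _ <;>
        simp_all <;> omega

theorem closing_three (hS : NoShortRel S) (hW : GoodWeight W j₀ σ) {j1 j2 j3 s1 s2 s3} {p q r : H}
    (h1 : x j1 ∉ S) (hp : p ∈ S) (hq : q ∈ S) (hr : r ∈ S)
    (n1 : j1 = j2 → s1 ≠ s2 → p ≠ 1) (n2 : j2 = j3 → s2 ≠ s3 → q ≠ 1)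
    (n3 : j3 = j1 → s3 ≠ s1 → r ≠ 1)
    (hv : sgn (x j1) s1 * p * sgn (x j2) s2 * q * sgn (x j3) s3 * r = 1) :
    12 ≤ 0 + W j1 s1 j2 s2 + W j2 s2 j3 s3 + W j3 s3 j1 s1 := by
  by_cases hj : j1 = j₀ ∧ j2 = j₀ ∧ j3 = j₀
  · obtain ⟨rfl, rfl, rfl⟩ := hj
    by_cases hs : s1 = s2 ∧ s2 = s3
    · obtain ⟨rfl, rfl⟩ := hs
      have := hW.same j3 j3 s1
      omega
    exfalso
    have rot : ∀ {a b : H}, a * b = 1 → b * a = 1 := fun {a b} h => by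
      rw [eq_inv_of_mul_eq_one_right h]; simp
    have hv2 := rot (a := sgn (x j3) s1 * p) (b := sgn (x j3) s2 * q * sgn (x j3) s3 * r)
      (by simpa only [mul_assoc] using hv)
    have hv3 := rot (a := sgn (x j3) s1 * p * sgn (x j3) s2 * q) (b := sgn (x j3) s3 * r)
      (by simpa only [mul_assoc] using hv)
    have key : ∀ (s : Bool) (p q r : H), p ∈ S → q ∈ S → r ∈ S → q ≠ 1 → r ≠ 1 →
        sgn (x j3) s * p * sgn (x j3) s * q * sgn (x j3) (!s) * r ≠ 1 := by
      intro s p q r hp hq hr hq1 hr1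
      have hinv : sgn (x j3) (!s) = (sgn (x j3) s)⁻¹ := by cases s <;> simp [sgn]
      rw [hinv]
      exact (hS _ (sgn_not_mem h1 s)).2.2.1 p hp q hq r hr hq1 hr1
    simp only [← mul_assoc] at hv2 hv3
    by_cases k1 : s1 = s2
    · subst k1
      have k2 : s3 = !s1 := by revert hs; clear * -; decide +revert
      subst k2
      exact key _ _ _ _ hp hq hr (n2 rfl (by simp)) (n3 rfl (by simp)) hv
    · by_cases k2 : s2 = s3
      · subst k2
        have k3 : s1 = !s2 := by revert k1; clear * -; decide +revert
        subst k3
        exact key _ _ _ _ hq hr hp (n3 rfl (by simp)) (n1 rfl (by simp)) hv2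
      · have k3 : s3 = s1 := by revert k1 k2; clear * -; decide +revert
        subst k3
        have k4 : s2 = !s3 := by revert k2; clear * -; decide +revert
        subst k4
        exact key _ _ _ _ hr hp hq (n1 rfl (by simp)) (n2 rfl (by simp)) hv3
  · have e1 := hW.sharp_edge j1 j2 s1 s2
    have e2 := hW.sharp_edge j2 j3 s2 s3
    have e3 := hW.sharp_edge j3 j1 s3 s1
    rcases hσ : σ with _ | _ <;> rcases s1 with _ | _ <;> rcases s2 with _ | _ <;>
      rcases s3 with _ | _ <;> subst hσ <;>
      simp only [reduceCtorEq, if_true, if_false, true_and, false_and, or_false, false_or, ne_eq,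
        not_true_eq_false, not_false_eq_true] at e1 e2 e3 <;>
      split_ifs at e1 e2 e3 <;> omega

theorem closing_four (hS : NoShortRel S) (hW : GoodWeight W j₀ σ) {j1 j2 j3 j4 s1 s2 s3 s4}
    {p q r t : H}
    (h1 : x j1 ∉ S) (hp : p ∈ S) (hq : q ∈ S) (hr : r ∈ S) (ht : t ∈ S)
    (n1 : j1 = j2 → s1 ≠ s2 → p ≠ 1) (n2 : j2 = j3 → s2 ≠ s3 → q ≠ 1)
    (n3 : j3 = j4 → s3 ≠ s4 → r ≠ 1) (n4 : j4 = j1 → s4 ≠ s1 → t ≠ 1)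
    (hv : sgn (x j1) s1 * p * sgn (x j2) s2 * q * sgn (x j3) s3 * r * sgn (x j4) s4 * t = 1) :
    12 ≤ 0 + W j1 s1 j2 s2 + W j2 s2 j3 s3 + W j3 s3 j4 s4 + W j4 s4 j1 s1 := by
  have a1 := hW.same j1 j2 s1
  have a2 := hW.same j2 j3 s2
  have a3 := hW.same j3 j4 s3
  have a4 := hW.same j4 j1 s4
  have b1 := hW.six j1 j2
  have b2 := hW.six j2 j3
  have b3 := hW.six j3 j4
  have b4 := hW.six j4 j1
  have d1 := hW.exc j1 j2
  have d2 := hW.exc j2 j3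
  have d3 := hW.exc j3 j4
  have d4 := hW.exc j4 j1
  by_cases hs : s1 ≠ s2 ∧ s2 ≠ s3 ∧ s3 ≠ s4
  · obtain ⟨k1, k2, k3⟩ := hs
    have k2' : s2 = !s1 := by revert k1; clear * -; decide +revert
    have k3' : s3 = s1 := by revert k2; rw [k2']; clear * -; decide +revert
    have k4' : s4 = !s1 := by revert k3; rw [k3']; clear * -; decide +revert
    subst k2' k3' k4'
    by_cases hj : j1 = j₀ ∧ j2 = j₀ ∧ j3 = j₀ ∧ j4 = j₀
    · exfalso
      obtain ⟨rfl, rfl, rfl, rfl⟩ := hj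
      obtain ⟨-, -, -, a⟩ := hS _ (sgn_not_mem h1 s3)
      have hinv : sgn (x j4) (!s3) = (sgn (x j4) s3)⁻¹ := by cases s3 <;> simp [sgn]
      rw [hinv] at hv
      exact a p hp q hq r hr t ht (n1 rfl k1) (n2 rfl k2) (n3 rfl k3) (n4 rfl (by simp)) hv
    · have c1 := hW.exc' j1 j2
      have c2 := hW.exc' j2 j3
      have c3 := hW.exc' j3 j4
      have c4 := hW.exc' j4 j1
      rcases hσ : σ with _ | _ <;> rcases s3 with _ | _ <;> simp_all <;> omega
  · rcases hσ : σ with _ | _ <;> rcases s1 with _ | _ <;> rcases s2 with _ | _ <;>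
      rcases s3 with _ | _ <;> rcases s4 with _ | _ <;> simp_all <;> omega

theorem CornerSeq.closing_le (hS : NoShortRel S) (hW : GoodWeight W j₀ σ) {j₁ s₁ n j s v w}
    (h : CornerSeq S x W j₁ s₁ n j s v w) (p : H) (hp : p ∈ S) (hne : j = j₁ → s ≠ s₁ → p ≠ 1)
    (hv : v * p = 1) : 12 ≤ w + W j s j₁ s₁ := by
  have hle := h.le hW
  have hed := hW.edge j j₁ s s₁
  by_cases hn : 6 ≤ n
  · have : (6 : ℤ) ≤ n := by exact_mod_cast hn
    omega
  have hnot : ∀ {g q : H} (s : Bool), g ∉ S → q ∈ S → sgn g s * q ≠ 1 := fun s hg hq e =>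
    sgn_not_mem hg s (by rw [eq_inv_of_mul_eq_one_left e]; exact S.inv_mem hq)
  obtain _ | _ | _ | _ | _ | _ | n := n
  · cases h
  · cases h with
    | single hx => exact absurd hv (hnot _ hx hp)
    | snoc h => cases h
  · cases h with
    | @snoc _ j2 s2 v2 w2 h _ _ p1 hx2 hp1 hne1 => cases h with
      | snoc h => cases h
      | single hx1 => exact closing_two hS hW hx1 hx2 hp1 hp hne1 hne hv
  · cases h with
    | @snoc _ j3 s3 v3 w3 h _ _ p2 hx3 hp2 hne2 => cases h with
      | @snoc _ j2 s2 v2 w2 h _ _ p1 hx2 hp1 hne1 => cases h with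
        | snoc h => cases h
        | single hx1 => exact closing_three hS hW hx1 hp1 hp2 hp hne1 hne2 hne hv
  · cases h with
    | @snoc _ j3 s3 v3 w3 h _ _ p2 hx3 hp2 hne2 => cases h with
      | @snoc _ j2 s2 v2 w2 h _ _ p1 hx2 hp1 hne1 => cases h with
        | @snoc _ j2 s2 v2 w2 h _ _ p0 hx2 hp0 hne0 => cases h with
          | snoc h => cases h
          | single hx1 =>
            exact closing_four hS hW hx1 hp0 hp1 hp2 hp hne0 hne1 hne2 hne hv
  · cases h with
    | @snoc _ j5 s5 _ _ h _ _ _ _ _ _ => cases h with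
      | @snoc _ j4 s4 _ _ h _ _ _ _ _ _ => cases h with
        | @snoc _ j3 s3 _ _ h _ _ _ _ _ _ => cases h with
          | @snoc _ j2 s2 _ _ h _ _ _ _ _ _ => cases h with
            | snoc h => cases h
            | single hx1 => exact hW.five ..
  · omega
end

/-! ### Sides of cells and weights -/

/-- A side of a cell of the diagram or of its boundary. The cells are copies of the relator and
its inverse; `l` is a position in a period of the relator. -/
inductive Side
  | cell (s : Bool) (l : ℕ)
  | bd (u : Option Bool)

/-- The exponent of the stable letter on a side. -/
def Side.ex : Side → Option Bool
  | .cell s l => some (s == decide (l % 2 = 1))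
  | .bd u => u

/-- The side following a given side of a cell. -/
def Side.next (m : ℕ) : Side → Side
  | .cell true l => .cell true (if l = 2 * m + 1 then 1 else l + 1)
  | .cell false l => .cell false (if l = 1 then 2 * m + 1 else l - 1)
  | .bd u => .bd u

/-- Validity of the position of a side. -/
def Side.Valid (m : ℕ) : Side → Prop
  | .cell _ l => 1 ≤ l ∧ l ≤ 2 * m + 1
  | .bd _ => True

/-- Whether a side lies on the boundary. -/
def Side.isBd : Side → Bool
  | .cell _ _ => false
  | .bd _ => true

/-- The weight of a glueing of `d`, the side leaving a vertex, with the side `a` arriving at it. -/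
def glueWt (m : ℕ) : Side → Side → ℤ
  | .cell true l, .cell true l' => if l < l' then 8 else 4
  | .cell false l, .cell false l' => if l' < l then 8 else 4
  | .cell true l, .cell false l' =>
    if l = 1 ∧ l' = 1 then 14 else if l = 2 * m + 1 ∧ l' = 2 * m + 1 then 0 else 6
  | .cell false l, .cell true l' =>
    if l = 1 ∧ l' = 1 then -2 else if l = 2 * m + 1 ∧ l' = 2 * m + 1 then 12 else 6
  | .bd _, _ => 60
  | _, .bd _ => 60

/-- The weight of the corner following a side. -/
def cornerWt (m : ℕ) : Side → ℤ
  | .cell true l => if l = 2 * m + 1 then 7 else 0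
  | .cell false l => if l = 1 then 7 else 0
  | .bd _ => 0

/-- The potential of a side leaving a vertex. -/
def depPot (m : ℕ) (δ : ℤ) : Side → ℤ
  | .cell true l => if l = 1 then -7 else if l % 2 = 1 then 1 else 6
  | .cell false l => if l = 2 * m + 1 then 0 else if l % 2 = 1 then 8 else -1
  | .bd _ => δ

/-- The potential of a side arriving at a vertex. -/
def arrPot (m : ℕ) (δ : ℤ) (a : Side) : ℤ := depPot m δ (a.next m)

/-- Sides with opposite exponents. -/
def Side.Opp (d a : Side) : Prop := ∃ u, d.ex = some u ∧ a.ex = some (!u)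

/-- Sides which are mirror images of each other. -/
def Side.Mirror (d a : Side) : Prop := ∃ s l, d = .cell s l ∧ a = .cell (!s) l

theorem Side.Valid.next {m : ℕ} {a : Side} (h : a.Valid m) : (a.next m).Valid m := by
  rcases a with ⟨_ | _, l⟩ | u <;> simp only [Side.Valid, Side.next] at * <;> split_ifs <;> omega

theorem depPot_bounds (m : ℕ) {δ : ℤ} (h : -7 ≤ δ) (h' : δ ≤ 8) (a : Side) :
    -7 ≤ depPot m δ a ∧ depPot m δ a ≤ 8 := by
  rcases a with ⟨_ | _, l⟩ | u <;> simp only [depPot] <;> (try split_ifs) <;> omega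

theorem cornerWt_bounds (m : ℕ) (a : Side) : 0 ≤ cornerWt m a ∧ cornerWt m a ≤ 7 := by
  rcases a with ⟨_ | _, l⟩ | u <;> simp only [cornerWt] <;> (try split_ifs) <;> omega

theorem Side.Opp.parity {s s' : Bool} {l l' : ℕ} (h : Side.Opp (.cell s l) (.cell s' l')) :
    (l % 2 = l' % 2 ↔ s ≠ s') := by
  obtain ⟨u, h1, h2⟩ := h
  simp only [Side.ex, Option.some.injEq] at h1 h2
  rcases Nat.mod_two_eq_zero_or_one l with k | k <;>
    rcases Nat.mod_two_eq_zero_or_one l' with k' | k' <;>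
    cases s <;> cases s' <;> simp_all

theorem glueWt_bd (m : ℕ) {d a : Side} (h : (d.isBd || a.isBd) = true) : glueWt m d a = 60 := by
  rcases d with ⟨_ | _, l⟩ | u <;> rcases a with ⟨_ | _, l'⟩ | u' <;>
    simp_all [glueWt, Side.isBd]

/-- The slack of a glueing of cells is nonnegative. -/
theorem glueWt_slack {m : ℕ} (hm : 1 ≤ m) {δ : ℤ} (h1 : -7 ≤ δ) (h2 : δ ≤ 8) {d a : Side}
    (hd : d.Valid m) (ha : a.Valid m) (h : Side.Opp d a) :
    arrPot m δ a - depPot m δ d + (if d.isBd || a.isBd then 30 else 0) ≤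
      glueWt m d a - cornerWt m a := by
  have b1 := depPot_bounds m h1 h2 d
  have b2 := depPot_bounds m h1 h2 (a.next m)
  have b3 := cornerWt_bounds m a
  split_ifs with hb
  · rw [glueWt_bd m hb, arrPot]
    omega
  clear b1 b2 b3
  rcases d with ⟨s, l⟩ | u
  swap; · simp [Side.isBd] at hb
  rcases a with ⟨s', l'⟩ | u
  swap; · simp [Side.isBd] at hb
  have hp := h.parity
  simp only [Side.Valid] at hd ha
  clear hb h
  rcases s with _ | _ <;> rcases s' with _ | _ <;>
    simp only [arrPot, Side.next, depPot, glueWt, cornerWt, ne_eq, reduceCtorEq,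
      not_true_eq_false, not_false_eq_true, iff_true, iff_false] at * <;>
    split_ifs <;> omega

/-- Glueing a side to the last side of a period has large slack. -/
theorem glueWt_slack_last {m : ℕ} (hm : 1 ≤ m) {δ : ℤ} {s : Bool} {l : ℕ}
    (hd : (Side.cell s l).Valid m) (h : Side.Opp (.cell s l) (.cell true (2 * m + 1))) :
    arrPot m δ (.cell true (2 * m + 1)) - depPot m δ (.cell s l) + 12 ≤
      glueWt m (.cell s l) (.cell true (2 * m + 1)) - cornerWt m (.cell true (2 * m + 1)) := by
  have hp := h.parity
  simp only [Side.Valid] at hd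
  clear h
  rcases s with _ | _ <;>
    simp only [arrPot, Side.next, depPot, glueWt, cornerWt, ne_eq, reduceCtorEq,
      not_true_eq_false, not_false_eq_true, iff_true, iff_false, eq_self, if_true, and_true]
        at * <;>
    split_ifs <;> omega

theorem glueWt_add_swap {m : ℕ} {d a : Side} (h : Side.Opp d a) :
    glueWt m d a + glueWt m a d = if d.isBd || a.isBd then 120 else 12 := by
  split_ifs with hb
  · rw [glueWt_bd m hb, glueWt_bd m (by rwa [Bool.or_comm])]
    rfl
  rcases d with ⟨s, l⟩ | u
  swap; · simp [Side.isBd] at hb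
  rcases a with ⟨s', l'⟩ | u
  swap; · simp [Side.isBd] at hb
  have hp := h.parity
  rcases s with _ | _ <;> rcases s' with _ | _ <;>
    simp only [glueWt, ne_eq, reduceCtorEq,
      not_true_eq_false, not_false_eq_true, iff_true, iff_false] at * <;>
    split_ifs <;> omega

/-! ### Corners as powers of the labels -/

/-- `j` is a corner of a period with neighbouring exponents `u` and `!u`. -/
def IsInner (m : ℕ) (u : Bool) (j : ℕ) : Prop :=
  1 ≤ j ∧ j ≤ 2 * m ∧ decide (j % 2 = 1) = u

instance (m u j) : Decidable (IsInner m u j) := inferInstanceAs (Decidable (_ ∧ _))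

/-- The side arriving at a corner. -/
def arrSide (j : ℕ) (s : Bool) : Side := .cell s (if s then j else j + 1)

/-- The side leaving a corner. -/
def depSide (j : ℕ) (s : Bool) : Side := .cell s (if s then j + 1 else j)

/-- The weights of transitions between corners. -/
def innerWt (m : ℕ) (u : Bool) (j : ℕ) (s : Bool) (j' : ℕ) (s' : Bool) : ℤ :=
  if IsInner m u j ∧ IsInner m u j' then glueWt m (depSide j s) (arrSide j' s') else 8

theorem goodWeight_innerWt (m : ℕ) (u : Bool) :
    GoodWeight (innerWt m u) (if u then 1 else 2 * m) u := by
  constructor <;> intro j <;> try intro j'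
  all_goals
    cases u <;> (try intro s <;> cases s) <;> (try intro hj) <;>
    simp only [innerWt, IsInner, arrSide, depSide, glueWt, decide_eq_true_eq,
      decide_eq_false_iff_not, Bool.false_eq_true, if_true, if_false, Bool.not_true, Bool.not_false]
        at * <;>
    split_ifs <;> omega

/-! ### The ambient group -/

/-- Letters of words in elements of the base group and the stable letter. -/
inductive Tok (H : Type*)
  | h (g : H)
  | t (u : Bool)

/-- The value of a word. -/
def evalTok {H E : Type*} [Group H] [Group E] (of : H →* E) (t : E) : List (Tok H) → E
  | [] => 1
  | .h g :: T => of g * evalTok of t T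
  | .t u :: T => sgn t u * evalTok of t T

/-- A group containing `H` and an element `t` behaving like the stable letter of an HNN extension;
`Sub true` and `Sub false` are the associated subgroups. -/
structure StableLetter (H E : Type*) [Group H] [Group E] where
  /-- The inclusion of the base. -/
  of : H →* E
  of_inj : Function.Injective of
  /-- The stable letter. -/
  t : E
  /-- The associated subgroups. -/
  Sub : Bool → Subgroup H
  conj : ∀ u, ∀ p ∈ Sub u, ∃ q ∈ Sub (!u), sgn t u * of p = of q * sgn t u
  gen : ∀ g, ∃ T, evalTok of t T = g
  partner : ∀ u T, evalTok of t (.t u :: T) ∈ of.range →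
    ∃ T₁ T₂, T = T₁ ++ .t (!u) :: T₂ ∧ ∃ p ∈ Sub u, evalTok of t T₁ = of p

/-- A stable letter together with a relator in normal form, given by its corner labels
`x 1, ..., x (2 * m + 1)`, and an exponent `k`. -/
structure Setup (H E : Type*) [Group H] [Group E] extends StableLetter H E where
  /-- The relator has `2 * m + 1` stable letters. -/
  m : ℕ
  /-- The corner labels. -/
  x : ℕ → H
  /-- The exponent of the relator. -/
  k : ℕ
  two_le : 2 ≤ k
  not_mem : ∀ l, 1 ≤ l → l ≤ 2 * m → x l ∉ Sub (decide (l % 2 = 1))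
  noShortRel : ∀ u, NoShortRel (Sub u)
  pos_or_bot : 1 ≤ m ∨ ∀ u, Sub u = ⊥

variable {H E : Type*} [Group H] [Group E]

/-- The label of the corner following a side. -/
def Setup.label (D : Setup H E) : Side → H
  | .cell true l => D.x l
  | .cell false l => (D.x (if l = 1 then 2 * D.m + 1 else l - 1))⁻¹
  | .bd _ => 1

/-- The side `d` can be glued to the side `a`, with element `p`. -/
structure Setup.Glue (D : Setup H E) (d a : Side) (p : H) : Prop where
  opp : Side.Opp d a
  mem : ∀ u, a.ex = some u → p ∈ D.Sub u
  ne_one : Side.Mirror d a → p ≠ 1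

/-- The possible corners. -/
inductive Setup.Corner (D : Setup H E) (δ : ℤ) : Side → Side → H → ℤ → Prop
  | full (s : Bool) (l : ℕ) (h : (Side.cell s l).Valid D.m) :
      D.Corner δ (.cell s l) ((Side.cell s l).next D.m) (D.label (.cell s l))
        (-cornerWt D.m (.cell s l))
  | bdbd (u u' : Option Bool) (h : H) : D.Corner δ (.bd u) (.bd u') h 0
  | start (u : Option Bool) (h : H) (d : Side) (hd : d.isBd = false) (hv : d.Valid D.m)
      (hδ : depPot D.m δ d = δ) : D.Corner δ (.bd u) d h 0
  | finish (a : Side) (h : H) (u : Option Bool) (ha : a.isBd = false) (hv : a.Valid D.m)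
      (hδ : arrPot D.m δ a = δ) : D.Corner δ a (.bd u) h 0

/-- Partial vertices: sequences of corners glued along sides. The flag tells whether a boundary side
has been glued. -/
inductive Setup.Chain (D : Setup H E) (δ : ℤ) : Bool → Side → Side → H → ℤ → Prop
  | single {a d v w} (h : D.Corner δ a d v w) : D.Chain δ false a d v w
  | snoc {f a d v S a' d' x w} (h : D.Chain δ f a d v S) (p : H) (hg : D.Glue d a' p)
      (hc : D.Corner δ a' d' x w) :
      D.Chain δ (f || d.isBd || a'.isBd) a d' (v * p * x) (S + glueWt D.m d a' + w)

variable {D : Setup H E} {δ : ℤ}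

theorem Setup.Chain.append {f f' a d a' d' v v' S S' p} (h : D.Chain δ f a d v S)
    (hg : D.Glue d a' p) (h' : D.Chain δ f' a' d' v' S') :
    ∃ f'', D.Chain δ f'' a d' (v * p * v') (S + glueWt D.m d a' + S') := by
  induction h' with
  | single hc => exact ⟨_, h.snoc p hg hc⟩
  | @snoc f₁ a₁ d₁ v₁ S₁ a₂ d₂ x₂ w₂ h' p' hg' hc ih =>
    obtain ⟨f'', ih⟩ := ih hg
    have := ih.snoc p' hg' hc
    refine ⟨f'' || d₁.isBd || a₂.isBd, ?_⟩
    convert this using 1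
    · simp only [mul_assoc]
    · ring

theorem Setup.Corner.valid {a d v w} (h : D.Corner δ a d v w) : a.Valid D.m ∧ d.Valid D.m := by
  cases h with
  | full s l h => exact ⟨h, h.next⟩
  | bdbd => exact ⟨trivial, trivial⟩
  | start u h d hd hv hδ => exact ⟨trivial, hv⟩
  | finish a h u ha hv hδ => exact ⟨hv, trivial⟩

theorem Setup.Chain.valid {f a d v w} (h : D.Chain δ f a d v w) :
    a.Valid D.m ∧ d.Valid D.m := by
  induction h with
  | single h => exact h.valid
  | snoc h p hg hc ih => exact ⟨ih.1, hc.valid.2⟩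

theorem Side.Opp.mirror_of_zero {d a : Side} (h : Side.Opp d a) (hd : d.Valid 0) (ha : a.Valid 0)
    (hb : (d.isBd || a.isBd) = false) : Side.Mirror d a := by
  rcases d with ⟨s, l⟩ | u
  swap; · simp [Side.isBd] at hb
  rcases a with ⟨s', l'⟩ | u
  swap; · simp [Side.isBd] at hb
  have hp := h.parity
  simp only [Side.Valid] at hd ha
  obtain rfl : l = 1 := by omega
  obtain rfl : l' = 1 := by omega
  simp only [true_iff] at hp
  exact ⟨s, 1, rfl, by rw [Bool.eq_not_of_ne hp.symm]⟩

theorem Setup.Glue.slack {d a p} (hg : D.Glue d a p) (h1 : -7 ≤ δ) (h2 : δ ≤ 8)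
    (hd : d.Valid D.m) (ha : a.Valid D.m) :
    arrPot D.m δ a - depPot D.m δ d + (if d.isBd || a.isBd then 30 else 0) ≤
      glueWt D.m d a - cornerWt D.m a := by
  rcases D.pos_or_bot with hm | hb
  · exact glueWt_slack hm h1 h2 hd ha hg.opp
  · by_cases hm : 1 ≤ D.m
    · exact glueWt_slack hm h1 h2 hd ha hg.opp
    have hm : D.m = 0 := by omega
    by_cases hf : d.isBd || a.isBd
    · have b1 := depPot_bounds D.m h1 h2 d
      have b2 := depPot_bounds D.m h1 h2 (a.next D.m)
      have b3 := cornerWt_bounds D.m a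
      rw [glueWt_bd D.m hf, arrPot, if_pos hf]
      omega
    · rw [hm] at hd ha
      obtain ⟨u, -, hu⟩ := hg.opp
      have := hg.mem _ hu
      rw [hb, Subgroup.mem_bot] at this
      exact absurd this (hg.ne_one (hg.opp.mirror_of_zero hd ha (by simpa using hf)))

theorem Setup.Corner.le {a d v w} (h : D.Corner δ a d v w) :
    depPot D.m δ d - arrPot D.m δ a - cornerWt D.m a ≤ w := by
  cases h with
  | full s l h => simp [arrPot]
  | bdbd => simp [arrPot, depPot, Side.next, cornerWt]
  | start u h d hd hv hδ => simp [arrPot, Side.next, cornerWt, hδ]; simp [depPot]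
  | finish a h u ha hv hδ =>
    have := cornerWt_bounds D.m a
    rw [hδ, show depPot D.m δ (.bd u) = δ from rfl]
    omega

theorem Setup.Chain.le (h1 : -7 ≤ δ) (h2 : δ ≤ 8) {f a d v S} (h : D.Chain δ f a d v S) :
    depPot D.m δ d - arrPot D.m δ a - cornerWt D.m a + (if f then 30 else 0) ≤ S := by
  induction h with
  | single h => simpa using h.le
  | @snoc f a d v S a' d' x w h p hg hc ih =>
    have e1 := hg.slack h1 h2 h.valid.2 hc.valid.1
    have e2 := hc.le
    rcases f with _ | _ <;> rcases h3 : d.isBd || a'.isBd with _ | _ <;>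
      simp only [h3, Bool.false_or, Bool.true_or, if_true, if_false, Bool.false_eq_true] at * <;>
        omega

theorem Setup.Glue.slack_last {s l p} (hg : D.Glue (.cell s l) (.cell true (2 * D.m + 1)) p)
    (hd : (Side.cell s l).Valid D.m) :
    arrPot D.m δ (.cell true (2 * D.m + 1)) - depPot D.m δ (.cell s l) + 12 ≤
      glueWt D.m (.cell s l) (.cell true (2 * D.m + 1)) -
        cornerWt D.m (.cell true (2 * D.m + 1)) := by
  by_cases hm : 1 ≤ D.m
  · exact glueWt_slack_last hm hd hg.opp
  have hb := D.pos_or_bot.resolve_left hm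
  have hm : D.m = 0 := by omega
  obtain ⟨u, -, hu⟩ := hg.opp
  have := hg.mem _ hu
  rw [hb, Subgroup.mem_bot] at this
  refine absurd this (hg.ne_one (hg.opp.mirror_of_zero (hm ▸ hd) ?_ rfl))
  simp [Side.Valid, hm]

theorem Side.Valid.cases {m : ℕ} {s : Bool} {l : ℕ} (h : (Side.cell s l).Valid m) :
    (s = true ∧ l = 2 * m + 1) ∨ (s = false ∧ l = 1) ∨
    ∃ j u, IsInner m u j ∧ Side.cell s l = arrSide j s ∧
      (Side.cell s l).next m = depSide j s := by
  obtain ⟨h1, h2⟩ := h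
  rcases s with _ | _
  · by_cases hl : l = 1
    · simp [hl]
    · refine .inr (.inr ⟨l - 1, _, ⟨by omega, by omega, rfl⟩, ?_, ?_⟩)
      · simp [arrSide]; omega
      · simp [depSide, Side.next, hl]
  · by_cases hl : l = 2 * m + 1
    · simp [hl]
    · refine .inr (.inr ⟨l, _, ⟨by omega, by omega, rfl⟩, ?_, ?_⟩)
      · simp [arrSide]
      · simp [depSide, Side.next, hl]

theorem IsInner.ex_arr {m u j} (h : IsInner m u j) (s : Bool) : (arrSide j s).ex = some u := by
  obtain ⟨-, -, h⟩ := h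
  rcases s with _ | _ <;> rcases Nat.mod_two_eq_zero_or_one j with k | k <;>
    simp [arrSide, Side.ex, Nat.add_mod, k, ← h]

theorem IsInner.ex_dep {m u j} (h : IsInner m u j) (s : Bool) : (depSide j s).ex = some (!u) := by
  obtain ⟨-, -, h⟩ := h
  rcases s with _ | _ <;> rcases Nat.mod_two_eq_zero_or_one j with k | k <;>
    simp [depSide, Side.ex, Nat.add_mod, k, ← h]

theorem IsInner.label {u j} (h : IsInner D.m u j) (s : Bool) :
    D.label (arrSide j s) = sgn (D.x j) s := by
  have := h.1
  have h0 : j ≠ 0 := by omega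
  rcases s with _ | _ <;> simp [arrSide, Setup.label, sgn, h0]

theorem IsInner.cornerWt {m u j} (h : IsInner m u j) (s : Bool) :
    cornerWt m (arrSide j s) = 0 := by
  obtain ⟨h1, h2, -⟩ := h
  rcases s with _ | _ <;> simp [arrSide, RelIso.cornerWt] <;> omega

theorem IsInner.not_mem {u j} (h : IsInner D.m u j) : D.x j ∉ D.Sub u := by
  obtain ⟨h1, h2, rfl⟩ := h
  exact D.not_mem j h1 h2

theorem mirror_dep_arr {j s s'} (h : s ≠ s') : Side.Mirror (depSide j s) (arrSide j s') := by
  obtain rfl := Bool.eq_not_of_ne h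
  rcases s' with _ | _
  · exact ⟨_, _, rfl, rfl⟩
  · exact ⟨_, _, rfl, rfl⟩

theorem Setup.Glue.snoc_inner {u j₁ s₁ n j s v w p j' s'}
    (h : CornerSeq (D.Sub u) D.x (innerWt D.m u) j₁ s₁ n j s v w)
    (hj : IsInner D.m u j) (hj' : IsInner D.m u j')
    (hg : D.Glue (depSide j s) (arrSide j' s') p) :
    CornerSeq (D.Sub u) D.x (innerWt D.m u) j₁ s₁ (n + 1) j' s' (v * p * sgn (D.x j') s')
      (w + glueWt D.m (depSide j s) (arrSide j' s')) := by
  have := h.snoc j' s' p hj'.not_mem (hg.mem u (hj'.ex_arr _))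
    (fun e hs => hg.ne_one (by subst e; exact mirror_dep_arr hs))
  rwa [innerWt, if_pos ⟨hj, hj'⟩] at this

theorem Setup.Chain.classify (h1 : -7 ≤ δ) (h2 : δ ≤ 8) {f a d v S} (h : D.Chain δ f a d v S)
    (hf : f = false) (ha : a.isBd = false) (hd : d.isBd = false)
    (hne : a ≠ .cell true (2 * D.m + 1)) :
    12 + depPot D.m δ d - arrPot D.m δ a - cornerWt D.m a ≤ S ∨
    (a.ex = some false ∧ d.ex = some false) ∨
    ∃ n j₁ s₁ j s u, IsInner D.m u j₁ ∧ IsInner D.m u j ∧ a = arrSide j₁ s₁ ∧ d = depSide j s ∧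
      CornerSeq (D.Sub u) D.x (innerWt D.m u) j₁ s₁ n j s v S := by
  induction h with
  | single h =>
    cases h with
    | bdbd => simp [Side.isBd] at ha
    | start => simp [Side.isBd] at ha
    | finish => simp [Side.isBd] at hd
    | full s l hv =>
      rcases hv.cases with ⟨rfl, rfl⟩ | ⟨rfl, rfl⟩ | ⟨j, u, hj, e1, e2⟩
      · exact absurd rfl hne
      · refine .inr (.inl ⟨rfl, ?_⟩)
        simp [Side.next, Side.ex, Nat.add_mod]
      · refine .inr (.inr ⟨1, j, s, j, s, u, hj, hj, e1, e2, ?_⟩)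
        rw [e1, hj.label, hj.cornerWt, neg_zero]
        exact .single hj.not_mem
  | @snoc f a d v S a' d' x w h p hg hc ih =>
    have hle := h.le h1 h2
    have e1 := hg.slack h1 h2 h.valid.2 hc.valid.1
    have e2 := hc.le
    simp only [Bool.or_eq_false_iff] at hf
    obtain ⟨⟨rfl, hdb⟩, hab⟩ := hf
    simp only [hdb, hab, Bool.or_self, Bool.false_eq_true, if_false, add_zero] at e1 hle
    cases hc with
    | bdbd => simp [Side.isBd] at hab
    | start => simp [Side.isBd] at hab
    | finish => simp [Side.isBd] at hd
    | full s' l' hv =>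
      obtain ⟨u₀, ho1, ho2⟩ := hg.opp
      rcases hv.cases with ⟨rfl, rfl⟩ | ⟨rfl, rfl⟩ | ⟨j', u', hj', e3, e4⟩
      · rcases d with ⟨s, l⟩ | u
        swap; · simp [Side.isBd] at hdb
        have := hg.slack_last (δ := δ) h.valid.2
        left
        omega
      · have hu₀ : u₀ = true := by simpa [Side.ex] using ho2
        subst hu₀
        rcases ih rfl ha hdb hne with hA | ⟨-, hB⟩ | ⟨n, j₁, s₁, j, s, u, hj₁, hj, rfl, rfl, hs⟩
        · left; omega
        · rw [hB] at ho1; simp at ho1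
        · refine .inr (.inl ⟨?_, ?_⟩)
          · rw [hj.ex_dep] at ho1
            rw [hj₁.ex_arr]
            simpa using ho1
          · simp [Side.next, Side.ex, Nat.add_mod]
      · rw [e3] at ho2 hg e1 e2
        rw [hj'.ex_arr] at ho2
        rcases ih rfl ha hdb hne with hA | ⟨hB1, hB⟩ | ⟨n, j₁, s₁, j, s, u, hj₁, hj, rfl, rfl, hs⟩
        · left
          rw [e3]
          omega
        · refine .inr (.inl ⟨hB1, ?_⟩)
          rw [hB] at ho1
          rw [e4, hj'.ex_dep]
          simp only [Option.some.injEq] at ho1 ho2 ⊢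
          rw [ho2, ← ho1]
          rfl
        · have : u = u' := by
            rw [hj.ex_dep] at ho1
            simp only [Option.some.injEq] at ho1 ho2
            rw [ho2, ← ho1, Bool.not_not]
          subst this
          refine .inr (.inr ⟨n + 1, j₁, s₁, j', s', u, hj₁, hj', rfl, e4, ?_⟩)
          rw [e3, hj'.label, hj'.cornerWt, neg_zero, add_zero]
          exact hg.snoc_inner hs hj hj'

/-- The weight of a vertex is at least `12`. -/
theorem Setup.Chain.closing (h1 : -7 ≤ δ) (h2 : δ ≤ 8) {f a d v S p} (h : D.Chain δ f a d v S)
    (hg : D.Glue d a p) (hv : v * p = 1) : 12 ≤ S + glueWt D.m d a := by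
  have hle := h.le h1 h2
  have e1 := hg.slack h1 h2 h.valid.2 h.valid.1
  rcases hf : f with _ | _
  swap
  · simp only [hf, if_true] at hle
    split_ifs at e1 <;> omega
  rcases hb : d.isBd || a.isBd with _ | _
  swap
  · simp only [hb, if_true] at e1
    split_ifs at hle <;> omega
  simp only [Bool.or_eq_false_iff] at hb
  by_cases hne : a = .cell true (2 * D.m + 1)
  · subst hne
    rcases d with ⟨s, l⟩ | u
    swap; · simp [Side.isBd] at hb
    have := hg.slack_last (δ := δ) h.valid.2
    split_ifs at hle <;> omega
  simp only [hb.1, hb.2, Bool.or_self, Bool.false_eq_true, if_false, add_zero] at e1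
  obtain ⟨u₀, ho1, ho2⟩ := hg.opp
  rcases h.classify h1 h2 hf hb.2 hb.1 hne with hA | ⟨hB1, hB⟩ |
    ⟨n, j₁, s₁, j, s, u, hj₁, hj, rfl, rfl, hs⟩
  · omega
  · rw [hB] at ho1
    rw [hB1, ← Option.some.inj ho1] at ho2
    simp at ho2
  · have := hs.closing_le (D.noShortRel u) (goodWeight_innerWt D.m u) p (hg.mem u (hj₁.ex_arr _))
      (fun e hs' => hg.ne_one (by subst e; exact mirror_dep_arr hs')) hv
    rwa [innerWt, if_pos ⟨hj, hj₁⟩] at this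

/-! ### Conjugates of the relator -/

/-- A valid side of a cell. -/
def Side.IsCell (m : ℕ) (b : Side) : Prop := b.isBd = false ∧ b.Valid m

/-- The exponent of a side, with a default value on the root. -/
def Side.sg (b : Side) : Bool := b.ex.getD true

/-- The mirror image of a side. -/
def Side.mirror : Side → Side
  | .cell s l => .cell (!s) l
  | .bd u => .bd u

theorem Side.IsCell.next {m b} (h : Side.IsCell m b) : (b.next m).IsCell m := by
  refine ⟨?_, h.2.next⟩
  rcases b with ⟨_ | _, l⟩ | u
  · rfl
  · rfl
  · exact h.1

theorem Side.IsCell.mirror {m b} (h : Side.IsCell m b) : b.mirror.IsCell m := by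
  rcases b with ⟨_ | _, l⟩ | u <;> exact h

theorem Side.IsCell.ex {m b} (h : Side.IsCell m b) : b.ex = some b.sg := by
  rcases b with ⟨_ | _, l⟩ | u
  · rfl
  · rfl
  · exact absurd h.1 (by simp [Side.isBd])

theorem Side.IsCell.sg_mirror {m b} (h : Side.IsCell m b) : b.mirror.sg = !b.sg := by
  rcases b with ⟨_ | _, l⟩ | u
  · simp [Side.sg, Side.ex, Side.mirror]
  · simp [Side.sg, Side.ex, Side.mirror]
  · exact absurd h.1 (by simp [Side.isBd])

theorem Side.IsCell.next_mirror_next {m b} (h : Side.IsCell m b) :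
    (b.next m).mirror.next m = b.mirror := by
  rcases b with ⟨_ | _, l⟩ | u
  · have := h.2
    simp only [Side.Valid] at this
    simp only [Side.mirror, Side.next, Bool.not_false, Side.cell.injEq, true_and]
    split_ifs <;> omega
  · have := h.2
    simp only [Side.Valid] at this
    simp only [Side.mirror, Side.next, Bool.not_true, Side.cell.injEq, true_and]
    split_ifs <;> omega
  · rfl

theorem Side.IsCell.label_mirror_next {b} (h : Side.IsCell D.m b) :
    D.label (b.next D.m).mirror = (D.label b)⁻¹ := by
  rcases b with ⟨_ | _, l⟩ | u
  · have := h.2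
    simp only [Side.Valid] at this
    simp only [Side.mirror, Side.next, Bool.not_false, Setup.label, inv_inv]
  · have := h.2
    simp only [Side.Valid] at this
    simp only [Side.mirror, Side.next, Bool.not_true, Setup.label]
    congr 2
    split_ifs <;> omega
  · simp [Side.mirror, Side.next, Setup.label]

theorem Side.IsCell.iterate_next {m b} (h : Side.IsCell m b) (n : ℕ) :
    ((Side.next m)^[n] b).IsCell m := by
  induction n with
  | zero => exact h
  | succ n ih => rw [Function.iterate_succ_apply']; exact ih.next

theorem Side.iterate_next_true {m l : ℕ} (j : ℕ) (hj : l + j ≤ 2 * m + 1) :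
    (Side.next m)^[j] (.cell true l) = .cell true (l + j) := by
  induction j with
  | zero => rfl
  | succ j ih =>
    rw [Function.iterate_succ_apply', ih (by omega), Side.next, if_neg (by omega)]
    rfl

theorem Side.iterate_next_false {m l : ℕ} (j : ℕ) (hj : j < l) :
    (Side.next m)^[j] (.cell false l) = .cell false (l - j) := by
  induction j with
  | zero => rfl
  | succ j ih =>
    rw [Function.iterate_succ_apply', ih (by omega), Side.next, if_neg (by omega)]
    rfl

theorem Side.IsCell.iterate_period {m b} (h : Side.IsCell m b) :
    (Side.next m)^[2 * m + 1] b = b := by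
  rcases b with ⟨_ | _, l⟩ | u
  · obtain ⟨-, h1, h2⟩ := h
    have e : 2 * m + 1 = (2 * m + 1 - l) + ((l - 1) + 1) := by omega
    rw [e, Function.iterate_add_apply, Function.iterate_succ_apply',
      Side.iterate_next_false _ (by omega), show l - (l - 1) = 1 by omega]
    rw [show (Side.cell false 1).next m = .cell false (2 * m + 1) from rfl,
      Side.iterate_next_false _ (by omega)]
    congr 1
    omega
  · obtain ⟨-, h1, h2⟩ := h
    have e : 2 * m + 1 = (l - 1) + ((2 * m + 1 - l) + 1) := by omega
    rw [e, Function.iterate_add_apply, Function.iterate_succ_apply',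
      Side.iterate_next_true _ (by omega), show l + (2 * m + 1 - l) = 2 * m + 1 by omega]
    rw [show (Side.cell true (2 * m + 1)).next m = .cell true 1 by simp [Side.next],
      Side.iterate_next_true _ (by omega)]
    congr 1
    omega
  · exact absurd h.1 (by simp [Side.isBd])

theorem Side.IsCell.iterate_mul_period {m b} (h : Side.IsCell m b) (k : ℕ) :
    (Side.next m)^[k * (2 * m + 1)] b = b := by
  rw [mul_comm, Function.iterate_mul]
  exact Function.iterate_fixed h.iterate_period k

namespace Setup
variable (D : Setup H E)

/-- The value of a word. -/
def ev (T : List (Tok H)) : E := evalTok D.of D.t T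

@[simp] theorem ev_nil : D.ev [] = 1 := rfl
@[simp] theorem ev_h (g T) : D.ev (.h g :: T) = D.of g * D.ev T := rfl
@[simp] theorem ev_t (u T) : D.ev (.t u :: T) = sgn D.t u * D.ev T := rfl

@[simp] theorem ev_append (T T') : D.ev (T ++ T') = D.ev T * D.ev T' := by
  induction T with
  | nil => simp
  | cons a T ih => cases a <;> simp [ih, mul_assoc]

/-- The first `n` letters of the infinite word read along a cell from the side `b`. -/
def relTok : ℕ → Side → List (Tok H)
  | 0, _ => []
  | n + 1, b => .t b.sg :: .h (D.label b) :: relTok n (b.next D.m)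

/-- The length of the relator. -/
def len : ℕ := D.k * (2 * D.m + 1)

/-- The relator read from the side `b`. -/
def rel (b : Side) : E := D.ev (D.relTok D.len b)

theorem relTok_succ' (n b) : D.relTok (n + 1) b =
    D.relTok n b ++ [.t ((Side.next D.m)^[n] b).sg, .h (D.label ((Side.next D.m)^[n] b))] := by
  induction n generalizing b with
  | zero => rfl
  | succ n ih =>
    rw [relTok, ih, Function.iterate_succ_apply, relTok]
    rfl

theorem relTok_add (n n' b) : D.relTok (n + n') b =
    D.relTok n b ++ D.relTok n' ((Side.next D.m)^[n] b) := by
  induction n generalizing b with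
  | zero => simp [relTok]
  | succ n ih => rw [Nat.succ_add, relTok, ih, relTok, Function.iterate_succ_apply]; rfl

variable {D}

theorem iterate_len {b : Side} (hb : b.IsCell D.m) : (Side.next D.m)^[D.len] b = b :=
  hb.iterate_mul_period _

theorem rel_mul_relTok {b : Side} (hb : b.IsCell D.m) (n : ℕ) :
    D.rel b * D.ev (D.relTok n b) = D.ev (D.relTok n b) * D.rel ((Side.next D.m)^[n] b) := by
  have h1 := D.relTok_add n D.len b
  have h2 := D.relTok_add D.len n b
  rw [iterate_len hb, add_comm, h1] at h2
  rw [rel, rel, ← ev_append, ← ev_append, h2]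

theorem sgn_not {G : Type*} [Group G] (g : G) (u : Bool) : sgn g (!u) = (sgn g u)⁻¹ := by
  cases u <;> simp [sgn]

theorem relTok_mirror {b : Side} (hb : b.IsCell D.m) (n : ℕ) :
    D.ev (D.relTok n b) * sgn D.t ((Side.next D.m)^[n] b).sg *
      D.ev (D.relTok n ((Side.next D.m)^[n] b).mirror) = sgn D.t b.sg := by
  induction n generalizing b with
  | zero => simp [relTok]
  | succ n ih =>
    have e : ∀ (n : ℕ) {b : Side}, b.IsCell D.m →
        (Side.next D.m)^[n] ((Side.next D.m)^[n] b).mirror = b.mirror := by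
      intro n
      induction n with
      | zero => intros; rfl
      | succ n ih =>
        intro b hb
        rw [Function.iterate_succ_apply, Function.iterate_succ_apply',
          (hb.iterate_next n).next_mirror_next, ih hb]
    rw [Function.iterate_succ_apply, relTok_succ' D n ((Side.next D.m)^[n] (b.next D.m)).mirror,
      e n hb.next, hb.next.sg_mirror, hb.label_mirror_next, relTok]
    have := ih hb.next
    simp only [ev_append, ev_t, ev_h, ev_nil, mul_one, sgn_not, map_inv]
    calc _ = sgn D.t b.sg * D.of (D.label b) * (D.ev (D.relTok n (b.next D.m)) *
        sgn D.t ((Side.next D.m)^[n] (b.next D.m)).sg *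
        D.ev (D.relTok n ((Side.next D.m)^[n] (b.next D.m)).mirror)) *
        (sgn D.t (b.next D.m).sg)⁻¹ * (D.of (D.label b))⁻¹ := by group
      _ = _ := by rw [this]; group

theorem rel_mirror {b : Side} (hb : b.IsCell D.m) :
    D.rel b.mirror = (sgn D.t b.sg)⁻¹ * (D.rel b)⁻¹ * sgn D.t b.sg := by
  have := relTok_mirror hb D.len
  rw [iterate_len hb] at this
  change D.rel b * _ * D.rel _ = _ at this
  rw [mul_assoc, ← eq_inv_mul_iff_mul_eq, ← eq_inv_mul_iff_mul_eq] at this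
  rw [this, mul_assoc]

variable (D)

/-- A product of conjugates of the relator; each factor is given by the conjugating word and a
side. -/
def evC : List (List (Tok H) × Side) → E
  | [] => 1
  | (x, b) :: C => D.ev x * D.rel b * (D.ev x)⁻¹ * evC C

@[simp] theorem evC_nil : D.evC [] = 1 := rfl
@[simp] theorem evC_cons (x b C) :
    D.evC ((x, b) :: C) = D.ev x * D.rel b * (D.ev x)⁻¹ * D.evC C := rfl

@[simp] theorem evC_append (C C') : D.evC (C ++ C') = D.evC C * D.evC C' := by
  induction C with
  | nil => simp
  | cons a C ih => simp [evC, ih, mul_assoc]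

/-- All factors are conjugates of relators. -/
def Cells (C : List (List (Tok H) × Side)) : Prop := ∀ c ∈ C, c.2.IsCell D.m

/-- `g` is a product of `n` conjugates of the relator and its inverse. -/
def Ar (n : ℕ) (g : E) : Prop := ∃ C, D.Cells C ∧ C.length = n ∧ D.evC C = g

variable {D}

theorem Ar.one : D.Ar 0 1 := ⟨[], by simp [Cells], rfl, rfl⟩

theorem Ar.mul {n n' g g'} (h : D.Ar n g) (h' : D.Ar n' g') : D.Ar (n + n') (g * g') := by
  obtain ⟨C, h1, rfl, rfl⟩ := h
  obtain ⟨C', h1', rfl, rfl⟩ := h'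
  refine ⟨C ++ C', ?_, by simp, by simp⟩
  intro c hc
  rcases List.mem_append.1 hc with h | h
  exacts [h1 c h, h1' c h]

theorem Ar.conj {n g} (h : D.Ar n g) (y : E) : D.Ar n (y * g * y⁻¹) := by
  obtain ⟨C, h1, rfl, rfl⟩ := h
  obtain ⟨T, rfl⟩ := D.gen y
  change D.Ar _ (D.ev T * _ * (D.ev T)⁻¹)
  refine ⟨C.map fun c => (T ++ c.1, c.2), ?_, by simp, ?_⟩
  · intro c hc
    obtain ⟨c', hc', rfl⟩ := List.mem_map.1 hc
    exact h1 c' hc'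
  · clear h1
    induction C with
    | nil => simp
    | cons a C ih => simp [evC, ih, mul_assoc]

theorem Ar.rel {b : Side} (hb : b.IsCell D.m) : D.Ar 1 (D.rel b) :=
  ⟨[([], b)], by simpa [Cells] using hb, rfl, by simp⟩

theorem Ar.rel_inv {b : Side} (hb : b.IsCell D.m) : D.Ar 1 (D.rel b)⁻¹ := by
  have := (Ar.rel hb.mirror).conj (sgn D.t b.sg)
  rw [rel_mirror hb] at this
  convert this using 1
  group

theorem Ar.evC {C} (h : D.Cells C) : D.Ar C.length (D.evC C) := ⟨C, h, rfl, rfl⟩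

theorem Ar.inv {n g} (h : D.Ar n g) : D.Ar n g⁻¹ := by
  obtain ⟨C, h1, rfl, rfl⟩ := h
  induction C with
  | nil => simpa using Ar.one
  | cons a C ih =>
    obtain ⟨x, b⟩ := a
    have h2 := ih fun c hc => h1 c (List.mem_cons_of_mem _ hc)
    have h3 := h2.mul ((Ar.rel_inv (h1 (x, b) (List.mem_cons_self ..))).conj (D.ev x))
    have e : (D.evC ((x, b) :: C))⁻¹ = (D.evC C)⁻¹ * (D.ev x * (D.rel b)⁻¹ * (D.ev x)⁻¹) := by
      rw [evC_cons]
      group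
    rw [e]
    exact h3

theorem Ar.cyc {n g g'} (h : D.Ar n (g * g')) : D.Ar n (g' * g) := by
  have := h.conj g⁻¹
  convert this using 1
  group

end Setup

/-! ### Annular boundaries -/

theorem cornerWt_sum_period {m : ℕ} {b : Side} (hb : b.IsCell m) :
    ∑ i ∈ Finset.range (2 * m + 1), cornerWt m ((Side.next m)^[i] b) = 7 := by
  have shift : ∀ {b : Side}, b.IsCell m →
      ∑ i ∈ Finset.range (2 * m + 1), cornerWt m ((Side.next m)^[i] (b.next m)) =
        ∑ i ∈ Finset.range (2 * m + 1), cornerWt m ((Side.next m)^[i] b) := by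
    intro b hb
    have h1 := Finset.sum_range_succ (fun i => cornerWt m ((Side.next m)^[i] b)) (2 * m + 1)
    have h2 := Finset.sum_range_succ' (fun i => cornerWt m ((Side.next m)^[i] b)) (2 * m + 1)
    simp only [hb.iterate_period, Function.iterate_succ_apply, Function.iterate_zero, id] at h1 h2
    omega
  have shift' : ∀ (j : ℕ) {b : Side}, b.IsCell m →
      ∑ i ∈ Finset.range (2 * m + 1), cornerWt m ((Side.next m)^[i] ((Side.next m)^[j] b)) =
        ∑ i ∈ Finset.range (2 * m + 1), cornerWt m ((Side.next m)^[i] b) := by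
    intro j
    induction j with
    | zero => intros; rfl
    | succ j ih => intro b hb; rw [Function.iterate_succ_apply, ih hb.next, shift hb]
  rcases b with ⟨_ | _, l⟩ | u
  · obtain ⟨-, h1, h2⟩ := hb
    have e := Side.iterate_next_false (m := m) (l := 2 * m + 1) (2 * m + 1 - l) (by omega)
    rw [show 2 * m + 1 - (2 * m + 1 - l) = l by omega] at e
    rw [← e, shift' _ (b := .cell false (2 * m + 1)) ⟨rfl, by omega, le_rfl⟩,
      Finset.sum_eq_single_of_mem (2 * m) (by simp)]
    · rw [Side.iterate_next_false _ (by omega), cornerWt, if_pos (by omega)]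
    · intro i hi hne
      rw [Finset.mem_range] at hi
      rw [Side.iterate_next_false _ (by omega), cornerWt, if_neg (by omega)]
  · obtain ⟨-, h1, h2⟩ := hb
    have e := Side.iterate_next_true (m := m) (l := 1) (l - 1) (by omega)
    rw [show 1 + (l - 1) = l by omega] at e
    rw [← e, shift' _ (b := .cell true 1) ⟨rfl, le_rfl, by omega⟩,
      Finset.sum_eq_single_of_mem (2 * m) (by simp)]
    · rw [Side.iterate_next_true _ (by omega), cornerWt, if_pos (by omega)]
    · intro i hi hne
      rw [Finset.mem_range] at hi
      rw [Side.iterate_next_true _ (by omega), cornerWt, if_neg (by omega)]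
  · exact absurd hb.1 (by simp [Side.isBd])

theorem cornerWt_sum {m : ℕ} {b : Side} (hb : b.IsCell m) (k : ℕ) :
    ∑ i ∈ Finset.range (k * (2 * m + 1)), cornerWt m ((Side.next m)^[i] b) = 7 * k := by
  induction k with
  | zero => simp
  | succ k ih =>
    rw [Nat.succ_mul, Finset.sum_range_add, ih]
    simp only [add_comm (k * (2 * m + 1)), Function.iterate_add_apply, hb.iterate_mul_period,
      cornerWt_sum_period hb]
    push_cast
    ring

/-- A letter of a word together with the partial vertex following it: the side `a` read by the
letter, the side `d` read by the next one, the element `v` between them and the weight `S`. -/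
structure Gap (H : Type*) where
  /-- The side arriving at the vertex. -/
  a : Side
  /-- The side leaving the vertex. -/
  d : Side
  /-- The label. -/
  v : H
  /-- The weight. -/
  S : ℤ

namespace Setup

section
variable {K : Type*}

/-- The weight of a gap. -/
def wt (g : Gap K) : ℤ := g.S + if g.a.isBd && g.a.ex.isSome then 108 else 0

/-- The weight of a sequence of gaps. -/
def psi (l : List (Gap K)) : ℤ := (l.map wt).sum

@[simp] theorem psi_nil : psi ([] : List (Gap K)) = 0 := rfl
@[simp] theorem psi_cons (g : Gap K) (l) : psi (g :: l) = wt g + psi l := by simp [psi]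
@[simp] theorem psi_append (l l' : List (Gap K)) : psi (l ++ l') = psi l + psi l' := by simp [psi]

end

end Setup

namespace Setup
variable (D : Setup H E) (δ : ℤ)

/-- The stable letter read by a side. -/
def tau (a : Side) : E :=
  match a.ex with
  | none => 1
  | some u => sgn D.t u

theorem tau_of_isSome {a : Side} (h : a.ex.isSome) : D.tau a = sgn D.t a.sg := by
  obtain ⟨u, hu⟩ := Option.isSome_iff_exists.1 h
  simp [tau, Side.sg, hu]

/-- The value of a gap. -/
def gv (g : Gap H) : E := D.tau g.a * D.of g.v

/-- The value of a sequence of gaps. -/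
def val (l : List (Gap H)) : E := (l.map D.gv).prod

@[simp] theorem val_nil : D.val [] = 1 := rfl
@[simp] theorem val_cons (g l) : D.val (g :: l) = D.gv g * D.val l := by simp [val]
@[simp] theorem val_append (l l') : D.val (l ++ l') = D.val l * D.val l' := by simp [val]

/-- Sequences of gaps starting from a given side and ending at the boundary. -/
inductive Path : Side → List (Gap H) → Prop
  | last (g : Gap H) (hg : ∃ f, D.Chain δ f g.a g.d g.v g.S) (hd : g.d.isBd = true) : Path g.a [g]
  | cons (g : Gap H) (l) (hg : ∃ f, D.Chain δ f g.a g.d g.v g.S) (hd : g.d.ex.isSome)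
      (hl : Path g.d l) : Path g.a (g :: l)

variable {D} {δ} in
theorem Path.replace {l l₂ : List (Gap H)} (hl : l ≠ []) (h : ∀ a, D.Path δ a l → D.Path δ a l₂)
    (pre : List (Gap H)) : ∀ a, D.Path δ a (pre ++ l) → D.Path δ a (pre ++ l₂) := by
  induction pre with
  | nil => exact h
  | cons g pre ih =>
    intro a ha
    rw [List.cons_append] at ha ⊢
    generalize he : pre ++ l = l' at ha
    cases ha with
    | last _ hg hd => exact absurd (List.append_eq_nil_iff.1 he).2 hl
    | cons _ _ hg hd hl => exact .cons g _ hg hd (ih _ (he ▸ hl))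

/-- Values of a sequence of gaps after removal of cells of given orientations at some letters. -/
inductive Rem : List Bool → List (Gap H) → E → Prop
  | nil : Rem [] [] 1
  | skip {r l z} (g : Gap H) (h : Rem r l z) : Rem r (g :: l) (D.gv g * z)
  | take {r l z} (g : Gap H) (s : Bool) (i : ℕ) (hg : g.a = .cell s i) (h : Rem r l z) :
      Rem (s :: r) (g :: l) ((D.rel g.a)⁻¹ * D.gv g * z)

variable {D} {δ}

theorem Rem.append {r r' l l' z z'} (h : D.Rem r l z) (h' : D.Rem r' l' z') :
    D.Rem (r ++ r') (l ++ l') (z * z') := by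
  induction h with
  | nil => simpa
  | skip g h ih => rw [mul_assoc]; exact ih.skip g
  | take g s i hg h ih => rw [mul_assoc]; exact ih.take g s i hg

theorem Rem.of_append {r l l' z} (h : D.Rem r (l ++ l') z) :
    ∃ r₁ r₂ z₁ z₂, r = r₁ ++ r₂ ∧ z = z₁ * z₂ ∧ D.Rem r₁ l z₁ ∧ D.Rem r₂ l' z₂ := by
  induction l generalizing r z with
  | nil => exact ⟨[], r, 1, z, by simp, by simp, .nil, h⟩
  | cons g l ih =>
    cases h with
    | skip _ h =>
      obtain ⟨r₁, r₂, z₁, z₂, rfl, rfl, h1, h2⟩ := ih h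
      exact ⟨r₁, r₂, _, z₂, rfl, by rw [mul_assoc], h1.skip g, h2⟩
    | take _ s i hg h =>
      obtain ⟨r₁, r₂, z₁, z₂, rfl, rfl, h1, h2⟩ := ih h
      exact ⟨s :: r₁, r₂, _, z₂, rfl, by rw [mul_assoc _ z₁], h1.take g s i hg, h2⟩

theorem rem_nil_iff {l z} : D.Rem [] l z ↔ z = D.val l := by
  induction l generalizing z with
  | nil => exact ⟨fun h => by cases h; rfl, fun h => by subst h; exact .nil⟩
  | cons g l ih =>
    refine ⟨fun h => ?_, fun h => ?_⟩
    · cases h with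
      | skip _ h => rw [ih.1 h, val_cons]
    · subst h
      rw [val_cons]
      exact (ih.2 rfl).skip g

theorem rem_nil (l) : D.Rem [] l (D.val l) := rem_nil_iff.2 rfl

theorem Rem.replace {l l₂ : List (Gap H)} (h : ∀ r z, D.Rem r l₂ z → D.Rem r l z)
    (pre post : List (Gap H)) {r z} (hr : D.Rem r (pre ++ (l₂ ++ post)) z) :
    D.Rem r (pre ++ (l ++ post)) z := by
  obtain ⟨r₁, r₂, z₁, z₂, rfl, rfl, h1, h2⟩ := hr.of_append
  obtain ⟨r₃, r₄, z₃, z₄, rfl, rfl, h3, h4⟩ := h2.of_append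
  exact h1.append ((h _ _ h3).append h4)

/-- The admissible sequences of orientations. -/
def Alt (r : List Bool) : Prop := r = [] ∨ (∃ s, r = [s]) ∨ ∃ s, r = [s, !s]

variable (D) (δ) in
/-- The boundary of a partial diagram of area `A` which is minimal in a strong sense. -/
structure Holds (A : ℕ) (l : List (Gap H)) : Prop where
  path : D.Path δ (.bd none) l
  area : D.Ar A (D.val l)
  min : ∀ r z j, Alt r → D.Rem r l z → D.Ar j z → A + r.length ≤ j

theorem tau_conj {a : Side} (ha : a.ex.isSome) {p : H} (hp : p ∈ D.Sub a.sg) :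
    ∃ q ∈ D.Sub (!a.sg), D.tau a * D.of p = D.of q * D.tau a := by
  rw [D.tau_of_isSome ha]
  exact D.conj _ _ hp

theorem opp_of_sg {a b : Side} (ha : a.ex.isSome) (hb : b.ex.isSome) (h : b.sg = !a.sg) :
    Side.Opp a b := by
  obtain ⟨u, hu⟩ := Option.isSome_iff_exists.1 ha
  obtain ⟨u', hu'⟩ := Option.isSome_iff_exists.1 hb
  simp only [Side.sg, hu, hu', Option.getD_some] at h
  exact ⟨u, hu, by rw [hu', h]⟩

theorem tau_mul_tau {a b : Side} (ha : a.ex.isSome) (hb : b.ex.isSome) (h : b.sg = !a.sg) :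
    D.tau a * D.tau b = 1 := by
  rw [D.tau_of_isSome ha, D.tau_of_isSome hb, h, sgn_not, mul_inv_cancel]

theorem sg_eq {a : Side} {u} (h : a.ex = some u) : u = a.sg := by simp [Side.sg, h]

theorem path_cons₂ {a g g' l} (h : D.Path δ a (g :: g' :: l)) :
    a = g.a ∧ (∃ f, D.Chain δ f g.a g.d g.v g.S) ∧ g.d = g'.a ∧ g.d.ex.isSome ∧
      D.Path δ g'.a (g' :: l) := by
  cases h with
  | cons _ _ hg hd hl =>
    have : g.d = g'.a := by
      generalize g.d = d at hl
      cases hl <;> rfl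
    exact ⟨rfl, hg, this, hd, this ▸ hl⟩

/-- Changing the first gap of a path. -/
theorem Path.change {a g l} (h : D.Path δ a (g :: l)) (g₁ : Gap H)
    (hg : ∃ f, D.Chain δ f g₁.a g₁.d g₁.v g₁.S) (hd : g₁.d = g.d) :
    D.Path δ g₁.a (g₁ :: l) := by
  cases h with
  | last _ _ h2 => exact .last g₁ hg (hd ▸ h2)
  | cons _ _ _ h2 hl => exact .cons g₁ l hg (hd ▸ h2) (hd ▸ hl)

end Setup

/-! ### Folding and removing cells -/

namespace Setup

theorem Path.of_append {pre l : List (Gap H)} (hl : l ≠ []) {a} (h : D.Path δ a (pre ++ l)) :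
    ∃ a', D.Path δ a' l := by
  induction pre generalizing a with
  | nil => exact ⟨a, h⟩
  | cons g pre ih =>
    rw [List.cons_append] at h
    generalize he : pre ++ l = l' at h
    cases h with
    | last _ hg hd => exact absurd (List.append_eq_nil_iff.1 he).2 hl
    | cons _ _ hg hd h => exact ih (he ▸ h)

theorem wt_of_isSome {K : Type*} {g : Gap K} (h : g.a.ex.isSome) :
    wt g = g.S + if g.a.isBd then 108 else 0 := by
  simp [wt, h]

theorem rel_mirror_side {s i} (hb : (Side.cell s i).IsCell D.m) :
    D.tau (.cell s i) * D.rel (.cell (!s) i) = (D.rel (.cell s i))⁻¹ * D.tau (.cell s i) := by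
  have := rel_mirror hb
  rw [show Side.mirror (.cell s i) = .cell (!s) i from rfl] at this
  rw [this, D.tau_of_isSome rfl]
  group

theorem Holds.cmove (h1 : -7 ≤ δ) (h2 : δ ≤ 8) {A pre gl g g' post}
    (h : D.Holds δ A (pre ++ gl :: g :: g' :: post)) (hs : g'.a.sg = !g.a.sg)
    (hp : g.v ∈ D.Sub g.a.sg) :
    ∃ g₁, D.Holds δ A (pre ++ g₁ :: post) ∧
      psi (pre ++ g₁ :: post) ≤ psi (pre ++ gl :: g :: g' :: post) := by
  obtain ⟨a', hpath⟩ := h.path.of_append (by simp)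
  obtain ⟨-, ⟨f, hgl⟩, e1, s1, hpath⟩ := path_cons₂ hpath
  obtain ⟨-, ⟨f', hg⟩, e2, s2, hpath⟩ := path_cons₂ hpath
  rw [e1] at s1 hgl
  rw [e2] at s2 hg
  obtain ⟨q, hq, hconj⟩ := tau_conj s1 hp
  have hne : Side.Mirror g.a g'.a → g.v ≠ 1 := by
    rintro ⟨s, i, hi, hi'⟩ hv
    have hR : D.Rem [s, !s] (pre ++ gl :: g :: g' :: post) (D.val pre * (D.gv gl *
        ((D.rel g.a)⁻¹ * D.gv g * ((D.rel g'.a)⁻¹ * D.gv g' * D.val post)))) :=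
      (rem_nil pre).append (((((rem_nil post).take g' _ _ hi').take g _ _ hi).skip gl))
    have hz := h.min _ _ A (Or.inr (Or.inr ⟨s, rfl⟩)) hR ?_
    · simp at hz
    convert h.area using 1
    have hb : (Side.cell s i).IsCell D.m := ⟨rfl, hi ▸ hg.valid.1⟩
    have hm := rel_mirror_side hb
    have ht : D.gv g = D.tau (.cell s i) := by simp [gv, hv, hi]
    simp only [val_append, val_cons]
    rw [ht, hi, hi', ← mul_assoc ((D.rel (.cell s i))⁻¹ * _),
      ← mul_assoc ((D.rel (.cell s i))⁻¹ * _),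
      ← hm]
    group
  obtain ⟨f'', hch⟩ := hpath.rec (motive := fun a l _ => a = g'.a → l = g' :: post →
      ∃ f, D.Chain δ f g'.a g'.d g'.v g'.S) (fun g hg _ _ e => by cases e; exact hg)
      (fun g _ hg _ _ _ _ e => by cases e; exact hg) rfl rfl
  have hopp := opp_of_sg s1 s2 hs
  have hglue : D.Glue g.a g'.a q := by
    refine ⟨hopp, ?_, fun hm hq1 => hne hm ?_⟩
    · intro u hu
      rwa [sg_eq hu, hs]
    · rw [hq1, map_one, one_mul, mul_eq_left] at hconj
      exact D.of_inj (hconj.trans (map_one _).symm)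
  obtain ⟨f₁, hnew⟩ := hgl.append hglue hch
  have hopp' : Side.Opp g'.a g.a := opp_of_sg s2 s1 (by rw [hs, Bool.not_not])
  have hclose := hg.closing h1 h2 (p := g.v⁻¹) ⟨hopp', by
      intro u hu
      rw [sg_eq hu]
      exact inv_mem hp, by
      rintro ⟨s, i, hi, hi'⟩ hv
      exact hne ⟨!s, i, hi', by rw [hi, Bool.not_not]⟩ (inv_eq_one.1 hv)⟩ (mul_inv_cancel _)
  have hsum := glueWt_add_swap (m := D.m) hopp
  set g₁ : Gap H := ⟨gl.a, g'.d, gl.v * q * g'.v, gl.S + glueWt D.m g.a g'.a + g'.S⟩ with hg₁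
  have hval : D.gv g₁ = D.gv gl * D.gv g * D.gv g' := by
    simp only [gv, hg₁, map_mul, hconj, mul_assoc]
    rw [← mul_assoc (D.tau g.a) (D.tau g'.a), tau_mul_tau s1 s2 hs, one_mul]
  refine ⟨g₁, ⟨?_, ?_, ?_⟩, ?_⟩
  · refine Path.replace (l := gl :: g :: g' :: post) (by simp) (fun a ha => ?_) pre _ h.path
    obtain ⟨rfl, -⟩ := path_cons₂ ha
    exact Path.change hpath g₁ ⟨_, hnew⟩ rfl
  · convert h.area using 1
    simp [hval, mul_assoc]
  · intro r z j hr hz hj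
    refine h.min r z j hr ?_ hj
    refine Rem.replace (l := [gl, g, g']) (l₂ := [g₁]) ?_ pre post hz
    intro r z hz
    cases hz with
    | skip _ h =>
      cases h
      rw [hval]
      have := (((Rem.nil.skip (D := D) g').skip g).skip gl)
      simpa [mul_assoc] using this
    | take _ s i hi h =>
      cases h
      rw [hval]
      have := (((Rem.nil.skip (D := D) g').skip g).take gl s i hi)
      simpa [mul_assoc, hg₁] using this
  · have w1 := wt_of_isSome s1
    have w2 := wt_of_isSome s2
    have w3 : wt g₁ = wt gl + glueWt D.m g.a g'.a + g'.S := by simp only [wt, hg₁]; ring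
    simp only [psi_append, psi_cons]
    rcases hb : g.a.isBd with _ | _ <;> rcases hb' : g'.a.isBd with _ | _ <;>
      simp only [hb, hb', Bool.or_false, Bool.or_true,
        if_true, if_false, Bool.false_eq_true] at * <;> omega

/-- The letters of a relator, the first one `b`, followed by a given gap. -/
def mids (D : Setup H E) : ℕ → Side → Gap H → List (Gap H)
  | 0, _, g => [g]
  | n + 1, b, g => ⟨b, b.next D.m, D.label b, -cornerWt D.m b⟩ :: mids D n (b.next D.m) g

theorem tau_cell {b : Side} (hb : b.IsCell D.m) : D.tau b = sgn D.t b.sg :=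
  D.tau_of_isSome (by rw [hb.ex]; rfl)

theorem val_mids {b : Side} (hb : b.IsCell D.m) (n : ℕ) (g : Gap H) :
    D.val (D.mids n b g) = D.ev (D.relTok n b) * D.gv g := by
  induction n generalizing b with
  | zero => simp [mids, relTok]
  | succ n ih => simp [mids, relTok, ih hb.next, gv, tau_cell hb, mul_assoc]

theorem psi_mids {b : Side} (hb : b.IsCell D.m) (n : ℕ) (g : Gap H) :
    psi (D.mids n b g) = wt g - ∑ i ∈ Finset.range n, cornerWt D.m ((Side.next D.m)^[i] b) := by
  induction n generalizing b with
  | zero => simp [mids]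
  | succ n ih =>
    rw [mids, psi_cons, ih hb.next, Finset.sum_range_succ']
    simp only [wt, hb.1, Bool.false_and, Bool.false_eq_true, if_false,
      Function.iterate_succ_apply, Function.iterate_zero, id]
    ring

end Setup

namespace Setup

theorem rel_mul_step {b : Side} (hb : b.IsCell D.m) :
    (D.rel b)⁻¹ * (D.tau b * D.of (D.label b)) =
      D.tau b * D.of (D.label b) * (D.rel (b.next D.m))⁻¹ := by
  have := rel_mul_relTok hb 1
  simp only [relTok, ev_t, ev_h, ev_nil, mul_one, Function.iterate_one, ← tau_cell hb] at this
  rw [inv_mul_eq_iff_eq_mul, ← mul_assoc, this, mul_inv_cancel_right]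

theorem next_cell (m : ℕ) (s : Bool) (i : ℕ) : ∃ i', (Side.cell s i).next m = .cell s i' := by
  cases s
  · exact ⟨_, rfl⟩
  · exact ⟨_, rfl⟩

theorem Rem.mids {s i} (hb : (Side.cell s i).IsCell D.m) (n : ℕ) {g : Gap H}
    (hg : g.a = (Side.next D.m)^[n] (.cell s i)) {r z} (h : D.Rem r (D.mids n (.cell s i) g) z) :
    (r = [] ∧ z = D.val (D.mids n (.cell s i) g)) ∨
      (r = [s] ∧ z = (D.rel (.cell s i))⁻¹ * D.val (D.mids n (.cell s i) g)) ∨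
      ∃ r', r = s :: s :: r' := by
  induction n generalizing i r z with
  | zero =>
    cases h with
    | skip _ h => cases h; exact Or.inl ⟨rfl, by simp [Setup.mids]⟩
    | take _ s' i' hi h =>
      cases h
      have hi := hg.symm.trans hi
      simp only [Function.iterate_zero, id, Side.cell.injEq] at hi hg
      refine Or.inr (Or.inl ⟨by rw [hi.1], by simp [Setup.mids, hg]⟩)
  | succ n ih =>
    obtain ⟨i₁, hi₁⟩ := next_cell D.m s i
    have hb₁ := hb.next
    have hstep := rel_mul_step hb
    rw [Function.iterate_succ_apply, hi₁] at hg
    rw [hi₁] at hb₁ hstep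
    have ih := @ih i₁ hb₁ hg
    rw [Setup.mids, hi₁] at h ⊢
    cases h with
    | skip _ h =>
      rcases ih h with ⟨rfl, rfl⟩ | ⟨rfl, rfl⟩ | ⟨r', rfl⟩
      · exact Or.inl ⟨rfl, by simp⟩
      · refine Or.inr (Or.inl ⟨rfl, ?_⟩)
        rw [val_cons, ← mul_assoc, ← mul_assoc, gv, hstep]
      · exact Or.inr (Or.inr ⟨r', rfl⟩)
    | take _ s' i' hi h =>
      cases hi
      rcases ih h with ⟨rfl, rfl⟩ | ⟨rfl, rfl⟩ | ⟨r', rfl⟩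
      · exact Or.inr (Or.inl ⟨rfl, by simp [mul_assoc]⟩)
      · exact Or.inr (Or.inr ⟨[], rfl⟩)
      · exact Or.inr (Or.inr ⟨s :: r', rfl⟩)

theorem Path.mids {b : Side} (hb : b.IsCell D.m) (n : ℕ) {g : Gap H} {post}
    (hg : g.a = (Side.next D.m)^[n] b) (h : D.Path δ g.a (g :: post)) :
    D.Path δ b (D.mids n b g ++ post) := by
  induction n generalizing b with
  | zero => rw [hg] at h; exact h
  | succ n ih =>
    refine Path.cons ⟨b, b.next D.m, D.label b, _⟩ _ ⟨false, .single ?_⟩ (by rw [hb.next.ex]; rfl)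
      (ih hb.next hg)
    rcases b with ⟨s, i⟩ | u
    · exact .full s i hb.2
    · exact absurd hb.1 (by simp [Side.isBd])

theorem Alt.length_le {r : List Bool} (h : Alt r) : r.length ≤ 2 := by
  rcases h with rfl | ⟨s, rfl⟩ | ⟨s, rfl⟩ <;> simp

theorem Alt.of_length {r : List Bool} (h : r.length ≤ 1) : Alt r := by
  match r, h with
  | [], _ => exact Or.inl rfl
  | [s], _ => exact Or.inr (Or.inl ⟨s, rfl⟩)

theorem Alt.not_double {r₁ r₂ : List Bool} {s} (h : Alt (r₁ ++ s :: s :: r₂)) : False := by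
  have hl := h.length_le
  obtain rfl : r₁ = [] := by
    apply List.eq_nil_of_length_eq_zero
    simp at hl
    omega
  rcases h with h | ⟨s', h⟩ | ⟨s', h⟩ <;> simp at h
  obtain ⟨rfl, h, -⟩ := h
  cases s <;> simp at h

theorem len_eq : ∃ n, D.len = n + 2 ∧ 7 * D.k ≥ 14 := by
  refine ⟨D.len - 2, ?_, by have := D.two_le; omega⟩
  have := D.two_le
  have : D.k * 1 ≤ D.k * (2 * D.m + 1) := Nat.mul_le_mul_left _ (by omega)
  unfold len
  omega

theorem Holds.rmove {A pre gl g post}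
    (h : D.Holds δ (A + 1) (pre ++ gl :: g :: post)) {p : H} (hp : p ∈ D.Sub g.a.sg)
    {b : Side} (hb : b.IsCell D.m) (hs : b.sg = !g.a.sg)
    (hA : D.Ar A (D.val pre * D.gv gl * (D.tau g.a * D.of p * D.rel b * (D.of p)⁻¹ * D.of g.v) *
      D.val post)) :
    ∃ l, D.Holds δ A (pre ++ l) ∧ psi (pre ++ l) + 2 ≤ psi (pre ++ gl :: g :: post) := by
  obtain ⟨a', hpath⟩ := h.path.of_append (by simp)
  obtain ⟨-, ⟨f, hgl⟩, e1, s1, hpath⟩ := path_cons₂ hpath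
  rw [e1] at s1 hgl
  have s2 : b.ex.isSome := by rw [hb.ex]; rfl
  obtain ⟨q, hq, hconj⟩ := tau_conj s1 hp
  have hopp := opp_of_sg s1 s2 hs
  have hopp' : Side.Opp b g.a := opp_of_sg s2 s1 (by rw [hs, Bool.not_not])
  have htau := tau_mul_tau (D := D) s1 s2 hs
  obtain ⟨⟨f', hg⟩, hgv⟩ := hpath.rec (motive := fun a l _ => a = g.a → l = g :: post →
      (∃ f, D.Chain δ f g.a g.d g.v g.S) ∧ g.a.Valid D.m)
      (fun g hg _ _ e => by cases e; exact ⟨hg, hg.choose_spec.valid.1⟩)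
      (fun g _ hg _ _ _ _ e => by cases e; exact ⟨hg, hg.choose_spec.valid.1⟩) rfl rfl
  have hne : Side.Mirror g.a b → p ≠ 1 := by
    rintro ⟨s, i, hi, rfl⟩ rfl
    have hR : D.Rem [s] (pre ++ gl :: g :: post) (D.val pre * (D.gv gl *
        ((D.rel g.a)⁻¹ * D.gv g * D.val post))) :=
      (rem_nil pre).append ((((rem_nil post).take g _ _ hi).skip gl))
    have hz := h.min _ _ A (Or.inr (Or.inl ⟨s, rfl⟩)) hR ?_
    · simp at hz
    convert hA using 1
    have hm := rel_mirror_side (D := D) (s := s) (i := i) ⟨rfl, hi ▸ hgv⟩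
    simp only [map_one, mul_one, inv_one, gv, hi, hm, mul_assoc]
  have hq1 : q = 1 → p = 1 := by
    intro hq1
    rw [hq1, map_one, one_mul, mul_eq_left] at hconj
    exact D.of_inj (hconj.trans (map_one _).symm)
  have hglue : D.Glue g.a b q := by
    refine ⟨hopp, ?_, fun hm hq' => hne hm (hq1 hq')⟩
    intro u hu
    rwa [sg_eq hu, hs]
  have hglue' : D.Glue b g.a p⁻¹ := by
    refine ⟨hopp', ?_, ?_⟩
    · intro u hu
      rw [sg_eq hu]
      exact inv_mem hp
    · rintro ⟨s, i, rfl, hi⟩ hp1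
      exact hne ⟨!s, i, hi, by rw [Bool.not_not]⟩ (inv_eq_one.1 hp1)
  obtain ⟨n, hn, hk⟩ := len_eq (D := D)
  obtain ⟨s, i, rfl⟩ : ∃ s i, b = .cell s i := by
    rcases b with ⟨s, i⟩ | u
    · exact ⟨s, i, rfl⟩
    · exact absurd hb.1 (by simp [Side.isBd])
  set b : Side := .cell s i with hbdef
  set c := (Side.next D.m)^[n] (b.next D.m) with hc
  have hcc : c.IsCell D.m := hb.next.iterate_next n
  have hcn : c.next D.m = b := by
    rw [hc, ← Function.iterate_succ_apply' (Side.next D.m), ← Function.iterate_succ_apply]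
    have := iterate_len hb
    rwa [hn] at this
  have hcorner : ∀ {b : Side}, b.IsCell D.m →
      D.Corner δ b (b.next D.m) (D.label b) (-cornerWt D.m b) := by
    rintro (⟨s, i⟩ | u) hb
    · exact .full s i hb.2
    · exact absurd hb.1 (by simp [Side.isBd])
  have hlast := Chain.append (f := false) (.single (hcorner hcc)) (hcn ▸ hglue') hg
  obtain ⟨f'', hlast⟩ := hlast
  have hfirst := hgl.snoc q hglue (hcorner hb)
  set gf : Gap H := ⟨gl.a, b.next D.m, gl.v * q * D.label b,
    gl.S + glueWt D.m g.a b + -cornerWt D.m b⟩ with hgf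
  set gc : Gap H := ⟨c, g.d, D.label c * p⁻¹ * g.v,
    -cornerWt D.m c + glueWt D.m (c.next D.m) g.a + g.S⟩ with hgc
  have hrel : D.rel b = D.tau b * D.of (D.label b) * (D.ev (D.relTok n (b.next D.m)) *
      (D.tau c * D.of (D.label c))) := by
    rw [rel, hn, show n + 2 = (n + 1) + 1 from rfl, relTok, relTok_succ', ← hc]
    simp [tau_cell hb, tau_cell hcc, mul_assoc]
  have hvm : D.val (D.mids n (b.next D.m) gc) =
      (D.of (D.label b))⁻¹ * (D.tau b)⁻¹ * D.rel b * (D.of p)⁻¹ * D.of g.v := by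
    rw [val_mids hb.next, hrel, gv, hgc]
    simp only [map_mul, map_inv]
    group
  have hgfv : D.gv gf = D.gv gl * (D.tau g.a * D.of p * D.tau b * D.of (D.label b)) := by
    rw [hconj, mul_assoc (D.of q), htau]
    simp [gv, hgf, mul_assoc]
  have hnb : (D.rel (b.next D.m))⁻¹ = (D.of (D.label b))⁻¹ * (D.tau b)⁻¹ * (D.rel b)⁻¹ *
      (D.tau b * D.of (D.label b)) := by
    have := rel_mul_step hb
    rw [mul_assoc _ (D.rel b)⁻¹, this]
    group
  have E1 : D.gv gf * D.val (D.mids n (b.next D.m) gc) =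
      D.gv gl * (D.tau g.a * D.of p * D.rel b * (D.of p)⁻¹ * D.of g.v) := by
    rw [hgfv, hvm]
    group
  have E2 : D.gv gf * ((D.rel (b.next D.m))⁻¹ * D.val (D.mids n (b.next D.m) gc)) =
      D.gv gl * D.gv g := by
    rw [hgfv, hvm, hnb, gv, gv]
    group
  obtain ⟨i₁, hi₁⟩ := next_cell D.m s i
  rw [← hbdef] at hi₁
  have key : ∀ r z, D.Rem r (gf :: D.mids n (b.next D.m) gc) z →
      (∃ z', D.Rem r [gl, g] z' ∧ D.Ar 1 (z' * z⁻¹)) ∨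
      (∃ r₁ r₂, r = r₁ ++ s :: r₂ ∧ D.Rem (r₁ ++ r₂) [gl, g] z) ∨
      ∃ r₁ r₂, r = r₁ ++ s :: s :: r₂ := by
    intro r z hz
    have hmid : ∀ {r z}, D.Rem r (D.mids n (b.next D.m) gc) z →
        (r = [] ∧ z = D.val (D.mids n (b.next D.m) gc)) ∨
        (r = [s] ∧ z = (D.rel (b.next D.m))⁻¹ * D.val (D.mids n (b.next D.m) gc)) ∨
        ∃ r', r = s :: s :: r' := by
      intro r z hz
      have hb₁ := hb.next
      rw [hi₁] at hb₁ hz ⊢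
      exact Rem.mids hb₁ n (by rw [hgc, hc, hi₁]) hz
    have hy : ∀ y, D.Ar 1 (y * (D.gv gl * D.gv g) *
        (y * (D.gv gf * D.val (D.mids n (b.next D.m) gc)))⁻¹) := by
      intro y
      rw [E1]
      convert (Ar.rel_inv hb).conj (y * D.gv gl * D.tau g.a * D.of p) using 1
      rw [gv, gv]
      group
    cases hz with
    | skip _ hz =>
      rcases hmid hz with ⟨rfl, rfl⟩ | ⟨rfl, rfl⟩ | ⟨r', rfl⟩
      · refine Or.inl ⟨_, rem_nil _, ?_⟩
        simpa using hy 1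
      · refine Or.inr (Or.inl ⟨[], [], rfl, ?_⟩)
        rw [E2]
        exact rem_nil_iff.2 (by simp)
      · exact Or.inr (Or.inr ⟨[], r', rfl⟩)
    | take _ s' i' hi hz =>
      have hz' := (Rem.nil.skip (D := D) g).take gl s' i' hi
      rcases hmid hz with ⟨rfl, rfl⟩ | ⟨rfl, rfl⟩ | ⟨r', rfl⟩
      · refine Or.inl ⟨_, hz', ?_⟩
        simpa [hgf, mul_assoc] using hy (D.rel gl.a)⁻¹
      · refine Or.inr (Or.inl ⟨[s'], [], rfl, ?_⟩)
        rw [mul_assoc, E2]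
        simpa [hgf, mul_assoc] using hz'
      · exact Or.inr (Or.inr ⟨[s'], r', rfl⟩)
  refine ⟨gf :: (D.mids n (b.next D.m) gc ++ post), ⟨?_, ?_, ?_⟩, ?_⟩
  · refine Path.replace (l := gl :: g :: post) (by simp) (fun a ha => ?_) pre _ h.path
    obtain ⟨rfl, -⟩ := path_cons₂ ha
    refine Path.cons gf _ ⟨_, hfirst⟩ (by rw [hgf, hb.next.ex]; rfl) ?_
    exact Path.mids hb.next n rfl (Path.change hpath gc ⟨_, hlast⟩ rfl)
  · convert hA using 1
    rw [val_append, val_cons, val_append, ← mul_assoc (D.gv gf), E1]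
    group
  · intro r z j hr hz hj
    obtain ⟨r₁, r₂, z₁, z₂, rfl, rfl, hz1, hz2⟩ := hz.of_append
    rw [← List.cons_append] at hz2
    obtain ⟨r₃, r₄, z₃, z₄, rfl, rfl, hz3, hz4⟩ := hz2.of_append
    rcases key _ _ hz3 with ⟨z', hz', ha⟩ | ⟨r₅, r₆, rfl, hz'⟩ | ⟨r₅, r₆, rfl⟩
    · have := h.min _ _ (1 + j) hr (hz1.append (hz'.append hz4)) ?_
      · omega
      · convert (ha.conj z₁).mul hj using 1
        group
    · have := h.min _ _ j (Alt.of_length ?_) (hz1.append (hz'.append hz4)) hj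
      · simp only [List.length_append, List.length_cons] at this ⊢
        omega
      · have := hr.length_le
        simp only [List.length_append, List.length_cons] at this ⊢
        omega
    · refine (Alt.not_double (r₁ := r₁ ++ r₅) (s := s) (r₂ := r₆ ++ r₄) ?_).elim
      simpa using hr
  · have w1 := wt_of_isSome s1
    have w2 : wt gf = wt gl + glueWt D.m g.a b + -cornerWt D.m b := by
      simp only [wt, hgf]; ring
    have w3 : wt gc = -cornerWt D.m c + glueWt D.m b g.a + g.S := by
      simp only [wt, hgc, hcc.1, hcn, Bool.false_and, Bool.false_eq_true, if_false, add_zero]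
    have hsum := glueWt_add_swap (m := D.m) hopp
    have hcs : ∑ i ∈ Finset.range D.len, cornerWt D.m ((Side.next D.m)^[i] b) = 7 * D.k :=
      cornerWt_sum hb D.k
    rw [hn, Finset.sum_range_succ', Finset.sum_range_succ] at hcs
    simp only [Function.iterate_succ_apply, Function.iterate_zero, id, ← hc] at hcs
    simp only [psi_append, psi_cons, psi_mids hb.next]
    rcases hbd : g.a.isBd with _ | _ <;>
      simp only [hbd, hb.1, Bool.or_false, if_true, if_false, Bool.false_eq_true] at * <;> omega

end Setup

/-! ### Peeling off a stable letter -/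

theorem List.split_append {α : Type*} {A B T₁ T₂ : List α} {c : α} (h : A ++ B = T₁ ++ c :: T₂) :
    (∃ y, A = T₁ ++ c :: y ∧ T₂ = y ++ B) ∨ ∃ y, B = y ++ c :: T₂ ∧ T₁ = A ++ y := by
  rcases List.append_eq_append_iff.1 h with ⟨y, rfl, h2⟩ | ⟨y, rfl, h2⟩
  · exact Or.inr ⟨y, h2, rfl⟩
  · rcases y with _ | ⟨c', y⟩
    · exact Or.inr ⟨[], by simpa using h2.symm, by simp⟩
    · simp only [List.cons_append, List.cons.injEq] at h2
      obtain ⟨rfl, rfl⟩ := h2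
      exact Or.inl ⟨y, rfl, rfl⟩

/-- The inverse letter. -/
def Tok.inv : Tok H → Tok H
  | .h g => .h g⁻¹
  | .t u => .t (!u)

/-- The number of stable letters of a letter. -/
def Tok.num : Tok H → ℕ
  | .h _ => 0
  | .t _ => 1

/-- The number of stable letters of a word. -/
def numT (T : List (Tok H)) : ℕ := (T.map Tok.num).sum

@[simp] theorem numT_nil {K : Type*} : numT ([] : List (Tok K)) = 0 := rfl
@[simp] theorem numT_h {K : Type*} (g : K) (T) : numT (.h g :: T) = numT T := by
  simp [numT, Tok.num]
@[simp] theorem numT_t {K : Type*} (u) (T : List (Tok K)) : numT (.t u :: T) = numT T + 1 := by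
  simp [numT, Tok.num, add_comm]
@[simp] theorem numT_append {K : Type*} (T T' : List (Tok K)) :
    numT (T ++ T') = numT T + numT T' := by
  simp [numT]

/-- The inverse word. -/
def invTok (T : List (Tok H)) : List (Tok H) := (T.map Tok.inv).reverse

@[simp] theorem numT_invTok (T : List (Tok H)) : numT (invTok T) = numT T := by
  induction T with
  | nil => rfl
  | cons c T ih =>
    have : invTok (c :: T) = invTok T ++ [c.inv] := by simp [invTok]
    rw [this, numT_append, ih]
    cases c <;> simp [Tok.inv]

namespace Setup

@[simp] theorem ev_invTok (T : List (Tok H)) : D.ev (invTok T) = (D.ev T)⁻¹ := by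
  induction T with
  | nil => simp [invTok]
  | cons c T ih =>
    have : invTok (c :: T) = invTok T ++ [c.inv] := by simp [invTok]
    rw [this, ev_append, ih]
    cases c <;> simp [Tok.inv, sgn_not]

/-- The number of stable letters in the conjugating words. -/
def ln (C : List (List (Tok H) × Side)) : ℕ := (C.map fun c => numT c.1).sum

@[simp] theorem ln_nil {K : Type*} : ln ([] : List (List (Tok K) × Side)) = 0 := rfl
@[simp] theorem ln_cons {K : Type*} (c) (C : List (List (Tok K) × Side)) :
    ln (c :: C) = numT c.1 + ln C := by
  simp [ln]
@[simp] theorem ln_append {K : Type*} (C C' : List (List (Tok K) × Side)) :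
    ln (C ++ C') = ln C + ln C' := by
  simp [ln]

theorem cells_nil : D.Cells [] := by simp [Cells]

theorem cells_cons {c C} : D.Cells (c :: C) ↔ c.2.IsCell D.m ∧ D.Cells C := by
  simp [Cells]

theorem cells_append {C C'} : D.Cells (C ++ C') ↔ D.Cells C ∧ D.Cells C' := by
  simp only [Cells, List.mem_append]
  exact ⟨fun h => ⟨fun c hc => h c (Or.inl hc), fun c hc => h c (Or.inr hc)⟩,
    fun h c hc => hc.elim (h.1 c) (h.2 c)⟩

variable (D) in
/-- The word spelling a product of conjugates. -/
def tokC (C : List (List (Tok H) × Side)) : List (Tok H) :=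
  (C.map fun c => c.1 ++ (D.relTok D.len c.2 ++ invTok c.1)).flatten

@[simp] theorem ev_tokC (C) : D.ev (D.tokC C) = D.evC C := by
  induction C with
  | nil => rfl
  | cons c C ih =>
    rw [tokC, List.map_cons, List.flatten_cons, ev_append]
    change _ * D.ev (D.tokC C) = _
    rw [ih]
    simp [evC, rel, mul_assoc]

theorem tokC_split {C T₁ T₂ c} (h : D.tokC C = T₁ ++ c :: T₂) :
    ∃ C₁ x b C₂ T T', C = C₁ ++ (x, b) :: C₂ ∧
      x ++ (D.relTok D.len b ++ invTok x) = T ++ c :: T' ∧ D.ev T₁ = D.evC C₁ * D.ev T := by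
  induction C generalizing T₁ with
  | nil => simp [tokC] at h
  | cons a C ih =>
    obtain ⟨x, b⟩ := a
    rw [tokC, List.map_cons, List.flatten_cons] at h
    rcases List.split_append h with ⟨y, h1, h2⟩ | ⟨y, h1, rfl⟩
    · exact ⟨[], x, b, C, T₁, y, rfl, h1, by simp⟩
    · obtain ⟨C₁, x', b', C₂, T, T', rfl, h3, h4⟩ := ih h1
      refine ⟨(x, b) :: C₁, x', b', C₂, T, T', rfl, h3, ?_⟩
      simp [h4, rel, mul_assoc]

theorem relTok_split {n b T T' u} (hb : b.IsCell D.m) (h : D.relTok n b = T ++ .t u :: T') :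
    ∃ i, T = D.relTok i b ∧ ((Side.next D.m)^[i] b).sg = u := by
  induction n generalizing b T with
  | zero => simp [relTok] at h
  | succ n ih =>
    rw [relTok] at h
    match T, h with
    | [], h =>
      simp only [List.nil_append, List.cons.injEq, Tok.t.injEq] at h
      exact ⟨0, rfl, h.1⟩
    | [c], h => simp at h
    | c :: c' :: T, h =>
      simp only [List.cons_append, List.cons.injEq] at h
      obtain ⟨rfl, rfl, h⟩ := h
      obtain ⟨i, rfl, hi⟩ := ih hb.next h
      exact ⟨i + 1, rfl, hi⟩

/-- Cancelling a stable letter with a letter of a conjugate of the relator. -/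
theorem conj_occ {x b T T' u Q p} (hb : b.IsCell D.m)
    (h : x ++ (D.relTok D.len b ++ invTok x) = T ++ .t (!u) :: T') (hp : p ∈ D.Sub u)
    (hQ : Q * D.ev T = D.of p) :
    (∃ z, numT z < numT x ∧ sgn D.t u * (Q * (D.ev x * D.rel b * (D.ev x)⁻¹)) =
      D.ev z * D.rel b * (D.ev z)⁻¹ * (sgn D.t u * Q)) ∨
    (∃ b' : Side, b'.IsCell D.m ∧ b'.sg = !u ∧ Q * (D.ev x * D.rel b * (D.ev x)⁻¹) =
      D.of p * D.rel b' * (D.of p)⁻¹ * Q) ∨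
    (∃ z, numT z < numT x ∧ Q * (D.ev x * D.rel b * (D.ev x)⁻¹) =
      D.ev z * D.rel b * (D.ev z)⁻¹ * Q) := by
  rcases List.split_append h with ⟨y, rfl, -⟩ | ⟨y, h', rfl⟩
  · left
    obtain ⟨q, -, hq⟩ := D.conj u p hp
    refine ⟨.h q :: y, by simp; omega, ?_⟩
    have hz : D.ev (.h q :: y) = sgn D.t u * (Q * D.ev (T ++ .t (!u) :: y)) := by
      rw [ev_append, ← mul_assoc Q, hQ, ← mul_assoc, hq]
      simp [sgn_not]
    rw [hz]
    group
  rcases List.split_append h' with ⟨y', h, -⟩ | ⟨y', h'', rfl⟩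
  · right; left
    obtain ⟨i, rfl, hi⟩ := relTok_split hb h
    refine ⟨_, hb.iterate_next i, hi, ?_⟩
    rw [← hQ]
    have := rel_mul_relTok hb i
    rw [← eq_mul_inv_iff_mul_eq] at this
    rw [this, ev_append]
    group
  · right; right
    refine ⟨.h p :: invTok y', ?_, ?_⟩
    · have := numT_invTok x
      rw [h''] at this
      simp at this ⊢
      omega
    · have hQx : Q * D.ev x = D.of p * (D.ev y')⁻¹ * (D.rel b)⁻¹ := by
        rw [← hQ]
        simp only [ev_append, rel]
        group
      calc _ = (Q * D.ev x) * D.rel b * (Q * D.ev x)⁻¹ * Q := by group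
        _ = _ := by
          rw [hQx]
          simp only [ev_h, ev_invTok]
          group

theorem peel_step {h₀ u V B C x b T T' Q p R B₁ C₁} (hp : p ∈ D.Sub u)
    (h : D.of h₀ * sgn D.t u * (D.evC B * D.ev V * D.evC C) = 1) (hb : b.IsCell D.m)
    (hx : x ++ (D.relTok D.len b ++ invTok x) = T ++ .t (!u) :: T') (hQ : Q * D.ev T = D.of p)
    (e1 : D.evC B * D.ev V * D.evC C = Q * (D.ev x * D.rel b * (D.ev x)⁻¹) * R)
    (e2 : D.evC B₁ * D.ev V * D.evC C₁ = Q * R) (hB : D.Cells B₁) (hC : D.Cells C₁)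
    (hl : B₁.length + C₁.length + 1 = B.length + C.length)
    (hn : ln B₁ + ln C₁ + numT x = ln B + ln C) :
    (∃ p ∈ D.Sub u, ∃ b : Side, b.IsCell D.m ∧ b.sg = (!u) ∧ ∃ N, N + 1 = B.length + C.length ∧
      D.Ar N (D.of h₀ * sgn D.t u * D.of p * D.rel b * (D.of p)⁻¹ * D.ev V)) ∨
    ∃ B' C', D.Cells B' ∧ D.Cells C' ∧ B'.length + C'.length = B.length + C.length ∧
      ln B' + ln C' < ln B + ln C ∧
      D.of h₀ * sgn D.t u * (D.evC B' * D.ev V * D.evC C') = 1 := by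
  rw [e1] at h
  rcases conj_occ hb hx hp hQ with ⟨z, hz, he⟩ | ⟨b', hb', hs, he⟩ | ⟨z, hz, he⟩
  · refine Or.inr ⟨B₁, C₁ ++ [(.h h₀ :: z, b)], hB, cells_append.2 ⟨hC, cells_cons.2
      ⟨hb, cells_nil⟩⟩, by simp; omega, by simp; omega, ?_⟩
    have h' : D.of h₀ * (D.ev z * D.rel b * (D.ev z)⁻¹) * (sgn D.t u * (Q * R)) = 1 := by
      calc _ = D.of h₀ * (D.ev z * D.rel b * (D.ev z)⁻¹ * (sgn D.t u * Q)) * R := by group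
        _ = 1 := by
          rw [← he, ← h]
          group
    replace h' := eq_inv_of_mul_eq_one_right h'
    calc _ = D.of h₀ * (sgn D.t u * (D.evC B₁ * D.ev V * D.evC C₁)) *
          (D.of h₀ * D.ev z * D.rel b * (D.of h₀ * D.ev z)⁻¹) := by
          simp [mul_assoc]
      _ = 1 := by rw [e2, h']; group
  · refine Or.inl ⟨p, hp, b', hb', hs, B₁.length + C₁.length, by omega, ?_⟩
    rw [he] at h
    set Y := D.of h₀ * sgn D.t u * D.of p * D.rel b' * (D.of p)⁻¹ with hY
    have h' : Y * (D.evC B₁ * D.ev V * D.evC C₁) = 1 := by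
      rw [e2, ← h, hY]
      group
    have := ((Ar.evC hB).inv.conj Y).mul (Ar.evC hC).inv
    convert this using 1
    rw [mul_eq_one_iff_eq_inv, mul_inv_rev] at h'
    have h'' : Y = (D.evC C₁)⁻¹ * ((D.ev V)⁻¹ * (D.evC B₁)⁻¹) := by rw [h', mul_inv_rev]
    rw [h'']
    group
  · refine Or.inr ⟨(z, b) :: B₁, C₁, cells_cons.2 ⟨hb, hB⟩, hC, by simp; omega,
      by simp; omega, ?_⟩
    rw [he] at h
    rw [evC_cons, mul_assoc (D.ev z * _ * _), mul_assoc (D.ev z * _ * _), e2, ← h]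
    group

theorem peel {h₀ u V} (n : ℕ) : ∀ {B C}, ln B + ln C ≤ n → D.Cells B → D.Cells C →
    D.of h₀ * sgn D.t u * (D.evC B * D.ev V * D.evC C) = 1 →
    (∃ p ∈ D.Sub u, ∃ b : Side, b.IsCell D.m ∧ b.sg = (!u) ∧ ∃ N, N + 1 = B.length + C.length ∧
      D.Ar N (D.of h₀ * sgn D.t u * D.of p * D.rel b * (D.of p)⁻¹ * D.ev V)) ∨
    ∃ V₁ V₂ B' C', V = V₁ ++ .t (!u) :: V₂ ∧ D.Cells B' ∧ D.Cells C' ∧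
      B'.length + C'.length = B.length + C.length ∧ ln B' + ln C' ≤ ln B + ln C ∧
      ∃ p ∈ D.Sub u, D.evC B' * D.ev V₁ = D.of p ∧
        D.of h₀ * sgn D.t u * D.of p * sgn D.t (!u) * (D.ev V₂ * D.evC C') = 1 := by
  induction n using Nat.strong_induction_on with
  | _ n ih =>
  intro B C hn hB hC h
  have hK : D.ev (D.tokC B ++ (V ++ D.tokC C)) = D.evC B * D.ev V * D.evC C := by
    simp [mul_assoc]
  have hr : D.ev (.t u :: (D.tokC B ++ (V ++ D.tokC C))) = D.of h₀⁻¹ := by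
    rw [ev_t, hK, map_inv]
    rw [mul_assoc] at h
    exact (inv_eq_of_mul_eq_one_right h).symm
  obtain ⟨T₁, T₂, hT, p, hp, hT₁⟩ := D.partner u _ ⟨_, hr.symm⟩
  change D.ev T₁ = _ at hT₁
  have fin : ∀ {B' C'}, D.Cells B' → D.Cells C' → B'.length + C'.length = B.length + C.length →
      ln B' + ln C' < ln B + ln C →
      D.of h₀ * sgn D.t u * (D.evC B' * D.ev V * D.evC C') = 1 → _ :=
    fun {B' C'} hB' hC' hl hlt h' => ih _ (lt_of_lt_of_le hlt hn) le_rfl hB' hC' h'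
  rcases List.split_append hT with ⟨y, h1, -⟩ | ⟨y, h1, rfl⟩
  · obtain ⟨C₁, x, b, C₂, T, T', rfl, hx, h2⟩ := tokC_split h1
    rw [cells_append, cells_cons] at hB
    rcases peel_step (B₁ := C₁ ++ C₂) (C₁ := C) (R := D.evC C₂ * D.ev V * D.evC C) hp h hB.2.1 hx
      (h2.symm.trans hT₁) (by simp [mul_assoc]) (by simp [mul_assoc])
      (cells_append.2 ⟨hB.1, hB.2.2⟩) hC (by simp; omega) (by simp; omega) with
      h3 | ⟨B', C', hB', hC', hl, hlt, h'⟩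
    · exact Or.inl h3
    · rw [← hl]
      refine (fin hB' hC' hl hlt h').imp id ?_
      rintro ⟨V₁, V₂, B'', C'', hV, h4, h5, h6, h7, h8⟩
      exact ⟨V₁, V₂, B'', C'', hV, h4, h5, h6, h7.trans hlt.le, h8⟩
  rcases List.split_append h1 with ⟨y', rfl, -⟩ | ⟨y', h1', rfl⟩
  · rw [ev_append, ev_tokC] at hT₁
    refine Or.inr ⟨y, y', B, C, rfl, hB, hC, rfl, le_rfl, p, hp, hT₁, ?_⟩
    rw [← h, ← hT₁]
    simp [mul_assoc]
  · obtain ⟨C₁, x, b, C₂, T, T', rfl, hx, h2⟩ := tokC_split h1'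
    rw [cells_append, cells_cons] at hC
    rw [ev_append, ev_append, ev_tokC, h2, ← mul_assoc, ← mul_assoc] at hT₁
    rcases peel_step (B₁ := B) (C₁ := C₁ ++ C₂) (R := D.evC C₂) hp h hC.2.1 hx
      hT₁ (by simp [mul_assoc]) (by simp [mul_assoc]) hB
      (cells_append.2 ⟨hC.1, hC.2.2⟩) (by simp; omega) (by simp; omega) with
      h3 | ⟨B', C', hB', hC', hl, hlt, h'⟩
    · exact Or.inl h3
    · rw [← hl]
      refine (fin hB' hC' hl hlt h').imp id ?_
      rintro ⟨V₁, V₂, B'', C'', hV, h4, h5, h6, h7, h8⟩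
      exact ⟨V₁, V₂, B'', C'', hV, h4, h5, h6, h7.trans hlt.le, h8⟩

end Setup

/-! ### The isoperimetric inequality for boundaries of minimal diagrams -/

/-- The word spelled by a sequence of stable letters and elements of the base. -/
def toks (ps : List (Bool × H)) : List (Tok H) := (ps.map fun x => [.t x.1, .h x.2]).flatten

@[simp] theorem toks_nil {K : Type*} : toks ([] : List (Bool × K)) = [] := rfl
@[simp] theorem toks_cons {K : Type*} (x : Bool × K) (ps) :
    toks (x :: ps) = .t x.1 :: .h x.2 :: toks ps := rfl
@[simp] theorem toks_append {K : Type*} (ps ps' : List (Bool × K)) :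
    toks (ps ++ ps') = toks ps ++ toks ps' := by
  simp [toks]

theorem toks_split {K : Type*} {ps : List (Bool × K)} {q u T T'}
    (h : toks ps ++ [.h q] = T ++ .t u :: T') :
    ∃ ps₁ g ps₂, ps = ps₁ ++ (u, g) :: ps₂ ∧ T = toks ps₁ ∧ T' = .h g :: (toks ps₂ ++ [.h q]) := by
  induction ps generalizing T with
  | nil =>
    rcases T with _ | ⟨c, T⟩ <;> simp at h
  | cons x ps ih =>
    obtain ⟨u', g⟩ := x
    match T, h with
    | [], h =>
      simp only [toks_cons, List.cons_append, List.nil_append, List.cons.injEq, Tok.t.injEq] at h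
      obtain ⟨rfl, rfl⟩ := h
      exact ⟨[], g, ps, rfl, rfl, rfl⟩
    | [c], h => simp at h
    | c :: c' :: T, h =>
      simp only [toks_cons, List.cons_append, List.cons.injEq] at h
      obtain ⟨rfl, rfl, h⟩ := h
      obtain ⟨ps₁, g', ps₂, rfl, rfl, rfl⟩ := ih h
      exact ⟨_ :: ps₁, g', ps₂, rfl, rfl, rfl⟩

namespace Setup

variable (D) in
/-- No nontrivial element of the base is a product of `n` conjugates of the relator. -/
def Inj (n : ℕ) : Prop := ∀ h, D.Ar n (D.of h) → h = 1

theorem exists_move (N : ℕ) : ∀ {ps : List (Bool × H)} {h₀ q n}, ps.length ≤ N → ps ≠ [] →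
    (∀ j ≤ n, D.Inj j) → D.Ar n (D.of h₀ * D.ev (toks ps) * D.of q) →
    (∃ pre u h h' post, ps = pre ++ (u, h) :: (!u, h') :: post ∧ h ∈ D.Sub u) ∨
    ∃ pre u h post, ps = pre ++ (u, h) :: post ∧ ∃ p ∈ D.Sub u, ∃ b : Side, b.IsCell D.m ∧
      b.sg = (!u) ∧ ∃ A, A + 1 = n ∧ D.Ar A (D.of h₀ * D.ev (toks pre) *
        (sgn D.t u * D.of p * D.rel b * (D.of p)⁻¹ * D.of h) * D.ev (toks post) * D.of q) := by
  induction N using Nat.strong_induction_on with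
  | _ N ih =>
  intro ps h₀ q n hN hps hinj hA
  obtain ⟨⟨u, h₁⟩, r, rfl⟩ := List.exists_cons_of_ne_nil hps
  obtain ⟨C, hC, hCn, hCe⟩ := hA.inv
  have hpeel : D.of h₀ * sgn D.t u *
      (D.evC [] * D.ev (.h h₁ :: (toks r ++ [.h q])) * D.evC C) = 1 := by
    rw [hCe]
    simp [mul_assoc]
  rcases peel _ le_rfl cells_nil hC hpeel with ⟨p, hp, b, hb, hs, A, hAn, hAr⟩ |
    ⟨V₁, V₂, B', C', hV, hB', hC', hl, -, p, hp, hV₁, hV₂⟩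
  · refine Or.inr ⟨[], u, h₁, r, rfl, p, hp, b, hb, hs, A, by simpa [hCn] using hAn, ?_⟩
    convert hAr using 1
    simp [mul_assoc]
  obtain ⟨c, V₁, rfl⟩ : ∃ c V, V₁ = c :: V := by
    rcases V₁ with _ | ⟨c, V⟩
    · simp at hV
    · exact ⟨c, V, rfl⟩
  rw [List.cons_append, List.cons.injEq] at hV
  obtain ⟨rfl, hV⟩ := hV
  obtain ⟨r₁, h₂, r₂, rfl, rfl, rfl⟩ := toks_split hV
  simp only [List.length_nil, zero_add, hCn] at hl
  have hB : D.Ar B'.length (D.of h₁ * D.ev (toks r₁) * D.of p⁻¹) := by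
    convert (Ar.evC hB').inv using 1
    rw [map_inv, ← hV₁, ev_h]
    group
  have hCe' : D.Ar C'.length (D.of h₀ * sgn D.t u * D.of p * sgn D.t (!u) *
      (D.of h₂ * D.ev (toks r₂) * D.of q)) := by
    convert (Ar.evC hC').inv using 1
    rw [eq_inv_iff_mul_eq_one, ← hV₂]
    simp [mul_assoc]
  rcases eq_or_ne r₁ [] with rfl | hr₁
  · refine Or.inl ⟨[], u, h₁, h₂, r₂, rfl, ?_⟩
    have : h₁ * p⁻¹ = 1 := hinj B'.length (by omega) _ (by simpa using hB)
    rw [mul_inv_eq_one] at this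
    exact this ▸ hp
  · rcases ih r₁.length (by simp at hN; omega) le_rfl hr₁ (fun j hj => hinj j (by omega)) hB with
      ⟨pre, u', h, h', post, rfl, hmem⟩ | ⟨pre, u', h, post, rfl, p', hp', b, hb, hs, A, hAn, hAr⟩
    · exact Or.inl ⟨(u, h₁) :: pre, u', h, h', post ++ (!u, h₂) :: r₂, by simp, hmem⟩
    · refine Or.inr ⟨(u, h₁) :: pre, u', h, post ++ (!u, h₂) :: r₂, by simp, p', hp', b, hb, hs,
        A + C'.length, by omega, ?_⟩
      convert (hAr.conj (D.of h₀ * sgn D.t u)).mul hCe' using 1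
      simp only [toks_cons, toks_append, ev_append, ev_t, ev_h, map_inv]
      group

theorem Path.letters {a l} (h : D.Path δ a l) :
    ∃ g l', l = g :: l' ∧ g.a = a ∧ ∀ g' ∈ l', g'.a.ex.isSome := by
  induction h with
  | last g hg hd => exact ⟨g, [], rfl, rfl, by simp⟩
  | cons g l hg hd hl ih =>
    obtain ⟨g', l', rfl, h1, h2⟩ := ih
    refine ⟨g, g' :: l', rfl, rfl, ?_⟩
    simp only [List.mem_cons, forall_eq_or_imp]
    exact ⟨h1 ▸ hd, h2⟩

theorem Path.singleton {a g} (h : D.Path δ a [g]) :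
    (∃ f, D.Chain δ f g.a g.d g.v g.S) ∧ g.d.isBd = true := by
  generalize he : [g] = l at h
  cases h with
  | last _ hg hd =>
    cases he
    exact ⟨hg, hd⟩
  | cons _ _ _ _ hl =>
    cases he
    obtain ⟨_, _, he, -⟩ := hl.letters
    simp at he

/-- The letters of a sequence of gaps. -/
def pairs {K : Type*} (l : List (Gap K)) : List (Bool × K) := l.map fun g => (g.a.sg, g.v)

theorem val_eq {l : List (Gap H)} (h : ∀ g ∈ l, g.a.ex.isSome) :
    D.val l = D.ev (toks (pairs l)) := by
  induction l with
  | nil => rfl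
  | cons g l ih =>
    simp only [List.mem_cons, forall_eq_or_imp] at h
    rw [val_cons, ih h.2, gv, D.tau_of_isSome h.1]
    simp [pairs, mul_assoc]

theorem Holds.two_mul_le (h1 : -7 ≤ δ) (h2 : δ ≤ 8) (A : ℕ) : ∀ (N : ℕ) {l}, l.length ≤ N →
    (∀ j ≤ A, D.Inj j) → D.Holds δ A l → 2 * (A : ℤ) ≤ psi l := by
  induction A using Nat.strong_induction_on with
  | _ A ihA =>
  intro N
  induction N using Nat.strong_induction_on with
  | _ N ih =>
  intro l hN hinj h
  obtain ⟨g₀, l', rfl, hg₀, hl'⟩ := h.path.letters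
  have hv₀ : D.gv g₀ = D.of g₀.v := by simp [gv, tau, hg₀, Side.ex]
  rcases eq_or_ne l' [] with rfl | hne
  · have hA : A = 0 := by
      have ha := h.area
      rw [val_cons, hv₀, val_nil, mul_one] at ha
      have := h.min [] _ 0 (Or.inl rfl) (rem_nil _) (by
        rw [val_cons, hv₀, val_nil, mul_one, hinj A le_rfl _ ha, map_one]
        exact Ar.one)
      simpa using this
    have hS : 0 ≤ g₀.S := by
      obtain ⟨⟨f, hf⟩, hd⟩ := h.path.singleton
      have := hf.le h1 h2
      rw [hg₀] at this
      rcases hd' : g₀.d with _ | u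
      · simp [hd', Side.isBd] at hd
      · rw [hd'] at this
        simp only [depPot, arrPot, Side.next, cornerWt] at this
        split_ifs at this <;> omega
    simp [hA, wt, hg₀, Side.ex, hS]
  have hval : ∀ l₁ l₂, l' = l₁ ++ l₂ → D.val l₁ = D.ev (toks (pairs l₁)) ∧
      D.val l₂ = D.ev (toks (pairs l₂)) := fun l₁ l₂ e =>
    ⟨val_eq fun g hg => hl' g (by simp [e, hg]), val_eq fun g hg => hl' g (by simp [e, hg])⟩
  have ha : D.Ar A (D.of g₀.v * D.ev (toks (pairs l')) * D.of 1) := by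
    have := h.area
    rwa [val_cons, hv₀, (hval l' [] (by simp)).1, ← mul_one (_ * _), ← map_one D.of] at this
  rcases exists_move _ le_rfl (by simpa [pairs] using hne) hinj ha with
    ⟨pre, u, v, v', post, he, hmem⟩ | ⟨pre, u, v, post, he, p, hp, b, hb, hs, A', hA', har⟩
  · obtain ⟨l₁, l₂, rfl, rfl, he'⟩ := List.map_eq_append_iff.1 he
    obtain ⟨g, l₂, rfl, hg, he'⟩ := List.map_eq_cons_iff.1 he'
    obtain ⟨g', l₂, rfl, hg', rfl⟩ := List.map_eq_cons_iff.1 he'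
    simp only [Prod.mk.injEq] at hg hg'
    obtain ⟨rfl, rfl⟩ := hg
    obtain ⟨pr, gl, hpr⟩ : ∃ pr gl, g₀ :: l₁ = pr ++ [gl] :=
      ⟨_, _, (List.dropLast_append_getLast (by simp)).symm⟩
    have e : g₀ :: (l₁ ++ g :: g' :: l₂) = pr ++ gl :: g :: g' :: l₂ := by
      rw [← List.cons_append, hpr]
      simp
    rw [e] at h hN ⊢
    obtain ⟨g₁, hh, hpsi⟩ := h.cmove h1 h2 hg'.1 hmem
    refine (ih _ ?_ le_rfl hinj hh).trans hpsi
    simp only [List.length_append, List.length_cons] at hN ⊢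
    omega
  · obtain ⟨l₁, l₂, rfl, rfl, he'⟩ := List.map_eq_append_iff.1 he
    obtain ⟨g, l₂, rfl, hg, rfl⟩ := List.map_eq_cons_iff.1 he'
    simp only [Prod.mk.injEq] at hg
    obtain ⟨rfl, rfl⟩ := hg
    obtain ⟨pr, gl, hpr⟩ : ∃ pr gl, g₀ :: l₁ = pr ++ [gl] :=
      ⟨_, _, (List.dropLast_append_getLast (by simp)).symm⟩
    have e : g₀ :: (l₁ ++ g :: l₂) = pr ++ gl :: g :: l₂ := by
      rw [← List.cons_append, hpr]
      simp
    have hpv : D.val pr * D.gv gl = D.of g₀.v * D.val l₁ := by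
      rw [← hv₀, ← val_cons, hpr]
      simp
    subst hA'
    rw [e] at h ⊢
    obtain ⟨l₃, hh, hpsi⟩ := h.rmove hp hb hs (by
      convert har using 1
      rw [hpv, (hval l₁ _ rfl).1, (hval (l₁ ++ [g]) l₂ (by simp)).2,
        D.tau_of_isSome (hl' g (by simp))]
      simp [pairs, mul_assoc])
    have := ihA A' (by omega) _ le_rfl (fun j hj => hinj j (by omega)) hh
    push_cast
    omega

end Setup

/-! ### Injectivity of the base -/

namespace Setup

theorem Path.of_mids {b : Side} {n : ℕ} {g : Gap H} {g₀ : Gap H} (hb : b.IsCell D.m)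
    (hg : g.a = (Side.next D.m)^[n] b) (hd : g.d.isBd = true)
    (hch : ∃ f, D.Chain δ f g.a g.d g.v g.S) (h₀ : ∃ f, D.Chain δ f g₀.a g₀.d g₀.v g₀.S)
    (hd₀ : g₀.d = b) : D.Path δ g₀.a (g₀ :: D.mids n b g) := by
  refine .cons g₀ _ h₀ (by rw [hd₀, hb.ex]; rfl) ?_
  have := Path.mids hb n hg (post := []) (.last g hch hd)
  rw [hd₀]
  rwa [List.append_nil] at this

/-- The case of a conjugating element in the base. -/
theorem inj_aux {s : ℕ} (hinj : ∀ j < s + 1, D.Inj j) {h a : H} {b : Side} (hb : b.IsCell D.m)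
    (hA : D.Ar s (D.of h * D.of a * D.rel b * (D.of a)⁻¹)) : h = 1 := by
  by_contra hne
  obtain ⟨n, hn, hk⟩ := len_eq (D := D)
  obtain ⟨sg, i, rfl⟩ : ∃ s i, b = .cell s i := by
    rcases b with ⟨s, i⟩ | u
    · exact ⟨s, i, rfl⟩
    · exact absurd hb.1 (by simp [Side.isBd])
  set b : Side := .cell sg i with hbdef
  set c := (Side.next D.m)^[n + 1] b with hc
  have hcc : c.IsCell D.m := hb.iterate_next _
  have hcn : c.next D.m = b := by
    have := iterate_len hb
    rwa [hn, Function.iterate_succ_apply'] at this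
  have hδ : ∀ δ, depPot D.m δ b = depPot D.m 0 b := fun δ => by rw [hbdef]; cases sg <;> rfl
  set δ := depPot D.m 0 b with hδdef
  have hbound := depPot_bounds D.m (δ := 0) (by norm_num) (by norm_num) b
  set g₀ : Gap H := ⟨.bd none, b, h * a, 0⟩ with hg₀
  set g : Gap H := ⟨c, .bd none, D.label c * a⁻¹, 0⟩ with hg
  have hgv₀ : D.gv g₀ = D.of h * D.of a := by simp [gv, tau, Side.ex, hg₀]
  have hval : D.val (D.mids (n + 1) b g) = D.rel b * (D.of a)⁻¹ := by
    rw [val_mids hb, rel, hn, D.relTok_succ' (n + 1)]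
    simp only [gv, hg, tau_cell hcc, ← hc, ev_append, ev_t, ev_h, ev_nil, map_mul, map_inv]
    simp only [mul_assoc, one_mul]
  have key : ∀ j, D.Ar j (D.of h) → s + 1 ≤ j := by
    intro j hj
    by_contra hlt
    exact hne (hinj j (by omega) h hj)
  have hH : D.Holds δ s (g₀ :: D.mids (n + 1) b g) := by
    refine ⟨?_, ?_, ?_⟩
    · refine Path.of_mids (g₀ := g₀) hb rfl rfl ⟨false, .single (.finish c _ none hcc.1 hcc.2 ?_)⟩
        ⟨false, .single (.start none _ b hb.1 hb.2 (hδ δ))⟩ rfl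
      rw [arrPot, hcn, hδ]
    · rw [val_cons, hgv₀, hval, ← mul_assoc]
      exact hA
    · intro r z j hr hR hj
      cases hR with
      | skip _ hR =>
        rw [hgv₀] at hj
        rcases Rem.mids hb (n + 1) (g := g) rfl hR with ⟨rfl, rfl⟩ | ⟨rfl, rfl⟩ | ⟨r', rfl⟩
        · rw [hval] at hj
          have := key (j + 1) (by
            convert hj.mul ((Ar.rel_inv hb).conj (D.of a)) using 1
            group)
          simp
          omega
        · rw [hval] at hj
          have := key j (by
            convert hj using 1
            rw [← hbdef]
            group)
          simpa using this
        · exact (Alt.not_double (r₁ := []) hr).elim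
      | take _ _ _ hg => simp [hg₀] at hg
  have := hH.two_mul_le hbound.1 hbound.2 s _ le_rfl fun j hj => hinj j (by omega)
  rw [psi_cons, psi_mids hb] at this
  have hsum := cornerWt_sum hb D.k
  rw [show D.k * (2 * D.m + 1) = n + 2 from hn, Finset.sum_range_succ] at hsum
  rw [← hc] at hsum
  have := (cornerWt_bounds D.m c).2
  have hw₀ : wt g₀ = 0 := by simp [wt, hg₀, Side.ex]
  have hw : wt g = 0 := by simp [wt, hg, hcc.1]
  have hk' : (D.k : ℤ) ≥ 2 := by exact_mod_cast D.two_le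
  omega

theorem ev_cases (x : List (Tok H)) : (∃ a, D.ev x = D.of a) ∨
    ∃ c u y, D.ev x = D.of c * sgn D.t u * D.ev y ∧ numT y < numT x := by
  induction x with
  | nil => exact Or.inl ⟨1, by simp⟩
  | cons e x ih =>
    cases e with
    | h g =>
      rcases ih with ⟨a, ha⟩ | ⟨c, u, y, h, hlt⟩
      · exact Or.inl ⟨g * a, by simp [ha]⟩
      · exact Or.inr ⟨g * c, u, y, by simp [h, mul_assoc], by simpa [numT, Tok.num] using hlt⟩
    | t u => exact Or.inr ⟨1, u, x, by simp, by simp [numT, Tok.num]⟩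

variable (D) in
/-- The base embeds into the quotient by the relator. -/
theorem inj (s : ℕ) : D.Inj s := by
  induction s using Nat.strong_induction_on with
  | _ s ih =>
  suffices ∀ (n : ℕ) (h : H) C, D.Cells C → C.length = s → D.evC C = D.of h → ln C = n → h = 1 by
    rintro h ⟨C, h1, h2, h3⟩
    exact this _ h C h1 h2 h3 rfl
  intro n
  induction n using Nat.strong_induction_on with
  | _ n ihn =>
  intro h C hC hs hE hn
  rcases C with _ | ⟨⟨x, b⟩, C⟩
  · exact D.of_inj (by rw [← hE, map_one, evC_nil])
  rw [cells_cons] at hC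
  obtain ⟨hb, hC⟩ := hC
  rw [evC_cons] at hE
  rcases ev_cases (D := D) x with ⟨a, ha⟩ | ⟨c, u, y, hx, hlt⟩
  · rw [← inv_eq_one]
    subst hs
    refine inj_aux (s := C.length) (fun j hj => ih j hj) hb (a := a) ?_
    convert (Ar.evC hC).inv using 1
    rw [eq_inv_iff_mul_eq_one, map_inv, ← hE, ha]
    group
  have hpeel : D.of (h⁻¹ * c) * sgn D.t u *
      (D.evC [(y, b)] * D.ev [.t (!u), .h c⁻¹] * D.evC C) = 1 := by
    rw [map_mul, map_inv, ← hE, hx]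
    simp only [evC_cons, evC_nil, ev_t, ev_h, ev_nil, sgn_not, map_inv]
    group
  simp only [List.length_cons] at hs
  have hln : ln [(y, b)] + ln C < n := by
    rw [← hn]
    simpa [ln] using hlt
  rcases peel _ le_rfl (by simpa [cells_cons, cells_nil] using hb) hC hpeel with
    ⟨p, hp, b', hb', hs', N, hN, hAr⟩ | ⟨V₁, V₂, B', C', hV, hB', hC', hl, hl', p, hp, h1, h2⟩
  · obtain ⟨q, hq, hconj⟩ := D.conj u p hp
    have hN : N + 1 = s := by simp at hN; omega
    subst hN
    refine inj_aux (fun j hj => ih j hj) hb'.mirror (a := c * q) ?_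
    have e : (D.of (h⁻¹ * c) * sgn D.t u * D.of p * D.rel b' * (D.of p)⁻¹ *
        D.ev [.t (!u), .h c⁻¹])⁻¹ =
        D.of (c * q) * D.rel b'.mirror * (D.of (c * q))⁻¹ * D.of h := by
      rw [rel_mirror hb', hs', mul_assoc (D.of (h⁻¹ * c)), hconj]
      have hconj' : (D.of p)⁻¹ = (sgn D.t u)⁻¹ * (D.of q)⁻¹ * sgn D.t u := by
        rw [← mul_inv_rev, ← hconj]
        group
      rw [hconj']
      simp only [ev_t, ev_h, ev_nil, sgn_not, map_mul, map_inv]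
      group
    have := hAr.inv
    rw [e] at this
    convert this.cyc using 1
    group
  · obtain ⟨rfl, rfl⟩ : V₁ = [] ∧ V₂ = [.h c⁻¹] := by
      rcases V₁ with _ | ⟨e, _ | ⟨e', V₁⟩⟩
      · simpa using hV.symm
      · simp at hV
      · simp at hV
    obtain ⟨q, hq, hconj⟩ := D.conj u p hp
    simp only [ev_nil, mul_one] at h1
    simp only [List.length_cons, List.length_nil] at hl
    have h2' : D.evC C' = D.of (c * q⁻¹ * c⁻¹ * h) := by
      rw [mul_assoc (D.of _), hconj, sgn_not] at h2
      simp only [ev_h, ev_nil] at h2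
      have h2 := eq_inv_of_mul_eq_one_right h2
      rw [mul_one, map_inv, inv_mul_eq_iff_eq_mul] at h2
      rw [h2]
      simp only [map_mul, map_inv]
      group
    have hq1 : p = 1 → q = 1 := by
      rintro rfl
      rw [map_one, mul_one, right_eq_mul, ← map_one D.of] at hconj
      exact D.of_inj hconj
    rcases lt_or_ge B'.length s with hlt' | hge
    · rw [hq1 (ih _ hlt' p ⟨B', hB', rfl, h1⟩)] at h2'
      simp only [inv_one, mul_one, mul_inv_cancel, one_mul] at h2'
      rcases lt_or_ge C'.length s with hlt'' | hge
      · exact ih _ hlt'' h ⟨C', hC', rfl, h2'⟩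
      · exact ihn (ln C') (by omega) h C' hC' (by omega) h2' rfl
    · rw [hq1 (ihn (ln B') (by omega) p B' hB' (by omega) h1 rfl)] at h2'
      obtain rfl : C' = [] := List.eq_nil_of_length_eq_zero (by omega)
      simp only [inv_one, mul_one, mul_inv_cancel, one_mul, evC_nil] at h2'
      exact D.of_inj (by rw [← h2', map_one])

end Setup

/-! ### The isoperimetric inequality -/

namespace Setup

/-- The sequence of gaps of a word all of whose letters lie on the boundary. -/
def bdGaps {K : Type*} : Option Bool → K → List (Bool × K) → List (Gap K)
  | o, h, [] => [⟨.bd o, .bd none, h, 0⟩]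
  | o, h, (u, v) :: ps => ⟨.bd o, .bd (some u), h, 0⟩ :: bdGaps (some u) v ps

theorem path_bdGaps (o : Option Bool) (h : H) (ps) : D.Path δ (.bd o) (bdGaps o h ps) := by
  induction ps generalizing o h with
  | nil => exact .last ⟨.bd o, .bd none, h, 0⟩ ⟨false, .single (.bdbd _ _ _)⟩ rfl
  | cons x ps ih =>
    exact .cons ⟨.bd o, .bd (some x.1), h, 0⟩ _ ⟨false, .single (.bdbd _ _ _)⟩ rfl (ih _ _)

theorem val_bdGaps (o : Option Bool) (h : H) (ps) :
    D.val (bdGaps o h ps) = D.tau (.bd o) * D.of h * D.ev (toks ps) := by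
  induction ps generalizing o h with
  | nil => simp [bdGaps, gv]
  | cons x ps ih => simp [bdGaps, gv, ih, tau, Side.ex, mul_assoc]

theorem psi_bdGaps {K : Type*} (o : Option Bool) (h : K) (ps) :
    psi (bdGaps o h ps) = (if o.isSome then 108 else 0) + 108 * ps.length := by
  induction ps generalizing o h with
  | nil => simp [bdGaps, wt, Side.isBd, Side.ex]
  | cons x ps ih =>
    simp [bdGaps, wt, Side.isBd, Side.ex, ih]
    ring

theorem rem_bdGaps {o : Option Bool} {h : H} {ps r z} (hr : D.Rem r (bdGaps o h ps) z) :
    r = [] := by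
  induction ps generalizing o h r z with
  | nil =>
    cases hr with
    | skip _ hr => cases hr; rfl
    | take _ _ _ hg => simp at hg
  | cons x ps ih =>
    cases hr with
    | skip _ hr => exact ih hr
    | take _ _ _ hg => simp at hg

theorem exists_toks (T : List (Tok H)) :
    ∃ h ps, D.ev T = D.of h * D.ev (toks ps) ∧ ps.length = numT T := by
  induction T with
  | nil => exact ⟨1, [], by simp, rfl⟩
  | cons c T ih =>
    obtain ⟨h, ps, h1, h2⟩ := ih
    cases c with
    | h g => exact ⟨g * h, ps, by simp [h1, mul_assoc], by simpa [numT, Tok.num] using h2⟩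
    | t u =>
      exact ⟨1, (u, h) :: ps, by simp [h1], by
        simp [numT, Tok.num] at h2 ⊢; omega⟩

/-- A product of conjugates of the relator spelled by a word with `n` stable letters is a product of
at most `54 * n` conjugates. -/
theorem Ar.exists_le {n : ℕ} {T : List (Tok H)} (h : D.Ar n (D.ev T)) :
    ∃ s ≤ 54 * numT T, D.Ar s (D.ev T) := by
  classical
  have hex : ∃ n, D.Ar n (D.ev T) := ⟨n, h⟩
  refine ⟨Nat.find hex, ?_, Nat.find_spec hex⟩
  obtain ⟨g, ps, h1, h2⟩ := D.exists_toks T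
  have hv : D.val (bdGaps none g ps) = D.ev T := by simp [val_bdGaps, h1, tau, Side.ex]
  have hH : D.Holds 0 (Nat.find hex) (bdGaps none g ps) := by
    refine ⟨path_bdGaps _ _ _, by rw [hv]; exact Nat.find_spec hex, fun r z j _ hr hj => ?_⟩
    obtain rfl := rem_bdGaps hr
    rw [rem_nil_iff.1 hr, hv] at hj
    simpa using Nat.find_min' hex hj
  have := hH.two_mul_le (by norm_num) (by norm_num) _ _ le_rfl fun j _ => D.inj j
  rw [psi_bdGaps, h2] at this
  simp at this
  omega

end Setup

/-! ### HNN extensions -/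

section HNN

theorem evalTok_append (of : H →* E) (t : E) (T T' : List (Tok H)) :
    evalTok of t (T ++ T') = evalTok of t T * evalTok of t T' := by
  induction T with
  | nil => simp [evalTok]
  | cons c T ih => cases c <;> simp [evalTok, ih, mul_assoc]

theorem exists_evalTok_inv (of : H →* E) (t : E) (T : List (Tok H)) :
    ∃ T', evalTok of t T' = (evalTok of t T)⁻¹ := by
  induction T with
  | nil => exact ⟨[], by simp [evalTok]⟩
  | cons c T ih =>
    obtain ⟨T', h⟩ := ih
    cases c with
    | h g => exact ⟨T' ++ [.h g⁻¹], by simp [evalTok_append, evalTok, h]⟩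
    | t u => exact ⟨T' ++ [.t (!u)], by simp [evalTok_append, evalTok, h, Setup.sgn_not]⟩

theorem map_sgn {E' : Type*} [Group E'] (f : E →* E') (t : E) (u : Bool) :
    f (sgn t u) = sgn (f t) u := by
  cases u <;> simp [sgn]

theorem map_evalTok {E' : Type*} [Group E'] (f : E →* E') (of : H →* E) (t : E)
    (T : List (Tok H)) : f (evalTok of t T) = evalTok (f.comp of) (f t) T := by
  induction T with
  | nil => simp [evalTok]
  | cons c T ih => cases c <;> simp [evalTok, ih, map_sgn]

/-- A pair of opposite stable letters enclosing an element of an associated subgroup. -/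
def Pinch (of : H →* E) (t : E) (S : Bool → Subgroup H) (T : List (Tok H)) : Prop :=
  ∃ X v Y Z, T = X ++ .t v :: (Y ++ .t (!v) :: Z) ∧ ∃ p ∈ S v, evalTok of t Y = of p

theorem Pinch.cons {of : H →* E} {t : E} {S : Bool → Subgroup H} {T : List (Tok H)}
    (h : Pinch of t S T) (c : Tok H) : Pinch of t S (c :: T) := by
  obtain ⟨X, v, Y, Z, rfl, h⟩ := h
  exact ⟨c :: X, v, Y, Z, rfl, h⟩

theorem pinch_or_reduced (of : H →* E) (t : E) (S : Bool → Subgroup H) (T : List (Tok H)) :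
    Pinch of t S T ∨ ∃ (g : H) (l : List (Bool × H)),
      l.IsChain (fun a b => a.2 ∈ S a.1 → a.1 = b.1) ∧
      evalTok of t T = of g * (l.map fun x => sgn t x.1 * of x.2).prod ∧
      (∀ x ∈ l.head?, ∃ Y Z, T = Y ++ .t x.1 :: Z ∧ evalTok of t Y = of g) ∧
      ((∃ u, .t u ∈ T) → l ≠ []) := by
  induction T with
  | nil => exact Or.inr ⟨1, [], .nil, by simp [evalTok], by simp, by simp⟩
  | cons c T ih =>
    rcases ih with h | ⟨g, l, h1, h2, h3, h4⟩
    · exact Or.inl (h.cons c)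
    cases c with
    | h g' =>
      refine Or.inr ⟨g' * g, l, h1, by simp [evalTok, h2, mul_assoc], fun x hx => ?_,
        fun ⟨u, hu⟩ => h4 ⟨u, by simpa using hu⟩⟩
      obtain ⟨Y, Z, rfl, h⟩ := h3 x hx
      exact ⟨.h g' :: Y, Z, rfl, by simp [evalTok, h]⟩
    | t u =>
      by_cases hp : ∃ x ∈ l.head?, g ∈ S u ∧ u ≠ x.1
      · obtain ⟨x, hx, hg, hne⟩ := hp
        obtain ⟨Y, Z, rfl, h⟩ := h3 x hx
        refine Or.inl ⟨[], u, Y, Z, ?_, g, hg, h⟩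
        rw [Bool.eq_not_of_ne hne]
        simp
      · refine Or.inr ⟨1, (u, g) :: l, ?_, ?_, ?_, by simp⟩
        · rw [List.isChain_cons]
          exact ⟨fun x hx hg => by_contra fun hne => hp ⟨x, hx, hg, hne⟩, h1⟩
        · simp [evalTok, h2, mul_assoc]
        · rintro x hx
          simp only [List.head?_cons, Option.mem_def, Option.some.injEq] at hx
          subst hx
          exact ⟨[], T, rfl, by simp [evalTok]⟩

theorem exists_partner {of : H →* E} {t : E} {S : Bool → Subgroup H}
    (hconj : ∀ u, ∀ p ∈ S u, ∃ q ∈ S (!u), sgn t u * of p = of q * sgn t u)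
    (hpinch : ∀ T, (∃ u, .t u ∈ T) → evalTok of t T ∈ of.range → Pinch of t S T)
    (n : ℕ) : ∀ (u : Bool) (T : List (Tok H)), T.length ≤ n → evalTok of t (.t u :: T) ∈ of.range →
      ∃ T₁ T₂, T = T₁ ++ .t (!u) :: T₂ ∧ ∃ p ∈ S u, evalTok of t T₁ = of p := by
  induction n using Nat.strong_induction_on with
  | _ n ih =>
  intro u T hn hT
  obtain ⟨X, v, Y, Z, he, p, hp, hY⟩ := hpinch _ ⟨u, by simp⟩ hT
  rcases X with _ | ⟨c, X⟩
  · simp only [List.nil_append, List.cons.injEq, Tok.t.injEq] at he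
    obtain ⟨rfl, rfl⟩ := he
    exact ⟨Y, Z, rfl, p, hp, hY⟩
  · simp only [List.cons_append, List.cons.injEq] at he
    obtain ⟨rfl, rfl⟩ := he
    obtain ⟨q, hq, hc⟩ := hconj v p hp
    have key : ∀ Z, evalTok of t (.t v :: (Y ++ .t (!v) :: Z)) = evalTok of t (.h q :: Z) := by
      intro Z
      simp only [evalTok, evalTok_append, hY, Setup.sgn_not]
      rw [← mul_assoc, hc]
      group
    have := ih (X ++ .h q :: Z).length (by simp at hn ⊢; omega) u _ le_rfl (by
      simp only [evalTok, evalTok_append] at hT key ⊢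
      rwa [← key])
    obtain ⟨T₁, T₂, he, p', hp', hT₁⟩ := this
    rcases List.split_append he with ⟨y, rfl, rfl⟩ | ⟨y, hy, rfl⟩
    · exact ⟨T₁, y ++ .t v :: (Y ++ .t (!v) :: Z), by simp, p', hp', hT₁⟩
    · rcases y with _ | ⟨c, y⟩
      · simp at hy
      · simp only [List.cons_append, List.cons.injEq] at hy
        obtain ⟨rfl, rfl⟩ := hy
        refine ⟨X ++ .t v :: (Y ++ .t (!v) :: y), T₂, by simp, p', hp', ?_⟩
        rw [evalTok_append, key, ← evalTok_append, hT₁]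

variable {A B : Subgroup H} {φ : A ≃* B}

/-- The associated subgroups. -/
def assoc (A B : Subgroup H) (u : Bool) : Subgroup H := bif u then A else B

theorem hnn_conj (u : Bool) (p : H) (hp : p ∈ assoc A B u) : ∃ q ∈ assoc A B (!u),
    sgn (HNNExtension.t : HNNExtension H A B φ) u * HNNExtension.of p =
      HNNExtension.of q * sgn HNNExtension.t u := by
  cases u
  · exact ⟨_, (φ.symm ⟨p, hp⟩).2, HNNExtension.inv_t_mul_of ⟨p, hp⟩⟩
  · exact ⟨_, (φ ⟨p, hp⟩).2, HNNExtension.t_mul_of ⟨p, hp⟩⟩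

theorem hnn_pinch (T : List (Tok H)) (hT : ∃ u, .t u ∈ T)
    (h : evalTok (HNNExtension.of : H →* HNNExtension H A B φ) .t T ∈
      (HNNExtension.of : H →* HNNExtension H A B φ).range) :
    Pinch (HNNExtension.of : H →* HNNExtension H A B φ) .t (assoc A B) T := by
  refine (pinch_or_reduced _ _ _ T).resolve_right ?_
  rintro ⟨g, l, h1, h2, -, h4⟩
  let σ : Bool → ℤˣ := fun u => bif u then 1 else -1
  have hσ : ∀ u, HNNExtension.toSubgroup A B (σ u) = assoc A B u := by
    rintro (_ | _) <;> rfl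
  have hσ' : Function.Injective σ := by
    rintro (_ | _) (_ | _) h
    · rfl
    · exact absurd h (by decide)
    · exact absurd h (by decide)
    · rfl
  let W : HNNExtension.NormalWord.ReducedWord H A B := ⟨g, l.map fun x => (σ x.1, x.2), by
    rw [List.isChain_map]
    refine h1.imp fun a b hab => ?_
    rw [hσ]
    exact fun h => congrArg σ (hab h)⟩
  have := HNNExtension.ReducedWord.toList_eq_nil_of_mem_of_range φ W (by
    convert h using 1
    rw [h2, HNNExtension.NormalWord.ReducedWord.prod]
    congr 2
    rw [List.map_map]
    refine List.map_congr_left fun x _ => ?_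
    rcases x with ⟨_ | _, x⟩ <;> simp [σ, sgn])
  exact h4 hT (List.map_eq_nil_iff.1 this)

/-- HNN extensions have a stable letter. -/
def StableLetter.ofHNN (f : HNNExtension H A B φ ≃* E) : StableLetter H E where
  of := f.toMonoidHom.comp HNNExtension.of
  of_inj := f.injective.comp (HNNExtension.of_injective φ)
  t := f .t
  Sub := assoc A B
  conj u p hp := by
    obtain ⟨q, hq, h⟩ := hnn_conj (φ := φ) u p hp
    refine ⟨q, hq, ?_⟩
    have := congrArg f h
    rw [map_mul, map_mul] at this
    have e := map_sgn f.toMonoidHom (HNNExtension.t : HNNExtension H A B φ) u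
    simp only [MulEquiv.toMonoidHom_eq_coe, MonoidHom.coe_coe] at e
    exact e ▸ this
  gen g := by
    obtain ⟨g, rfl⟩ := f.surjective g
    induction g using HNNExtension.induction_on with
    | of g => exact ⟨[.h g], by simp [evalTok]⟩
    | t => exact ⟨[.t true], by simp [evalTok, sgn]⟩
    | mul x y hx hy =>
      obtain ⟨T, hT⟩ := hx
      obtain ⟨T', hT'⟩ := hy
      exact ⟨T ++ T', by rw [evalTok_append, hT, hT', map_mul]⟩
    | inv x hx =>
      obtain ⟨T, hT⟩ := hx
      obtain ⟨T', hT'⟩ := exists_evalTok_inv (f.toMonoidHom.comp HNNExtension.of) (f .t) T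
      exact ⟨T', by rw [hT', hT, map_inv]⟩
  partner u T hT := by
    have hT' : evalTok (HNNExtension.of : H →* HNNExtension H A B φ) .t (.t u :: T) ∈
        (HNNExtension.of : H →* HNNExtension H A B φ).range := by
      obtain ⟨g, hg⟩ := hT
      refine ⟨g, f.injective ?_⟩
      exact hg.trans (map_evalTok f.toMonoidHom _ _ _).symm
    obtain ⟨T₁, T₂, h, p, hp, e⟩ := exists_partner hnn_conj hnn_pinch _ u T le_rfl hT'
    refine ⟨T₁, T₂, h, p, hp, ?_⟩
    exact (map_evalTok f.toMonoidHom _ _ _).symm.trans (congrArg f e)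

end HNN

/-! ### Factors of free products -/

section CoprodI

open Monoid CoprodI

variable {ι : Type*} {M : ι → Type*} [∀ i, Group (M i)]

/-- The value of a list of syllables. -/
def sylProd (l : List (Σ i, M i)) : CoprodI M := (l.map fun c => of c.2).prod

theorem sylProd_ne_one {l : List (Σ i, M i)} (h : l ≠ []) (h1 : ∀ c ∈ l, c.2 ≠ 1)
    (h2 : l.IsChain fun c d => c.1 ≠ d.1) : sylProd l ≠ 1 := by
  classical
  intro he
  have : (⟨l, h1, h2⟩ : Word M) = Word.empty := Word.equiv.symm.injective <| by
    change sylProd l = Word.prod Word.empty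
    rw [he, Word.prod_empty]
  exact h (congrArg Word.toList this)

theorem exists_sylProd (g : CoprodI M) : ∃ l : List (Σ i, M i), (∀ c ∈ l, c.2 ≠ 1) ∧
    (l.IsChain fun c d => c.1 ≠ d.1) ∧ sylProd l = g := by
  classical
  exact ⟨(Word.equiv g).toList, (Word.equiv g).ne_one, (Word.equiv g).chain_ne,
    Word.equiv.symm_apply_apply g⟩

theorem sylProd_append (l l' : List (Σ i, M i)) :
    sylProd (l ++ l') = sylProd l * sylProd l' := by
  simp [sylProd]

theorem sylProd_mul_self_ne_one (hM : ∀ i, ∀ g : M i, g * g = 1 → g = 1) (n : ℕ) :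
    ∀ l : List (Σ i, M i), l.length ≤ n → l ≠ [] → (∀ c ∈ l, c.2 ≠ 1) →
      (l.IsChain fun c d => c.1 ≠ d.1) → sylProd l * sylProd l ≠ 1 := by
  induction n with
  | zero => intro l hl h; exact absurd (List.length_eq_zero_iff.1 (by omega)) h
  | succ n ih =>
    intro l hl hne h1 h2 he
    rcases l with _ | ⟨⟨i, a⟩, l⟩
    · exact hne rfl
    rcases List.eq_nil_or_concat l with rfl | ⟨l, ⟨j, b⟩, rfl⟩
    · have ha := h1 ⟨i, a⟩ (by simp)
      refine ha (hM i a (of_injective (M := M) i ?_))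
      simpa [sylProd] using he
    · rw [List.concat_eq_append] at *
      have ha : a ≠ 1 := h1 ⟨i, a⟩ (by simp)
      have hb : b ≠ 1 := h1 ⟨j, b⟩ (by simp)
      by_cases hij : j = i
      · subst hij
        rw [← List.cons_append] at h2
        have h3 := h2.left_of_append.tail
        have h4 := h2.tail
        simp only [List.cons_append, List.tail_cons] at h3 h4
        have hl0 : l ≠ [] := by
          rintro rfl
          simp at h2
        have hb1 : ∀ c ∈ l, c.2 ≠ 1 := fun c hc => h1 c (by simp [hc])
        by_cases hba : b * a = 1
        · refine ih l (by simp at hl; omega) hl0 hb1 h3 ?_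
          obtain rfl : b = a⁻¹ := eq_inv_of_mul_eq_one_left hba
          have : sylProd (⟨j, a⟩ :: (l ++ [⟨j, a⁻¹⟩])) = of a * sylProd l * (of a)⁻¹ := by
            simp [sylProd, mul_assoc]
          rw [this] at he
          have : (of a)⁻¹ * (of a * sylProd l * (of a)⁻¹ * (of a * sylProd l * (of a)⁻¹)) * of a
            = sylProd l * sylProd l := by group
          rw [← this, he]
          group
        · have h5 : (l ++ [(⟨j, b * a⟩ : Σ i, M i)]).IsChain fun c d => c.1 ≠ d.1 := by
            rw [List.isChain_append] at h4 ⊢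
            simpa using h4
          refine sylProd_ne_one (l := (l ++ [(⟨j, b * a⟩ : Σ i, M i)]) ++
            (l ++ [(⟨j, b * a⟩ : Σ i, M i)])) (by simp) ?_ ?_ ?_
          · intro c hc
            have : c ∈ l ∨ c = ⟨j, b * a⟩ := by simpa using (List.mem_append.1 hc).elim id id
            rcases this with h | rfl
            · exact hb1 c h
            · exact hba
          · rw [List.isChain_append]
            refine ⟨h5, h5, ?_⟩
            obtain ⟨c, l, rfl⟩ := List.exists_cons_of_ne_nil hl0
            have := (List.isChain_cons_cons.1 h2.left_of_append).1
            intro x hx y hy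
            rw [List.getLast?_concat, Option.mem_some_iff] at hx
            simp only [List.cons_append, List.head?_cons, Option.mem_some_iff] at hy
            exact hx ▸ hy ▸ this
          · have : sylProd (⟨j, a⟩ :: (l ++ [⟨j, b⟩])) = of a * sylProd l * of b := by
              simp [sylProd, mul_assoc]
            rw [this] at he
            have e : sylProd ((l ++ [(⟨j, b * a⟩ : Σ i, M i)]) ++
              (l ++ [(⟨j, b * a⟩ : Σ i, M i)])) =
              (of a)⁻¹ * (of a * sylProd l * of b * (of a * sylProd l * of b)) * of a := by
              simp [sylProd, mul_assoc]
            rw [e, he]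
            group
      · refine sylProd_ne_one (l := (⟨i, a⟩ :: (l ++ [⟨j, b⟩])) ++ (⟨i, a⟩ :: (l ++ [⟨j, b⟩])))
          (by simp) ?_ ?_ (by rw [sylProd_append, he])
        · intro c hc
          exact h1 c ((List.mem_append.1 hc).elim id id)
        · rw [List.isChain_append]
          refine ⟨h2, h2, ?_⟩
          rw [← List.cons_append, List.getLast?_append]
          simpa using hij

theorem coprodI_mul_self_ne_one (hM : ∀ i, ∀ g : M i, g * g = 1 → g = 1) {g : CoprodI M}
    (hg : g ≠ 1) : g * g ≠ 1 := by
  obtain ⟨l, h1, h2, rfl⟩ := exists_sylProd g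
  refine sylProd_mul_self_ne_one hM _ l le_rfl ?_ h1 h2
  rintro rfl
  exact hg rfl

/-- `g` is represented by a reduced word with given first and last indices. -/
def IsNe (i j : ι) (g : CoprodI M) : Prop := ∃ w : NeWord M i j, w.prod = g

theorem IsNe.ne_one {i j : ι} {g : CoprodI M} (h : IsNe i j g) : g ≠ 1 := by
  obtain ⟨w, rfl⟩ := h
  exact sylProd_ne_one w.toList_ne_nil w.toWord.ne_one w.toWord.chain_ne

theorem IsNe.inv {i j : ι} {g : CoprodI M} (h : IsNe i j g) : IsNe j i g⁻¹ := by
  obtain ⟨w, rfl⟩ := h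
  exact ⟨w.inv, w.inv_prod⟩

theorem isNe_of_list {l : List (Σ i, M i)} (h : l ≠ []) (h1 : ∀ c ∈ l, c.2 ≠ 1)
    (h2 : l.IsChain fun c d => c.1 ≠ d.1) : ∃ c ∈ l.head?, ∃ d ∈ l.getLast?,
      IsNe c.1 d.1 (sylProd l) := by
  obtain ⟨i, j, w, hw⟩ := NeWord.of_word ⟨l, h1, h2⟩ (fun e => h (congrArg Word.toList e))
  obtain rfl : w.toList = l := congrArg Word.toList hw
  exact ⟨⟨i, _⟩, w.toList_head?, ⟨j, _⟩, w.toList_getLast?, w, rfl⟩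

theorem exists_core {α : Type*} (p : α → Prop) (l : List α) : (∀ c ∈ l, ¬ p c) ∨
    ∃ a b c, l = a ++ b ++ c ∧ b ≠ [] ∧ (∀ d ∈ a, ¬ p d) ∧ (∀ d ∈ c, ¬ p d) ∧
      (∀ d ∈ b.head?, p d) ∧ ∀ d ∈ b.getLast?, p d := by
  induction l with
  | nil => exact Or.inl (by simp)
  | cons x l ih =>
    by_cases hx : p x
    · right
      rcases ih with h | ⟨a, b, c, rfl, h1, h2, h3, h4, h5⟩
      · exact ⟨[], [x], l, by simp, by simp, by simp, h, by simpa, by simpa⟩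
      · refine ⟨[], x :: (a ++ b), c, by simp, by simp, by simp, h3, by simpa, ?_⟩
        rw [← List.cons_append, List.getLast?_append]
        obtain ⟨b, y, rfl⟩ := (List.eq_nil_or_concat b).resolve_left h1
        simpa using h5
    · rcases ih with h | ⟨a, b, c, rfl, h1, h2, h3, h4, h5⟩
      · exact Or.inl (by simpa [hx] using h)
      · exact Or.inr ⟨x :: a, b, c, by simp, h1, by simpa [hx] using h2, h3, h4, h5⟩

variable {S : Subgroup (CoprodI M)} {i₀ : ι}

theorem sylProd_mem (hS : ∀ i ≠ i₀, ∀ g : M i, of g ∈ S) {l : List (Σ i, M i)}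
    (h : ∀ c ∈ l, c.1 ≠ i₀) : sylProd l ∈ S :=
  S.list_prod_mem fun x hx => by
    obtain ⟨c, hc, rfl⟩ := List.mem_map.1 hx
    exact hS _ (h c hc) _

theorem exists_isNe_core (hS : ∀ i ≠ i₀, ∀ g : M i, of g ∈ S) {x : CoprodI M} (hx : x ∉ S) :
    ∃ a ∈ S, ∃ b ∈ S, ∃ y, IsNe i₀ i₀ y ∧ x = a * y * b := by
  obtain ⟨l, h1, h2, rfl⟩ := exists_sylProd x
  rcases exists_core (fun c : Σ i, M i => c.1 = i₀) l with h | ⟨a, b, c, rfl, hb, h3, h4, h5, h6⟩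
  · exact absurd (sylProd_mem hS h) hx
  · refine ⟨sylProd a, sylProd_mem hS h3, sylProd c, sylProd_mem hS h4, sylProd b, ?_, by
      simp only [sylProd_append]⟩
    obtain ⟨c, hc, d, hd, h⟩ := isNe_of_list hb (fun d hd => h1 d (by simp [hd]))
      h2.left_of_append.right_of_append
    rwa [h5 c hc, h6 d hd] at h

theorem exists_isNe_of_mem (hS : S ≤ Subgroup.closure {g | ∃ i ≠ i₀, ∃ m : M i, of m = g})
    {s : CoprodI M} (hs : s ∈ S) (h1 : s ≠ 1) : ∃ i ≠ i₀, ∃ j ≠ i₀, IsNe i j s := by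
  classical
  have key : ∀ c ∈ (s • (Word.empty : Word M)).toList, c.1 ≠ i₀ := by
    have := hS hs
    clear h1 hs
    induction this using Subgroup.closure_induction_left with
    | one => simp [Word.empty]
    | mul_left x hx y hy ih =>
      obtain ⟨i, hi, m, rfl⟩ := hx
      rintro ⟨j, c⟩ hc rfl
      rw [mul_smul] at hc
      exact ih ⟨j, c⟩ ((Word.mem_smul_iff_of_ne hi.symm).1 hc) rfl
    | inv_mul_cancel x hx y hy ih =>
      obtain ⟨i, hi, m, rfl⟩ := hx
      rintro ⟨j, c⟩ hc rfl
      rw [mul_smul, ← map_inv] at hc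
      exact ih ⟨j, c⟩ ((Word.mem_smul_iff_of_ne hi.symm).1 hc) rfl
  have e : sylProd (s • (Word.empty : Word M)).toList = s := by
    change Word.prod _ = _
    rw [Word.prod_smul, Word.prod_empty, mul_one]
  obtain ⟨c, hc, d, hd, h⟩ := isNe_of_list (l := (s • (Word.empty : Word M)).toList) (fun h => by
    rw [h] at e; exact h1 e.symm) (Word.ne_one _) (Word.chain_ne _)
  rw [e] at h
  exact ⟨_, key c (List.mem_of_mem_head? hc), _, key d (List.mem_of_mem_getLast? hd), h⟩

theorem noShortRel_of_coprodI (hM : ∀ i, ∀ g : M i, g * g = 1 → g = 1)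
    (hS : ∀ i ≠ i₀, ∀ g : M i, of g ∈ S)
    (hS' : S ≤ Subgroup.closure {g | ∃ i ≠ i₀, ∃ m : M i, of m = g}) : NoShortRel S := by
  intro x hx
  obtain ⟨a, ha, b, hb, y, hy, rfl⟩ := exists_isNe_core hS hx
  have mul : ∀ {g s h : CoprodI M}, s ∈ S → s ≠ 1 → IsNe i₀ i₀ g → IsNe i₀ i₀ h →
      IsNe i₀ i₀ (g * s * h) := by
    rintro g s h hs h1 ⟨g, rfl⟩ ⟨h, rfl⟩
    obtain ⟨i, hi, j, hj, s, rfl⟩ := exists_isNe_of_mem hS' hs h1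
    exact ⟨.append (.append g hi.symm s) hj h, by simp⟩
  have last : ∀ {g s : CoprodI M}, s ∈ S → IsNe i₀ i₀ g → g * s ≠ 1 := by
    rintro g s hs hg h
    by_cases h1 : s = 1
    · exact hg.ne_one (by rwa [h1, mul_one] at h)
    · obtain ⟨g, rfl⟩ := hg
      obtain ⟨i, hi, j, hj, s, rfl⟩ := exists_isNe_of_mem hS' hs h1
      exact IsNe.ne_one ⟨.append g hi.symm s, by simp⟩ h
  have conj : ∀ {c p : CoprodI M}, c ∈ S → p ∈ S → c⁻¹ * p * c ∈ S := fun hc hp =>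
    S.mul_mem (S.mul_mem (S.inv_mem hc) hp) hc
  have conj' : ∀ {c p : CoprodI M}, c ∈ S → p ∈ S → c * p * c⁻¹ ∈ S := fun hc hp =>
    S.mul_mem (S.mul_mem hc hp) (S.inv_mem hc)
  have conj1 : ∀ {c p : CoprodI M}, p ≠ 1 → c⁻¹ * p * c ≠ 1 := fun hp h => hp (by
    rwa [mul_eq_one_iff_eq_inv, mul_eq_left] at h)
  have conj1' : ∀ {c p : CoprodI M}, p ≠ 1 → c * p * c⁻¹ ≠ 1 := fun hp h => hp (by simpa using h)
  have sand : ∀ {p}, p ∈ S → b * p * a ∈ S := fun hp => S.mul_mem (S.mul_mem hb hp) ha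
  have rot : ∀ {g : CoprodI M}, g = 1 → a⁻¹ * g * a = 1 := by
    rintro g rfl
    group
  refine ⟨fun p hp q hq h => ?_, fun p hp q hq hp1 hq1 h => ?_,
    fun p hp q hq r hr hq1 hr1 h => ?_, fun p hp q hq r hr s hs hp1 hq1 hr1 hs1 h => ?_⟩
  · have e : y * (b * p * a) * y * (b * q * a) = 1 := by
      rw [← rot h]; group
    by_cases h1 : b * p * a = 1
    · by_cases h2 : b * q * a = 1
      · rw [h1, h2, mul_one, mul_one] at e
        exact coprodI_mul_self_ne_one hM hy.ne_one e
      · rw [h1, mul_one] at e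
        refine last (S.inv_mem (sand hq)) (mul (sand hq) h2 hy hy.inv) ?_
        rw [eq_inv_of_mul_eq_one_right e]
        group
    · exact last (sand hq) (mul (sand hp) h1 hy hy) e
  · refine last (conj ha hq) (mul (conj' hb hp) (conj1' hp1) hy hy.inv) ?_
    rw [← rot h]; group
  · have e : y * (b * p * a) * y * (b * q * b⁻¹) * y⁻¹ * (a⁻¹ * r * a) = 1 := by
      rw [← rot h]; group
    have h2 := mul (conj' hb hq) (conj1' hq1) hy hy.inv
    by_cases h1 : b * p * a = 1
    · refine (mul (conj ha hr) (conj1 hr1) h2 hy).ne_one ?_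
      rw [h1, mul_one] at e
      have : y * (b * q * b⁻¹) * y⁻¹ * (a⁻¹ * r * a) * y =
        y⁻¹ * (y * y * (b * q * b⁻¹) * y⁻¹ * (a⁻¹ * r * a)) * y := by group
      rw [this, e]
      group
    · refine last (conj ha hr) (mul (conj' hb hq) (conj1' hq1) (mul (sand hp) h1 hy hy) hy.inv) e
  · refine last (conj ha hs) (mul (conj' hb hr) (conj1' hr1)
      (mul (conj ha hq) (conj1 hq1) (mul (conj' hb hp) (conj1' hp1) hy hy.inv) hy) hy.inv) ?_
    rw [← rot h]; group

end CoprodI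

/-! ### Normal forms of relators -/

namespace StableLetter
variable (P : StableLetter H E)

/-- The product of the labels `x 0, ..., x j` separated by stable letters with alternating
exponents. -/
def alt (x : ℕ → H) : ℕ → E
  | 0 => P.of (x 0)
  | j + 1 => alt x j * sgn P.t (decide ((j + 1) % 2 = 1)) * P.of (x (j + 1))

variable {P}

theorem alt_congr {x y : ℕ → H} {j : ℕ} (h : ∀ i ≤ j, x i = y i) : P.alt x j = P.alt y j := by
  induction j with
  | zero => rw [alt, alt, h 0 le_rfl]
  | succ j ih => rw [alt, alt, ih fun i hi => h i (by omega), h _ le_rfl]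

theorem alt_update (x : ℕ → H) (j : ℕ) (g : H) :
    P.alt (Function.update x (j + 1) g) (j + 1) =
      P.alt x j * sgn P.t (decide ((j + 1) % 2 = 1)) * P.of g := by
  rw [alt, Function.update_self,
    alt_congr (y := x) fun i hi => Function.update_of_ne (by omega) _ _]

theorem alt_mul (x : ℕ → H) (j : ℕ) (g : H) :
    P.alt x j * P.of g = P.alt (Function.update x j (x j * g)) j := by
  cases j with
  | zero => simp [alt]
  | succ j => rw [alt_update, alt, map_mul]; simp only [mul_assoc]

theorem alt_reduce {x : ℕ → H} {l j : ℕ} (hl : x (l + 1) ∈ P.Sub (decide ((l + 1) % 2 = 1)))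
    (hj : l ≤ j) : ∃ y, P.alt y j = P.alt x (j + 2) := by
  obtain ⟨q, -, hq⟩ := P.conj _ _ hl
  refine ⟨fun i => if i < l then x i else if i = l then x l * q * x (l + 2) else x (i + 2), ?_⟩
  induction j, hj using Nat.le_induction with
  | base =>
    have e : (decide ((l + 1 + 1) % 2 = 1)) = !(decide ((l + 1) % 2 = 1)) := by
      rw [← decide_not]
      exact decide_eq_decide.2 (by omega)
    have : ∀ z : ℕ → H, z = Function.update x l (x l * (q * x (l + 2))) →
        P.alt z l = P.alt x (l + 2) := by
      rintro _ rfl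
      rw [← alt_mul, alt, alt, map_mul, e, Setup.sgn_not]
      have : P.alt x l * sgn P.t (decide ((l + 1) % 2 = 1)) * P.of (x (l + 1)) =
        P.alt x l * (P.of q * sgn P.t (decide ((l + 1) % 2 = 1))) := by rw [← hq, mul_assoc]
      rw [this]
      group
    rw [← this _ rfl]
    refine alt_congr fun i hi => ?_
    rcases hi.lt_or_eq with hi | rfl
    · rw [if_pos hi, Function.update_of_ne hi.ne]
    · simp [mul_assoc]
  | succ j hj ih =>
    rw [alt, ih, if_neg (by omega), if_neg (by omega)]
    change _ = P.alt x (j + 2) * sgn P.t (decide ((j + 2 + 1) % 2 = 1)) * P.of (x (j + 2 + 1))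
    rw [show decide ((j + 1) % 2 = 1) = decide ((j + 2 + 1) % 2 = 1) from
      decide_eq_decide.2 (by omega)]

/-- A conjugate of `w` is the product of `2 * m + 2` labels separated by stable letters. -/
def Rep (P : StableLetter H E) (w : E) (m : ℕ) : Prop :=
  ∃ c x, c * w * c⁻¹ = P.alt x (2 * m + 1)

theorem exists_setup (P : StableLetter H E) {w : E} {m₀ : ℕ} (hw : P.Rep w m₀) {k : ℕ}
    (hk : 2 ≤ k) (hP : ∀ u, NoShortRel (P.Sub u)) (h0 : ¬ P.Rep w 0 ∨ ∀ u, P.Sub u = ⊥) :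
    ∃ D : Setup H E, D.toStableLetter = P ∧ ∃ c, D.rel (.cell true 1) = c * w ^ k * c⁻¹ := by
  classical
  have hex : ∃ m, P.Rep w m := ⟨m₀, hw⟩
  obtain ⟨c, x, hx⟩ := Nat.find_spec hex
  have hmin := fun m => Nat.find_min hex (m := m)
  generalize Nat.find hex = m at hx hmin
  have hmem : ∀ l, 1 ≤ l → l ≤ 2 * m → x l ∉ P.Sub (decide (l % 2 = 1)) := by
    intro l h1 h2 h
    obtain ⟨l, rfl⟩ := Nat.exists_eq_add_of_le' h1
    obtain ⟨m, rfl⟩ : ∃ m', m = m' + 1 := ⟨m - 1, by omega⟩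
    obtain ⟨y, hy⟩ := alt_reduce (j := 2 * m + 1) h (by omega)
    exact hmin m (by omega) ⟨c, y, by rw [hx, hy]; rfl⟩
  let D : Setup H E :=
    { P with
      m := m
      x := Function.update x (2 * m + 1) (x (2 * m + 1) * x 0)
      k := k
      two_le := hk
      not_mem := fun l h1 h2 => by
        rw [Function.update_of_ne (by omega)]
        exact hmem l h1 h2
      noShortRel := hP
      pos_or_bot := h0.imp_left fun h => by
        by_contra h'
        obtain rfl : m = 0 := by omega
        exact h ⟨c, x, hx⟩ }
  have e1 : ∀ j ≤ 2 * m + 1, P.of (x 0) * D.ev (D.relTok j (.cell true 1)) =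
      P.alt (Function.update D.x 0 (x 0)) j := by
    intro j hj
    induction j with
    | zero => simp [alt, Setup.relTok]
    | succ j ih =>
      rw [Setup.relTok_succ', Side.iterate_next_true _ (by change 1 + j ≤ 2 * m + 1; omega),
        Setup.ev_append, ← mul_assoc, ih (by omega), alt, Function.update_of_ne (by omega)]
      simp only [Side.sg, Side.ex, Setup.label, Setup.ev_t, Setup.ev_h, Setup.ev_nil, mul_one,
        Option.getD_some, add_comm 1 j, Bool.true_beq, mul_assoc]
      rfl
  have hb : (Side.cell true 1).IsCell D.m := ⟨rfl, le_rfl, by omega⟩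
  have e2 : D.ev (D.relTok (2 * m + 1) (.cell true 1)) =
      (P.of (x 0))⁻¹ * (c * w * c⁻¹) * P.of (x 0) := by
    have := e1 (2 * m + 1) le_rfl
    rw [mul_assoc, eq_inv_mul_iff_mul_eq, this, hx]
    have e : Function.update D.x 0 (x 0) = Function.update x (2 * m + 1) (x (2 * m + 1) * x 0) := by
      funext i
      rcases i with _ | i
      · rw [Function.update_self, Function.update_of_ne (by omega)]
      · rw [Function.update_of_ne (by omega)]
    rw [e, alt_mul]
  have e3 : ∀ k, D.ev (D.relTok (k * (2 * m + 1)) (.cell true 1)) =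
      D.ev (D.relTok (2 * m + 1) (.cell true 1)) ^ k := by
    intro k
    induction k with
    | zero => simp [Setup.relTok]
    | succ k ih =>
      rw [Nat.succ_mul, Setup.relTok_add, Setup.ev_append, ih, pow_succ]
      congr 3
      exact hb.iterate_mul_period k
  refine ⟨D, rfl, (P.of (x 0))⁻¹ * c, ?_⟩
  change D.ev (D.relTok (k * (2 * m + 1)) (.cell true 1)) = _
  rw [e3, e2]
  have : (P.of (x 0))⁻¹ * (c * w * c⁻¹) * P.of (x 0) =
    ((P.of (x 0))⁻¹ * c) * w * ((P.of (x 0))⁻¹ * c)⁻¹ := by group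
  rw [this, conj_pow]

end StableLetter

/-! ### The free product with an infinite cyclic group as an HNN extension -/

section FP

open Monoid

variable {G : Type*} [Group G]

variable (G) in
/-- The free product of `n` copies of `G`. -/
abbrev Fac (n : ℕ) : Type _ := CoprodI fun _ : Fin n => G

variable (G) in
/-- The inclusion of the first `n` factors. -/
def low (n : ℕ) : Fac G n →* Fac G (n + 1) :=
  CoprodI.lift fun i => CoprodI.of (M := fun _ : Fin (n + 1) => G) (i := i.castSucc)

variable (G) in
/-- The inclusion of the last `n` factors. -/
def high (n : ℕ) : Fac G n →* Fac G (n + 1) :=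
  CoprodI.lift fun i => CoprodI.of (M := fun _ : Fin (n + 1) => G) (i := i.succ)

theorem low_of {n : ℕ} (i : Fin n) (g : G) :
    low G n (CoprodI.of (M := fun _ : Fin n => G) (i := i) g) =
      CoprodI.of (M := fun _ : Fin (n + 1) => G) (i := i.castSucc) g :=
  CoprodI.lift_of _ _

theorem high_of {n : ℕ} (i : Fin n) (g : G) :
    high G n (CoprodI.of (M := fun _ : Fin n => G) (i := i) g) =
      CoprodI.of (M := fun _ : Fin (n + 1) => G) (i := i.succ) g :=
  CoprodI.lift_of _ _

theorem range_low_le {n : ℕ} {S : Subgroup (Fac G (n + 1))}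
    (h : ∀ (i : Fin n) (g : G),
      CoprodI.of (M := fun _ : Fin (n + 1) => G) (i := i.castSucc) g ∈ S) :
    (low G n).range ≤ S :=
  CoprodI.lift_range_le (G := fun _ : Fin n => G) _ fun i => by
    rintro _ ⟨g, rfl⟩
    exact h i g

theorem range_high_le {n : ℕ} {S : Subgroup (Fac G (n + 1))}
    (h : ∀ (i : Fin n) (g : G),
      CoprodI.of (M := fun _ : Fin (n + 1) => G) (i := i.succ) g ∈ S) :
    (high G n).range ≤ S :=
  CoprodI.lift_range_le (G := fun _ : Fin n => G) _ fun i => by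
    rintro _ ⟨g, rfl⟩
    exact h i g

theorem low_injective (n : ℕ) : Function.Injective (low G n) := by
  let r : Fac G (n + 1) →* Fac G n := CoprodI.lift fun i =>
    Fin.lastCases (motive := fun _ => G →* Fac G n) 1
      (fun i => CoprodI.of (M := fun _ : Fin n => G) (i := i)) i
  have : r.comp (low G n) = MonoidHom.id _ := CoprodI.ext_hom _ _ fun i => by
    ext g
    simp only [MonoidHom.comp_apply, low_of]
    simp [r, CoprodI.lift_of]
  exact Function.LeftInverse.injective (g := r) (DFunLike.congr_fun this)

theorem high_injective (n : ℕ) : Function.Injective (high G n) := by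
  let r : Fac G (n + 1) →* Fac G n := CoprodI.lift fun i =>
    Fin.cases (motive := fun _ => G →* Fac G n) 1
      (fun i => CoprodI.of (M := fun _ : Fin n => G) (i := i)) i
  have : r.comp (high G n) = MonoidHom.id _ := CoprodI.ext_hom _ _ fun i => by
    ext g
    simp only [MonoidHom.comp_apply, high_of]
    simp [r, CoprodI.lift_of]
  exact Function.LeftInverse.injective (g := r) (DFunLike.congr_fun this)

variable (G) in
/-- The shift of the factors. -/
noncomputable def shift (n : ℕ) : (low G n).range ≃* (high G n).range :=
  (MonoidHom.ofInjective (low_injective n)).symm.trans (MonoidHom.ofInjective (high_injective n))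

theorem shift_low {n : ℕ} (c : Fac G n) :
    (shift G n ⟨low G n c, c, rfl⟩ : Fac G (n + 1)) = high G n c := by
  have : (⟨low G n c, c, rfl⟩ : (low G n).range) = MonoidHom.ofInjective (low_injective n) c := rfl
  rw [this, shift, MulEquiv.trans_apply, MulEquiv.symm_apply_apply]
  rfl

variable (G) in
/-- The map sending the factors to the conjugates of `G` by powers of the free generator. -/
def toFP (n : ℕ) : Fac G n →* FP G :=
  CoprodI.lift fun i => (MulAut.conj (tgen G ^ (i : ℕ))).toMonoidHom.comp (emb G)

theorem toFP_of {n : ℕ} (i : Fin n) (g : G) :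
    toFP G n (CoprodI.of (M := fun _ : Fin n => G) (i := i) g) =
      tgen G ^ (i : ℕ) * emb G g * (tgen G ^ (i : ℕ))⁻¹ :=
  CoprodI.lift_of _ _

theorem toFP_low {n : ℕ} (c : Fac G n) : toFP G (n + 1) (low G n c) = toFP G n c := by
  have : (toFP G (n + 1)).comp (low G n) = toFP G n := CoprodI.ext_hom _ _ fun i => by
    ext g
    simp only [MonoidHom.comp_apply, low_of, toFP_of, Fin.val_castSucc]
  exact DFunLike.congr_fun this c

theorem toFP_high {n : ℕ} (c : Fac G n) :
    toFP G (n + 1) (high G n c) = tgen G * toFP G n c * (tgen G)⁻¹ := by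
  have : (toFP G (n + 1)).comp (high G n) =
      (MulAut.conj (tgen G)).toMonoidHom.comp (toFP G n) := CoprodI.ext_hom _ _ fun i => by
    ext g
    simp only [MonoidHom.comp_apply, high_of, toFP_of, Fin.val_succ, MulEquiv.toMonoidHom_eq_coe,
      MonoidHom.coe_coe, MulAut.conj_apply, pow_succ']
    group
  exact DFunLike.congr_fun this c

variable (G) in
/-- The HNN extension of the free product of copies of `G` by the shift. -/
abbrev Hnn (n : ℕ) : Type _ := HNNExtension (Fac G (n + 1)) _ _ (shift G n)

variable (G) in
/-- The map from the HNN extension. -/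
noncomputable def ofHnn (n : ℕ) : Hnn G n →* FP G :=
  HNNExtension.lift (toFP G (n + 1)) (tgen G) fun a => by
    obtain ⟨_, c, rfl⟩ := a
    rw [shift_low, toFP_low, toFP_high, inv_mul_cancel_right]

variable (G) in
/-- The map to the HNN extension. -/
noncomputable def toHnn (n : ℕ) : FP G →* Hnn G n :=
  Coprod.lift (HNNExtension.of.comp (CoprodI.of (M := fun _ : Fin (n + 1) => G) (i := 0)))
    (FreeGroup.lift fun _ => HNNExtension.t)

theorem toHnn_emb (n : ℕ) (g : G) : toHnn G n (emb G g) =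
    HNNExtension.of (CoprodI.of (M := fun _ : Fin (n + 1) => G) (i := 0) g) :=
  Coprod.lift_apply_inl _ _ _

theorem toHnn_tgen (n : ℕ) : toHnn G n (tgen G) = HNNExtension.t := by
  rw [toHnn, tgen, Coprod.lift_apply_inr, FreeGroup.lift_apply_of]

theorem ofHnn_t (n : ℕ) : ofHnn G n HNNExtension.t = tgen G := HNNExtension.lift_t _ _ _

theorem ofHnn_of (n : ℕ) (c : Fac G (n + 1)) :
    ofHnn G n (HNNExtension.of c) = toFP G (n + 1) c := HNNExtension.lift_of _ _ _ _

theorem t_mul_low {n : ℕ} (c : Fac G n) :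
    (HNNExtension.t : Hnn G n) * HNNExtension.of (low G n c) =
      HNNExtension.of (high G n c) * HNNExtension.t := by
  have := HNNExtension.t_mul_of (φ := shift G n) ⟨low G n c, c, rfl⟩
  rw [shift_low] at this
  exact this

theorem toHnn_conj (n : ℕ) (i : ℕ) (hi : i < n + 1) (g : G) :
    toHnn G n (tgen G ^ i * emb G g * (tgen G ^ i)⁻¹) =
      HNNExtension.of (CoprodI.of (M := fun _ : Fin (n + 1) => G) (i := ⟨i, hi⟩) g) := by
  induction i with
  | zero => simpa using toHnn_emb n g
  | succ i ih =>
    have e : tgen G ^ (i + 1) * emb G g * (tgen G ^ (i + 1))⁻¹ =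
      tgen G * (tgen G ^ i * emb G g * (tgen G ^ i)⁻¹) * (tgen G)⁻¹ := by
      rw [pow_succ']
      group
    rw [e, map_mul, map_mul, ih (by omega), map_inv, toHnn_tgen, mul_inv_eq_iff_eq_mul]
    have := t_mul_low (CoprodI.of (M := fun _ : Fin n => G) (i := ⟨i, by omega⟩) g)
    rwa [low_of, high_of] at this

variable (G) in
/-- The free product of `G` with an infinite cyclic group is an HNN extension. -/
noncomputable def hnnEquiv (n : ℕ) : Hnn G n ≃* FP G :=
  MonoidHom.toMulEquiv (ofHnn G n) (toHnn G n)
    (HNNExtension.hom_ext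
      (CoprodI.ext_hom _ _ fun i => by
        ext g
        simp only [MonoidHom.comp_apply, ofHnn_of, toFP_of, toHnn_conj n i i.2, MonoidHom.id_apply,
          Fin.eta])
      (by simp only [MonoidHom.comp_apply, ofHnn_t, toHnn_tgen, MonoidHom.id_apply]))
    (Coprod.hom_ext
      (by
        ext g
        change ofHnn G n (toHnn G n (emb G g)) = emb G g
        rw [toHnn_emb, ofHnn_of, toFP_of]
        simp)
      (by
        refine FreeGroup.ext_hom _ _ fun _ => ?_
        change ofHnn G n (toHnn G n (tgen G)) = tgen G
        rw [toHnn_tgen, ofHnn_t]))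

variable (G) in
/-- The stable letter structure on the free product. -/
noncomputable def fpLetter (n : ℕ) : StableLetter (Fac G (n + 1)) (FP G) :=
  StableLetter.ofHNN (hnnEquiv G n)

theorem fpLetter_of (n : ℕ) (c : Fac G (n + 1)) : (fpLetter G n).of c = toFP G (n + 1) c :=
  ofHnn_of n c

theorem fpLetter_t (n : ℕ) : (fpLetter G n).t = tgen G := ofHnn_t n

theorem noShortRel_fpLetter (hG : ∀ g : G, g * g = 1 → g = 1) (n : ℕ) (u : Bool) :
    NoShortRel ((fpLetter G n).Sub u) := by
  cases u
  · refine noShortRel_of_coprodI (i₀ := (0 : Fin (n + 1))) (fun _ => hG) (fun i hi g => ?_) ?_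
    · obtain ⟨j, rfl⟩ := Fin.exists_succ_eq.2 hi
      exact ⟨_, high_of j g⟩
    · exact range_high_le fun i g => Subgroup.subset_closure ⟨_, Fin.succ_ne_zero i, g, rfl⟩
  · refine noShortRel_of_coprodI (i₀ := Fin.last n) (fun _ => hG) (fun i hi g => ?_) ?_
    · obtain ⟨j, rfl⟩ := Fin.exists_castSucc_eq.2 hi
      exact ⟨_, low_of j g⟩
    · exact range_low_le fun i g =>
        Subgroup.subset_closure ⟨_, (Fin.castSucc_lt_last i).ne, g, rfl⟩

theorem sub_fpLetter_zero (u : Bool) : (fpLetter G 0).Sub u = ⊥ := by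
  cases u
  · exact eq_bot_iff.2 (range_high_le fun i => i.elim0)
  · exact eq_bot_iff.2 (range_low_le fun i => i.elim0)

theorem range_toFP_le (n : ℕ) : (toFP G n).range ≤ (toFP G (n + 1)).range := by
  rintro _ ⟨c, rfl⟩
  exact ⟨_, toFP_low c⟩

theorem conj_mem_range_toFP {n : ℕ} {v : FP G} (hv : v ∈ (toFP G n).range) :
    tgen G * v * (tgen G)⁻¹ ∈ (toFP G (n + 1)).range := by
  obtain ⟨c, rfl⟩ := hv
  exact ⟨_, toFP_high c⟩

theorem exists_evalTok_fp (w : FP G) : ∃ T, evalTok (emb G) (tgen G) T = w := by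
  induction w using Coprod.induction_on with
  | inl g => exact ⟨[.h g], mul_one _⟩
  | inr x =>
    induction x using FreeGroup.induction_on with
    | C1 => exact ⟨[], (map_one _).symm⟩
    | of => exact ⟨[.t true], mul_one _⟩
    | inv_of => exact ⟨[.t false], (mul_one _).trans (map_inv _ _).symm⟩
    | mul x y hx hy =>
      obtain ⟨T, hT⟩ := hx
      obtain ⟨T', hT'⟩ := hy
      exact ⟨T ++ T', by rw [evalTok_append, hT, hT', map_mul]⟩
  | mul x y hx hy =>
    obtain ⟨T, hT⟩ := hx
    obtain ⟨T', hT'⟩ := hy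
    exact ⟨T ++ T', by rw [evalTok_append, hT, hT']⟩

theorem exists_eq_pow_mul (w : FP G) : ∃ (N n : ℕ) (e : ℤ), ∃ v ∈ (toFP G n).range,
    w = (tgen G ^ N)⁻¹ * v * tgen G ^ e := by
  obtain ⟨T, rfl⟩ := exists_evalTok_fp w
  induction T with
  | nil => exact ⟨0, 0, 0, 1, one_mem _, by simp [evalTok]⟩
  | cons c T ih =>
    obtain ⟨N, n, e, v, hv, h⟩ := ih
    rcases c with g | _ | _
    · have mono := monotone_nat_of_le_succ (f := fun n => (toFP G n).range) range_toFP_le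
      refine ⟨N, max n (N + 1), e, tgen G ^ N * emb G g * (tgen G ^ N)⁻¹ * v,
        mul_mem (mono (le_max_right _ _) ⟨_, toFP_of (Fin.last N) g⟩)
          (mono (le_max_left _ _) hv), ?_⟩
      rw [evalTok, h]
      group
    · refine ⟨N + 1, n, e, v, hv, ?_⟩
      rw [evalTok, h, pow_succ]
      simp only [sgn, cond_false]
      group
    · refine ⟨N, n + 1, e + 1, _, conj_mem_range_toFP hv, ?_⟩
      rw [evalTok, h]
      simp only [sgn, cond_true]
      group

theorem exists_conj_of_unimodular {w : FP G} (hw : Unimodular w) :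
    ∃ n, ∃ c, ∃ v ∈ (toFP G n).range, c * w * c⁻¹ = v * tgen G := by
  obtain ⟨N, n, e, v, hv, h⟩ := exists_eq_pow_mul w
  have ht : expSum G (tgen G) = Multiplicative.ofAdd 1 := by
    rw [expSum, tgen, Coprod.lift_apply_inr, FreeGroup.lift_apply_of]
  have hg : ∀ g, expSum G (emb G g) = 1 := fun g => Coprod.lift_apply_inl _ _ _
  have h1 : (expSum G).comp (toFP G n) = 1 := CoprodI.ext_hom _ _ fun i => by
    ext g
    simp [toFP_of, hg]
  obtain ⟨c, rfl⟩ := hv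
  have h1 : expSum G (toFP G n c) = 1 := DFunLike.congr_fun h1 c
  have h2 : e = 1 + N := by
    have := congrArg Multiplicative.toAdd (hw.symm.trans (congrArg (expSum G) h))
    simp [h1, ht] at this
    omega
  refine ⟨n, tgen G ^ N, _, ⟨c, rfl⟩, ?_⟩
  rw [h, h2]
  group

theorem exists_alt {n : ℕ} {v : FP G} (hv : v ∈ (toFP G (n + 2)).range) :
    ∃ m x, v = (fpLetter G n).alt x (2 * m) := by
  obtain ⟨c, rfl⟩ := hv
  suffices ∀ m x, ∃ m' x', (fpLetter G n).alt x (2 * m) * toFP G (n + 2) c =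
      (fpLetter G n).alt x' (2 * m') by
    obtain ⟨m, x, h⟩ := this 0 1
    exact ⟨m, x, by rw [← h]; simp [StableLetter.alt]⟩
  induction c using CoprodI.induction_on with
  | one => exact fun m x => ⟨m, x, by rw [map_one, mul_one]⟩
  | mul a b ha hb =>
    intro m x
    obtain ⟨m', x', h⟩ := ha m x
    obtain ⟨m'', x'', h'⟩ := hb m' x'
    exact ⟨m'', x'', by rw [← h', ← h, map_mul, mul_assoc]⟩
  | of i g =>
    intro m x
    induction i using Fin.lastCases with
    | cast i =>
      rw [← low_of, toFP_low, ← fpLetter_of, StableLetter.alt_mul]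
      exact ⟨_, _, rfl⟩
    | last =>
      rw [← Fin.succ_last, ← high_of, toFP_high, ← fpLetter_of, ← fpLetter_t n]
      refine ⟨m + 1, Function.update (Function.update x (2 * m + 1)
        (CoprodI.of (M := fun _ : Fin (n + 1) => G) (i := Fin.last n) g)) (2 * m + 1 + 1) 1, ?_⟩
      rw [show 2 * (m + 1) = 2 * m + 1 + 1 by ring, StableLetter.alt_update,
        StableLetter.alt_update, show decide ((2 * m + 1) % 2 = 1) = true by simp,
        show decide ((2 * m + 1 + 1) % 2 = 1) = false by simp; omega]
      simp [sgn, mul_assoc]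

/-- Every unimodular word is conjugate to a relator in normal form. -/
theorem exists_setup_of_unimodular (hG : ∀ g : G, g * g = 1 → g = 1) {w : FP G} (hw : Unimodular w)
    {k : ℕ} (hk : 2 ≤ k) : ∃ (n : ℕ) (D : Setup (Fac G (n + 1)) (FP G)),
      D.toStableLetter = fpLetter G n ∧ ∃ c, D.rel (.cell true 1) = c * w ^ k * c⁻¹ := by
  classical
  have hex := exists_conj_of_unimodular hw
  obtain ⟨c, v, hv, h⟩ := Nat.find_spec hex
  have hmin := fun n => Nat.find_min hex (m := n)
  generalize Nat.find hex = n at hv hmin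
  have one : ∀ {n v c}, v ∈ (toFP G (n + 1)).range → c * w * c⁻¹ = v * tgen G →
      (fpLetter G n).Rep w 0 := by
    rintro n _ c ⟨v, rfl⟩ h
    refine ⟨c, Function.update 1 0 v, ?_⟩
    simp [StableLetter.alt, h, fpLetter_of, fpLetter_t, sgn]
  rcases n with _ | _ | n
  · exact ⟨0, (fpLetter G 0).exists_setup (one (range_toFP_le 0 hv) h) hk
      (noShortRel_fpLetter hG 0) (Or.inr sub_fpLetter_zero)⟩
  · exact ⟨0, (fpLetter G 0).exists_setup (one hv h) hk
      (noShortRel_fpLetter hG 0) (Or.inr sub_fpLetter_zero)⟩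
  · obtain ⟨m, x, rfl⟩ := exists_alt hv
    refine ⟨n, (fpLetter G n).exists_setup (m₀ := m)
      ⟨c, Function.update x (2 * m + 1) 1, ?_⟩ hk (noShortRel_fpLetter hG n) (Or.inl ?_)⟩
    · rw [StableLetter.alt_update, show decide ((2 * m + 1) % 2 = 1) = true by simp, h]
      simp [sgn, fpLetter_t]
    · rintro ⟨c, x, h⟩
      refine hmin (n + 1) (by omega) ⟨toFP G (n + 1) (x 1) * c, toFP G (n + 1) (x 1 * x 0),
        ⟨_, rfl⟩, ?_⟩
      have : toFP G (n + 1) (x 1) * c * w * (toFP G (n + 1) (x 1) * c)⁻¹ =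
        toFP G (n + 1) (x 1) * (c * w * c⁻¹) * (toFP G (n + 1) (x 1))⁻¹ := by group
      rw [this, h]
      simp [StableLetter.alt, fpLetter_of, fpLetter_t, sgn, mul_assoc]

end FP

/-! ### Products of conjugates -/

namespace Setup

theorem exists_rel_eq {w : E} {k : ℕ} {c : E} (hc : D.rel (.cell true 1) = c * w ^ k * c⁻¹)
    {b : Side} (hb : b.IsCell D.m) : ∃ (y : E) (e : ℤ), (e = 1 ∨ e = -1) ∧
      D.rel b = y * w ^ (e * (k : ℤ)) * y⁻¹ := by
  have key : ∀ l, (Side.cell true l).IsCell D.m → ∃ y,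
      D.rel (.cell true l) = y * w ^ k * y⁻¹ := by
    rintro l ⟨-, h1, h2⟩
    have := rel_mul_relTok (D := D) (b := .cell true 1) ⟨rfl, le_rfl, by omega⟩ (l - 1)
    rw [Side.iterate_next_true _ (by omega), Nat.add_sub_cancel' h1, ← inv_mul_eq_iff_eq_mul,
      hc] at this
    refine ⟨(D.ev (D.relTok (l - 1) (.cell true 1)))⁻¹ * c, ?_⟩
    rw [← this]
    group
  rcases b with ⟨_ | _, l⟩ | u
  · have hb' : (Side.cell true l).IsCell D.m := hb
    obtain ⟨y, hy⟩ := key l hb'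
    have := rel_mirror hb'
    rw [hy] at this
    refine ⟨(sgn D.t (Side.cell true l).sg)⁻¹ * y, -1, Or.inr rfl, ?_⟩
    change D.rel (.cell false l) = _ at this
    rw [this, neg_one_mul, zpow_neg, zpow_natCast]
    group
  · obtain ⟨y, hy⟩ := key l hb
    exact ⟨y, 1, Or.inl rfl, by rw [hy, one_mul, zpow_natCast]⟩
  · exact absurd hb.1 (by simp [Side.isBd])

theorem Ar.exists_ofFn {w : E} {k : ℕ} {c : E} (hc : D.rel (.cell true 1) = c * w ^ k * c⁻¹)
    {s : ℕ} {g : E} (h : D.Ar s g) : ∃ (x : Fin s → E) (ε : Fin s → ℤ),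
      (∀ i, ε i = 1 ∨ ε i = -1) ∧
      g = (List.ofFn fun i => x i * w ^ (ε i * (k : ℤ)) * (x i)⁻¹).prod := by
  obtain ⟨C, hC, rfl, rfl⟩ := h
  induction C with
  | nil => exact ⟨Fin.elim0, Fin.elim0, fun i => i.elim0, by simp⟩
  | cons b C ih =>
    obtain ⟨x, ε, h1, h2⟩ := ih fun c hc => hC c (by simp [hc])
    obtain ⟨y, e, he, h⟩ := exists_rel_eq hc (hC b (by simp))
    refine ⟨Fin.cons (D.ev b.1 * y) x, Fin.cons e ε, Fin.cases he h1, ?_⟩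
    obtain ⟨T, b⟩ := b
    rw [evC_cons, h, h2]
    change _ = (List.ofFn (n := C.length + 1) _).prod
    rw [List.ofFn_succ, List.prod_cons]
    simp only [Fin.cons_zero, Fin.cons_succ]
    group

theorem exists_ar_of_mem {w : E} {k : ℕ} {c : E} (hc : D.rel (.cell true 1) = c * w ^ k * c⁻¹)
    {g : E} (hg : g ∈ Subgroup.normalClosure {w ^ k}) : ∃ n, D.Ar n g := by
  have hb : (Side.cell true 1).IsCell D.m := ⟨rfl, le_rfl, by omega⟩
  induction hg using Subgroup.closure_induction with
  | mem x hx =>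
    obtain ⟨a, ha, hconj⟩ := Group.mem_conjugatesOfSet_iff.1 hx
    obtain rfl := Set.mem_singleton_iff.1 ha
    obtain ⟨y, rfl⟩ := isConj_iff.1 hconj
    refine ⟨1, ?_⟩
    have := (Ar.rel hb).conj (y * c⁻¹)
    rw [hc] at this
    convert this using 1
    group
  | one => exact ⟨0, Ar.one⟩
  | mul x y _ _ hx hy =>
    obtain ⟨n, hn⟩ := hx
    obtain ⟨n', hn'⟩ := hy
    exact ⟨_, hn.mul hn'⟩
  | inv x _ hx =>
    obtain ⟨n, hn⟩ := hx
    exact ⟨n, hn.inv⟩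

end Setup

open scoped Classical in
theorem exists_ev_eq_prod {G : Type*} [Group G] {n : ℕ} {D : Setup (Fac G (n + 1)) (FP G)}
    (hD : D.toStableLetter = fpLetter G n) (L : List (FP G))
    (hL : ∀ a ∈ L, (∃ g : G, a = emb G g) ∨ a = tgen G ∨ a = (tgen G)⁻¹) :
    ∃ T, D.ev T = L.prod ∧
      numT T ≤ L.countP fun a => decide (a = tgen G ∨ a = (tgen G)⁻¹) := by
  have ht : D.t = tgen G := by rw [hD, fpLetter_t]
  induction L with
  | nil => exact ⟨[], rfl, by simp⟩
  | cons a L ih =>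
    obtain ⟨T, h1, h2⟩ := ih fun b hb => hL b (by simp [hb])
    rcases hL a (by simp) with ⟨g, rfl⟩ | rfl | rfl
    · refine ⟨.h (Monoid.CoprodI.of (M := fun _ : Fin (n + 1) => G) (i := 0) g) :: T, ?_, ?_⟩
      · rw [Setup.ev_h, h1, hD, fpLetter_of, toFP_of, List.prod_cons]
        simp
      · rw [numT_h, List.countP_cons]
        omega
    · exact ⟨.t true :: T, by simp [h1, ht, sgn], by simpa using h2⟩
    · exact ⟨.t false :: T, by simp [h1, ht, sgn], by simpa using h2⟩

end RelIso

open scoped Classical in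
/-- Linear relative isoperimetric inequality for `k ≥ 2` when `G` is involution-free
(hence `G̃` is relatively hyperbolic with respect to `G`). -/
theorem linear_isoperimetric_of_involution_free {G : Type*} [Group G]
    (hG : ∀ g : G, orderOf g ≠ 2) (w : FP G)
    (hw : Unimodular w) (k : ℕ) (hk : 2 ≤ k) :
    ∃ C : ℕ, 0 < C ∧
      ∀ L : List (FP G),
        (∀ a ∈ L, (∃ g : G, a = emb G g) ∨ a = tgen G ∨ a = (tgen G)⁻¹) →
        L.prod ∈ Subgroup.normalClosure {w ^ k} →
        ∃ s : ℕ,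
          s ≤ C * (L.countP fun a => decide (a = tgen G ∨ a = (tgen G)⁻¹)) ∧
          ∃ (x : Fin s → FP G) (ε : Fin s → ℤ),
            (∀ i, ε i = 1 ∨ ε i = -1) ∧
            L.prod = (List.ofFn fun i => x i * w ^ (ε i * (k : ℤ)) * (x i)⁻¹).prod := by
  have hG' : ∀ g : G, g * g = 1 → g = 1 := fun g hg => by_contra fun h1 =>
    hG g (orderOf_eq_prime (by rwa [pow_two]) h1)
  obtain ⟨n, D, hD, c, hc⟩ := RelIso.exists_setup_of_unimodular hG' hw hk
  refine ⟨54, by norm_num, fun L hL hmem => ?_⟩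
  obtain ⟨T, hT, hnum⟩ := RelIso.exists_ev_eq_prod hD L hL
  obtain ⟨N, hN⟩ := RelIso.Setup.exists_ar_of_mem hc hmem
  rw [← hT] at hN
  obtain ⟨s, hs, hs'⟩ := hN.exists_le
  rw [hT] at hs'
  exact ⟨s, hs.trans (Nat.mul_le_mul_left _ hnum), hs'.exists_ofFn hc⟩
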